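/- arXiv:math/0403021 — 3 statements merged into one kernel-verified Lean document; each statement's English description precedes it below -/
import Mathlib

section
/- Let k be a field. Every quantum graded algebra with a straightening law on a finite poset (Π, ≤st) is a noetherian ring. -/
/-- A *quantum graded algebra with a straightening law* over the field `k`, on the finite
poset `ι` (whose elements are realised in `A` via the map `elem`). -/
structure QuantumGradedASL (k : Type*) [Field k] (A : Type*) [Ring A] [Algebra k A]
    (𝒜 : ℕ → Submodule k A) (ι : Type*) [PartialOrder ι] [Finite ι] where
  /-- the map realising the elements of the poset `Π = ι` as elements of `A` -/
  elem : ι → A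
  /-- `A` is an `ℕ`-graded `k`-algebra with grading `𝒜` -/
  graded : GradedAlgebra 𝒜
  /-- (1) the elements of `Π` are homogeneous of positive degree -/
  homog : ∀ i : ι, ∃ d : ℕ, 0 < d ∧ elem i ∈ 𝒜 d
  /-- (2) the elements of `Π` generate `A` as a `k`-algebra -/
  gen : Algebra.adjoin k (Set.range elem) = ⊤
  /-- (3) the standard monomials (products of the `elem i` along nondecreasing lists,
  the empty product being `1`) form a linearly independent family -/
  indep : LinearIndependent k
    (fun l : {l : List ι // l.Chain' (· ≤ ·)} => ((l : List ι).map elem).prod)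
  /-- (4) if `a`, `b` are incomparable then `elem a * elem b` is a linear combination of
  terms `elem lam` or `elem lam * elem mu` with `lam ≤ mu`, `lam < a` and `lam < b` -/
  straighten : ∀ a b : ι, ¬ a ≤ b → ¬ b ≤ a →
    elem a * elem b ∈ Submodule.span k {x : A | ∃ lam : ι, lam < a ∧ lam < b ∧
      (x = elem lam ∨ ∃ mu : ι, lam ≤ mu ∧ x = elem lam * elem mu)}
  /-- (5) for all `a`, `b` there is `0 ≠ c ∈ k` such that `elem a * elem b - c • (elem b * elem a)`
  is a linear combination of terms `elem lam` or `elem lam * elem mu` with `lam ≤ mu`,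
  `lam < a` and `lam < b` -/
  comm : ∀ a b : ι, ∃ c : k, c ≠ 0 ∧
    elem a * elem b - c • (elem b * elem a) ∈
      Submodule.span k {x : A | ∃ lam : ι, lam < a ∧ lam < b ∧
        (x = elem lam ∨ ∃ mu : ι, lam ≤ mu ∧ x = elem lam * elem mu)}

section MonomialFiltration

variable {k : Type*} [Field k] {A : Type*} [Ring A] [Algebra k A] {ι : Type*}
  {V : Type*} [AddCommMonoid V]

/-- The span of the words in the family `x` whose content has weight satisfying `P`. -/
def wordSpan (k : Type*) [Field k] {A : Type*} [Ring A] [Algebra k A] {ι V : Type*}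
    [AddCommMonoid V] (x : ι → A) (φ : Multiset ι →+ V) (P : V → Prop) : Submodule k A :=
  Submodule.span k {y | ∃ l : List ι, P (φ l) ∧ y = (l.map x).prod}

variable {x : ι → A} {φ : Multiset ι →+ V}

theorem prod_mem_wordSpan {P : V → Prop} {l : List ι} (h : P (φ l)) :
    (l.map x).prod ∈ wordSpan k x φ P :=
  Submodule.subset_span ⟨l, h, rfl⟩

theorem wordSpan_mono {P R : V → Prop} (h : ∀ v, P v → R v) :
    wordSpan k x φ P ≤ wordSpan k x φ R :=
  Submodule.span_mono fun _ ⟨l, hl, hy⟩ => ⟨l, h _ hl, hy⟩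

open MulOpposite in
theorem adjoin_range_op_eq_top (hgen : Algebra.adjoin k (Set.range x) = ⊤) :
    Algebra.adjoin k (Set.range fun i => op (x i)) = ⊤ := by
  have := Subalgebra.op_adjoin (R := k) (Set.range x)
  rw [hgen, Subalgebra.op_top] at this
  rw [this]
  congr 1
  ext y
  simp only [Set.mem_range, Set.mem_preimage]
  exact exists_congr fun i => by rw [← MulOpposite.op_unop y, MulOpposite.op_inj, unop_op]

variable [LinearOrder V]

/-- The generators `x` commute, up to nonzero scalars, modulo words of smaller weight. -/
def QuasiCommute (k : Type*) [Field k] {A : Type*} [Ring A] [Algebra k A] {ι V : Type*}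
    [AddCommMonoid V] [LinearOrder V] (x : ι → A) (φ : Multiset ι →+ V) : Prop :=
  ∀ a b : ι, ∃ c : k, c ≠ 0 ∧
    x a * x b - c • (x b * x a) ∈ wordSpan k x φ (· < φ (([a, b] : List ι) : Multiset ι))

open MulOpposite in
theorem QuasiCommute.op (hcomm : QuasiCommute k x φ) :
    QuasiCommute k (fun i => op (x i)) φ := by
  intro a b
  obtain ⟨c, hc, h⟩ := hcomm b a
  refine ⟨c, hc, ?_⟩
  have hle : wordSpan k x φ (· < φ (([b, a] : List ι) : Multiset ι)) ≤
      (wordSpan k (fun i => MulOpposite.op (x i)) φ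
        (· < φ (([a, b] : List ι) : Multiset ι))).comap
        (opLinearEquiv k : A ≃ₗ[k] Aᵐᵒᵖ).toLinearMap := by
    refine Submodule.span_le.2 ?_
    rintro _ ⟨l, hl, rfl⟩
    refine Submodule.subset_span ⟨l.reverse, ?_, ?_⟩
    · rwa [Multiset.coe_reverse, Multiset.coe_eq_coe.2 (List.Perm.swap b a [])]
    · simp [MulOpposite.op_list_prod, Function.comp_def]
  simpa using hle h

/-- The contents of leading words of elements of the left ideal `I`, together with the contents
of words which are reducible modulo words of smaller weight. -/
def leadingContents (k : Type*) [Field k] {A : Type*} [Ring A] [Algebra k A] {ι V : Type*}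
    [AddCommMonoid V] [LinearOrder V] (x : ι → A) (φ : Multiset ι →+ V)
    (I : Ideal A) : Set (Multiset ι) :=
  {s | ∃ l : List ι, (l : Multiset ι) = s ∧
    ∃ p ∈ wordSpan k x φ (· < φ s), (l.map x).prod + p ∈ I}

theorem leadingContents_mono {I J : Ideal A} (h : I ≤ J) :
    leadingContents k x φ I ⊆ leadingContents k x φ J :=
  fun _ ⟨l, hl, p, hp, hI⟩ => ⟨l, hl, p, hp, h hI⟩

variable [IsOrderedCancelAddMonoid V]

theorem prod_mul_mem_wordSpan (l : List ι) {v : V} {p : A}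
    (hp : p ∈ wordSpan k x φ (· < v)) :
    (l.map x).prod * p ∈ wordSpan k x φ (· < φ l + v) := by
  induction hp using Submodule.span_induction with
  | mem y hy =>
    obtain ⟨w, hw, rfl⟩ := hy
    rw [← List.prod_append, ← List.map_append]
    refine prod_mem_wordSpan ?_
    rw [← Multiset.coe_add, map_add]
    exact add_lt_add_right hw _
  | zero => simp
  | add y z _ _ hy hz => rw [mul_add]; exact add_mem hy hz
  | smul c y _ hy => rw [mul_smul_comm]; exact Submodule.smul_mem _ _ hy

theorem mul_prod_mem_wordSpan (l : List ι) {v : V} {p : A}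
    (hp : p ∈ wordSpan k x φ (· < v)) :
    p * (l.map x).prod ∈ wordSpan k x φ (· < v + φ l) := by
  induction hp using Submodule.span_induction with
  | mem y hy =>
    obtain ⟨w, hw, rfl⟩ := hy
    rw [← List.prod_append, ← List.map_append]
    refine prod_mem_wordSpan ?_
    rw [← Multiset.coe_add, map_add]
    exact add_lt_add_left hw _
  | zero => simp
  | add y z _ _ hy hz => rw [add_mul]; exact add_mem hy hz
  | smul c y _ hy => rw [smul_mul_assoc]; exact Submodule.smul_mem _ _ hy

/-- Permuting the letters of a word rescales it modulo words of smaller weight. -/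
theorem QuasiCommute.exists_sub_smul_mem_of_perm (hcomm : QuasiCommute k x φ) {l m : List ι}
    (h : l.Perm m) :
    ∃ c : k, c ≠ 0 ∧ (l.map x).prod - c • (m.map x).prod ∈ wordSpan k x φ (· < φ l) := by
  induction h with
  | nil => exact ⟨1, one_ne_zero, by simp⟩
  | @cons a l m _ ih =>
    obtain ⟨c, hc, h⟩ := ih
    refine ⟨c, hc, ?_⟩
    have := prod_mul_mem_wordSpan [a] h
    rw [← map_add, Multiset.coe_add] at this
    simpa [mul_sub] using this
  | swap a b l =>
    obtain ⟨c, hc, h⟩ := hcomm b a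
    refine ⟨c, hc, ?_⟩
    have := mul_prod_mem_wordSpan l h
    rw [← map_add, Multiset.coe_add] at this
    simpa [sub_mul, mul_assoc] using this
  | @trans l m n hlm _ ih₁ ih₂ =>
    obtain ⟨c, hc, h⟩ := ih₁
    obtain ⟨d, hd, h'⟩ := ih₂
    refine ⟨c * d, mul_ne_zero hc hd, ?_⟩
    rw [← Multiset.coe_eq_coe.2 hlm] at h'
    have := add_mem h (Submodule.smul_mem _ c h')
    simpa [smul_sub, smul_smul] using this

/-- Every nonzero element has a leading word. -/
theorem QuasiCommute.exists_leading_word (hcomm : QuasiCommute k x φ)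
    (hφ : Function.Injective φ) {P : V → Prop} {y : A} (hy : y ∈ wordSpan k x φ P) :
    y = 0 ∨ ∃ l : List ι, P (φ l) ∧ ∃ c : k,
      y - c • (l.map x).prod ∈ wordSpan k x φ (· < φ l) := by
  induction hy using Submodule.span_induction with
  | mem y hy =>
    obtain ⟨l, hl, rfl⟩ := hy
    exact Or.inr ⟨l, hl, 1, by simp⟩
  | zero => exact Or.inl rfl
  | smul a y _ hy =>
    obtain rfl | ⟨l, hl, c, h⟩ := hy
    · simp
    · refine Or.inr ⟨l, hl, a * c, ?_⟩
      simpa [smul_sub, smul_smul] using Submodule.smul_mem _ a h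
  | add y z _ _ hy hz =>
    obtain rfl | ⟨l, hl, c, h⟩ := hy
    · simpa using hz
    obtain rfl | ⟨m, hm, d, h'⟩ := hz
    · exact Or.inr ⟨l, hl, c, by simpa using h⟩
    have absorb : ∀ {l m : List ι} {y : A} {c : k}, φ l < φ m →
        y - c • (l.map x).prod ∈ wordSpan k x φ (· < φ l) →
        y ∈ wordSpan k x φ (· < φ m) := by
      intro l m y c hlm h
      have := add_mem (wordSpan_mono (fun v hv => lt_trans hv hlm) h)
        (Submodule.smul_mem _ c (prod_mem_wordSpan hlm))
      rwa [sub_add_cancel] at this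
    obtain hlt | heq | hlt := lt_trichotomy (φ l) (φ m)
    · exact Or.inr ⟨m, hm, d, by simpa [add_sub_assoc] using add_mem (absorb hlt h) h'⟩
    · obtain ⟨e, -, he⟩ := hcomm.exists_sub_smul_mem_of_perm (Multiset.coe_eq_coe.1 (hφ heq)).symm
      refine Or.inr ⟨l, hl, c + d * e, ?_⟩
      rw [← heq] at h' he
      have := add_mem (add_mem h h') (Submodule.smul_mem _ d he)
      convert this using 1
      rw [smul_sub, smul_smul, add_smul]
      abel
    · refine Or.inr ⟨l, hl, c, ?_⟩
      rw [add_sub_right_comm]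
      exact add_mem h (absorb hlt h')

theorem isUpperSet_leadingContents (I : Ideal A) : IsUpperSet (leadingContents k x φ I) := by
  rintro s t hst ⟨l, rfl, p, hp, hI⟩
  obtain ⟨u, rfl⟩ := Multiset.le_iff_exists_add.1 hst
  refine ⟨u.toList ++ l, ?_, (u.toList.map x).prod * p, ?_, ?_⟩
  · rw [← Multiset.coe_add, Multiset.coe_toList, add_comm]
  · have := prod_mul_mem_wordSpan u.toList hp
    rwa [Multiset.coe_toList, add_comm, ← map_add] at this
  · rw [List.map_append, List.prod_append, ← mul_add]
    exact I.mul_mem_left _ hI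

theorem QuasiCommute.le_of_leadingContents_subset (hcomm : QuasiCommute k x φ)
    (hφ : Function.Injective φ) (hwf : WellFounded (InvImage (· < ·) φ))
    (hgen : Algebra.adjoin k (Set.range x) = ⊤) {I J : Ideal A} (hIJ : I ≤ J)
    (h : leadingContents k x φ J ⊆ leadingContents k x φ I) : J ≤ I := by
  have reduce : ∀ (l : List ι) (c : k) (y : A), y ∈ J →
      y - c • (l.map x).prod ∈ wordSpan k x φ (· < φ l) →
      (∀ z ∈ J, z ∈ wordSpan k x φ (· < φ l) → z ∈ I) → y ∈ I := by
    intro l c y hy hyl ih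
    obtain rfl | hc := eq_or_ne c 0
    · exact ih y hy (by simpa using hyl)
    have hmem : (l : Multiset ι) ∈ leadingContents k x φ J := by
      refine ⟨l, rfl, _, Submodule.smul_mem _ c⁻¹ hyl, ?_⟩
      rw [smul_sub, smul_smul, inv_mul_cancel₀ hc, one_smul, add_sub_cancel]
      exact Submodule.smul_of_tower_mem J c⁻¹ hy
    obtain ⟨m, hm, p, hp, hI⟩ := h hmem
    obtain ⟨e, -, he⟩ := hcomm.exists_sub_smul_mem_of_perm (Multiset.coe_eq_coe.1 hm.symm)
    have hI' := Submodule.smul_of_tower_mem I (c * e) hI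
    have hz : y - (c * e) • ((m.map x).prod + p) ∈ wordSpan k x φ (· < φ l) := by
      have := sub_mem (add_mem hyl (Submodule.smul_mem _ c he))
        (Submodule.smul_mem _ (c * e) hp)
      convert this using 1
      rw [smul_sub, smul_smul, smul_add]
      abel
    simpa using I.add_mem (ih _ (J.sub_mem hy (hIJ hI')) hz) hI'
  have key : ∀ s : Multiset ι, ∀ z ∈ J, z ∈ wordSpan k x φ (· < φ s) → z ∈ I := by
    intro s
    induction s using hwf.induction with
    | _ s ih =>
      intro z hz hzs
      obtain rfl | ⟨l, hl, c, hc⟩ := hcomm.exists_leading_word hφ hzs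
      · exact I.zero_mem
      · exact reduce l c z hz hc (ih l hl)
  intro y hy
  have htop : y ∈ wordSpan k x φ (fun _ => True) := by
    have hy' : y ∈ Subalgebra.toSubmodule (Algebra.adjoin k (Set.range x)) := by simp [hgen]
    rw [Algebra.adjoin_eq_span] at hy'
    refine Submodule.span_mono ?_ hy'
    intro z hz
    obtain ⟨l, hl, rfl⟩ := Submonoid.exists_list_of_mem_closure hz
    obtain ⟨l, rfl⟩ : ∃ m : List ι, m.map x = l := by
      rwa [← Set.mem_range, Set.range_list_map]
    exact ⟨l, trivial, rfl⟩
  obtain rfl | ⟨l, -, c, hc⟩ := hcomm.exists_leading_word hφ htop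
  · exact I.zero_mem
  · exact reduce l c y hy hc (key l)

theorem Multiset.wellQuasiOrderedLE (ι : Type*) [Finite ι] : WellQuasiOrderedLE (Multiset ι) := by
  classical
  exact (Finsupp.orderIsoMultiset (ι := ι)).wellQuasiOrderedLE_iff.1 inferInstance

/-- An algebra whose finitely many generators commute up to nonzero scalars, modulo words of
smaller weight, is left noetherian. -/
theorem QuasiCommute.isNoetherianRing [Finite ι] (hcomm : QuasiCommute k x φ)
    (hφ : Function.Injective φ) (hφ0 : ∀ s, 0 ≤ φ s)
    (hgen : Algebra.adjoin k (Set.range x) = ⊤) : IsNoetherianRing A := by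
  have hwqo := Multiset.wellQuasiOrderedLE ι
  have hwf : WellFounded (InvImage (· < ·) φ) := by
    refine wellFounded_iff_isEmpty_descending_chain.2 ⟨fun ⟨f, hf⟩ => ?_⟩
    have hanti : StrictAnti (φ ∘ f) := strictAnti_nat_of_succ_lt hf
    obtain ⟨i, j, hij, hle⟩ := hwqo.wqo f
    obtain ⟨u, hu⟩ := Multiset.le_iff_exists_add.1 hle
    refine (hanti hij).not_ge ?_
    simp only [Function.comp_apply, hu, map_add]
    exact le_add_of_nonneg_right (hφ0 u)
  refine isNoetherian_iff'.2 ⟨wellFounded_iff_isEmpty_descending_chain.2 ⟨fun ⟨f, hf⟩ => ?_⟩⟩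
  have hmono : StrictMono f := strictMono_nat_of_lt_succ hf
  have hex : ∀ n, ∃ s ∈ leadingContents k x φ (f (n + 1)), s ∉ leadingContents k x φ (f n) := by
    intro n
    refine Set.not_subset.1 fun hsub => (hf n).not_ge ?_
    exact hcomm.le_of_leadingContents_subset hφ hwf hgen (hf n).le hsub
  choose s hs hs' using hex
  obtain ⟨i, j, hij, hle⟩ := hwqo.wqo s
  exact hs' j (isUpperSet_leadingContents _ hle
    (leadingContents_mono (hmono.monotone hij) (hs i)))

end MonomialFiltration

section DegreeLex

variable {ι : Type*} [LinearOrder ι]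

/-- The content of a word, ordered first by weighted degree, then antilexicographically. -/
def degreeLex (d : ι → ℕ) : Multiset ι →+ ℕ ×ₗ (Lex (ι → ℕ))ᵒᵈ where
  toFun s := toLex ((s.map d).sum, OrderDual.toDual (toLex fun i => s.count i))
  map_zero' := by simp; rfl
  map_add' s t := by simp; rfl

theorem degreeLex_injective (d : ι → ℕ) : Function.Injective (degreeLex d) := by
  intro s t h
  have h₂ := congrArg (fun z => ofLex (OrderDual.ofDual (ofLex z).2)) h
  exact Multiset.ext.2 fun i => congrFun h₂ i

theorem degreeLex_nonneg {d : ι → ℕ} (hd : ∀ i, 0 < d i) (s : Multiset ι) :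
    0 ≤ degreeLex d s := by
  induction s using Multiset.induction_on with
  | empty => simp
  | cons a s _ =>
    refine le_of_lt (Prod.Lex.toLex_lt_toLex.2 (Or.inl ?_))
    have := hd a
    simp
    omega

theorem degreeLex_lt {d : ι → ℕ} {s t : Multiset ι} (h : (s.map d).sum = (t.map d).sum) {i : ι}
    (hi : i ∈ s) (hs : ∀ j ∈ s, i ≤ j) (ht : ∀ j ∈ t, i < j) : degreeLex d s < degreeLex d t := by
  refine Prod.Lex.toLex_lt_toLex.2 (Or.inr ⟨h, OrderDual.toDual_lt_toDual.2 ⟨i, ?_, ?_⟩⟩)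
  · intro j hj
    have h₁ : j ∉ s := fun h => (hs j h).not_gt hj
    have h₂ : j ∉ t := fun h => (ht j h).not_gt hj
    simp [h₁, h₂]
  · have h₂ : i ∉ t := fun h => (ht i h).false
    show t.count i < s.count i
    rw [Multiset.count_eq_zero.2 h₂]
    exact Multiset.count_pos.2 hi

end DegreeLex

/-- A homogeneous element in the span of homogeneous elements is in the span of those having the
same degree. -/
theorem mem_span_of_mem_graded {k A : Type*} [Field k] [Ring A] [Algebra k A]
    (𝒜 : ℕ → Submodule k A) [GradedAlgebra 𝒜] {S : Set A} (hS : ∀ y ∈ S, ∃ n, y ∈ 𝒜 n)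
    {n : ℕ} {z : A} (hz : z ∈ 𝒜 n) (hzS : z ∈ Submodule.span k S) :
    z ∈ Submodule.span k (S ∩ 𝒜 n) := by
  have hle : Submodule.span k S ≤
      (Submodule.span k (S ∩ 𝒜 n)).comap (GradedAlgebra.proj 𝒜 n) := by
    refine Submodule.span_le.2 fun y hy => ?_
    obtain ⟨m, hm⟩ := hS y hy
    simp only [SetLike.mem_coe, Submodule.mem_comap, GradedAlgebra.proj_apply]
    obtain rfl | hne := eq_or_ne m n
    · rw [DirectSum.decompose_of_mem_same 𝒜 hm]
      exact Submodule.subset_span ⟨hy, hm⟩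
    · rw [DirectSum.decompose_of_mem_ne 𝒜 hm hne]
      exact zero_mem _
  simpa [GradedAlgebra.proj_apply, DirectSum.decompose_of_mem_same 𝒜 hz] using hle hzS

instance LinearExtension.instFinite {ι : Type*} [Finite ι] : Finite (LinearExtension ι) :=
  inferInstanceAs (Finite ι)

theorem QuantumGradedASL.exists_quasiCommute {k : Type*} [Field k] {A : Type*} [Ring A]
    [Algebra k A] {𝒜 : ℕ → Submodule k A} {ι : Type*} [PartialOrder ι] [Finite ι]
    (Q : QuantumGradedASL k A 𝒜 ι) :
    ∃ d : LinearExtension ι → ℕ, (∀ i, 0 < d i) ∧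
      QuasiCommute k (ι := LinearExtension ι) Q.elem (degreeLex d) := by
  have := Q.graded
  choose d hd hmem using Q.homog
  refine ⟨d, hd, fun a b => ?_⟩
  obtain ⟨c, hc, h⟩ := Q.comm a b
  refine ⟨c, hc, ?_⟩
  have hlt : ∀ {i j : ι}, i < j → toLinearExtension i < toLinearExtension j := fun h =>
    lt_of_le_of_ne (toLinearExtension.monotone h.le) h.ne
  have hdeg : Q.elem a * Q.elem b - c • (Q.elem b * Q.elem a) ∈ 𝒜 (d a + d b) := by
    refine sub_mem (SetLike.mul_mem_graded (hmem a) (hmem b)) (Submodule.smul_mem _ _ ?_)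
    rw [add_comm]
    exact SetLike.mul_mem_graded (hmem b) (hmem a)
  have hspan := mem_span_of_mem_graded 𝒜 (fun y hy => ?_) hdeg h
  · refine Submodule.span_le.2 ?_ hspan
    rintro y ⟨⟨lam, hla, hlb, hy⟩, hyn⟩
    obtain rfl | hy0 := eq_or_ne y 0
    · exact zero_mem _
    have hab : ∀ j ∈ (([a, b] : List (LinearExtension ι)) : Multiset (LinearExtension ι)),
        toLinearExtension lam < j := by
      intro j hj
      obtain rfl | rfl : j = a ∨ j = b := by simpa using hj
      exacts [hlt hla, hlt hlb]
    obtain rfl | ⟨mu, hle, rfl⟩ := hy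
    · have hn := DirectSum.degree_eq_of_mem_mem 𝒜 (hmem lam) hyn hy0
      refine Submodule.subset_span ⟨[toLinearExtension lam], degreeLex_lt ?_
        (i := toLinearExtension lam) (by simp) (by simp) hab, ?_⟩
      · exact hn
      · exact (mul_one _).symm
    · have hn := DirectSum.degree_eq_of_mem_mem 𝒜
        (SetLike.mul_mem_graded (hmem lam) (hmem mu)) hyn hy0
      refine Submodule.subset_span ⟨[toLinearExtension lam, toLinearExtension mu], degreeLex_lt ?_
        (i := toLinearExtension lam) (by simp) ?_ hab, ?_⟩
      · exact hn
      · simpa using toLinearExtension.monotone hle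
      · exact congrArg (Q.elem lam * ·) (mul_one _).symm
  · obtain ⟨lam, -, -, rfl | ⟨mu, -, rfl⟩⟩ := hy
    · exact ⟨_, hmem lam⟩
    · exact ⟨_, SetLike.mul_mem_graded (hmem lam) (hmem mu)⟩

/-- Every quantum graded algebra with a straightening law on a finite poset
is a noetherian ring (on both sides). -/
theorem qasl_noetherian {k : Type*} [Field k] {A : Type*} [Ring A] [Algebra k A]
    {𝒜 : ℕ → Submodule k A} {ι : Type*} [PartialOrder ι] [Finite ι]
    (Q : QuantumGradedASL k A 𝒜 ι) :
    IsNoetherianRing A ∧ IsNoetherianRing Aᵐᵒᵖ := by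
  obtain ⟨d, hd, hcomm⟩ := Q.exists_quasiCommute
  exact ⟨hcomm.isNoetherianRing (degreeLex_injective d) (degreeLex_nonneg hd) Q.gen,
    hcomm.op.isNoetherianRing (degreeLex_injective d) (degreeLex_nonneg hd)
      (adjoin_range_op_eq_top Q.gen)⟩
end

section
/- Let A be a commutative integral domain and u a unit of A, and let m ≤ n be positive integers. Then the set of standard monomials on Π_{m,n} (products [I₁]⋯[I_s] of maximal quantum minors with I₁ ≤st ⋯ ≤st I_s, together with 1) is an A-module basis of the quantum grassmannian O_u(G_{m,n}(A)). -/
/-- The defining relations of the algebra of quantum `m × n` matrices, with parameter the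
unit `u`, imposed on the free algebra on the generators `X (i,j)`. -/
inductive qMatrixRel (R : Type*) [CommRing R] (u : Rˣ) (m n : ℕ) :
    FreeAlgebra R (Fin m × Fin n) → FreeAlgebra R (Fin m × Fin n) → Prop
  | row : ∀ (i : Fin m) (j l : Fin n), j < l →
      qMatrixRel R u m n (FreeAlgebra.ι R (i, j) * FreeAlgebra.ι R (i, l))
        ((u : R) • (FreeAlgebra.ι R (i, l) * FreeAlgebra.ι R (i, j)))
  | col : ∀ (i k : Fin m) (j : Fin n), i < k →
      qMatrixRel R u m n (FreeAlgebra.ι R (i, j) * FreeAlgebra.ι R (k, j))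
        ((u : R) • (FreeAlgebra.ι R (k, j) * FreeAlgebra.ι R (i, j)))
  | antidiag : ∀ (i k : Fin m) (j l : Fin n), k < i → j < l →
      qMatrixRel R u m n (FreeAlgebra.ι R (i, j) * FreeAlgebra.ι R (k, l))
        (FreeAlgebra.ι R (k, l) * FreeAlgebra.ι R (i, j))
  | diag : ∀ (i k : Fin m) (j l : Fin n), i < k → j < l →
      qMatrixRel R u m n (FreeAlgebra.ι R (i, j) * FreeAlgebra.ι R (k, l))
        (FreeAlgebra.ι R (k, l) * FreeAlgebra.ι R (i, j) +
          ((u : R) - ((u⁻¹ : Rˣ) : R)) • (FreeAlgebra.ι R (i, l) * FreeAlgebra.ι R (k, j)))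

/-- The algebra `O_u(M_{m,n}(R))` of quantum `m × n` matrices over `R`. -/
abbrev QuantumMat (R : Type*) [CommRing R] (u : Rˣ) (m n : ℕ) :=
  RingQuot (qMatrixRel R u m n)

/-- The generator `X i j` of the algebra of quantum matrices. -/
def qX (R : Type*) [CommRing R] (u : Rˣ) {m n : ℕ} (i : Fin m) (j : Fin n) :
    QuantumMat R u m n :=
  RingQuot.mkAlgHom R (qMatrixRel R u m n) (FreeAlgebra.ι R (i, j))

/-- The number of inversions (i.e. the Coxeter length) of a permutation of `Fin t`. -/
def permLength {t : ℕ} (σ : Equiv.Perm (Fin t)) : ℕ :=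
  (Finset.univ.filter fun p : Fin t × Fin t => p.1 < p.2 ∧ σ p.2 < σ p.1).card

/-- The index set `Π_{m,n}` of maximal quantum minors consists of the `m`-element subsets
`{j₁ < ⋯ < j_m} ⊆ {1,…,n}`, encoded as order embeddings `Fin m ↪o Fin n`; it carries the
standard partial order `I ≤st J ↔ ∀ s, i_s ≤ j_s` (pointwise order). -/
instance piPartialOrder (m n : ℕ) : PartialOrder (Fin m ↪o Fin n) :=
  PartialOrder.lift (fun f => (f : Fin m → Fin n)) DFunLike.coe_injective

instance piFinite (m n : ℕ) : Finite (Fin m ↪o Fin n) :=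
  Finite.of_injective (fun f => (f : Fin m → Fin n)) DFunLike.coe_injective

/-- The maximal quantum minor `[J] = Σ_{σ ∈ S_m} (−u)^{ℓ(σ)} X_{1 j_{σ(1)}} ⋯ X_{m j_{σ(m)}}`
of the generic matrix, for a column index set `J ∈ Π_{m,n}`. -/
def qMaximalMinor (R : Type*) [CommRing R] (u : Rˣ) {m n : ℕ} (J : Fin m ↪o Fin n) :
    QuantumMat R u m n :=
  ∑ σ : Equiv.Perm (Fin m),
    ((-(u : R)) ^ permLength σ) • (List.ofFn fun i : Fin m => qX R u i (J (σ i))).prod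

/-- The image of the unit `u` of `A` in the fraction field of `A`. -/
noncomputable def uFrac (A : Type*) [CommRing A] [IsDomain A] (u : Aˣ) : (FractionRing A)ˣ :=
  Units.map (algebraMap A (FractionRing A)).toMonoidHom u

/-- `O_u(M_{m,n}(A))` for a commutative domain `A` is the `A`-subalgebra of
`O_u(M_{m,n}(Frac A))` generated by the `X i j`; the quantum grassmannian `O_u(G_{m,n}(A))`
is its `A`-subalgebra generated by the maximal quantum minors `[J]`, `J ∈ Π_{m,n}`. -/
noncomputable def quantumGrassmannianSubmodule (A : Type*) [CommRing A] [IsDomain A]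
    (u : Aˣ) (m n : ℕ) : Subalgebra A (QuantumMat (FractionRing A) (uFrac A u) m n) :=
  Algebra.adjoin A (Set.range fun J : Fin m ↪o Fin n => qMaximalMinor _ (uFrac A u) J)

/-- A family `X i j` in an `R`-algebra satisfies the defining relations of quantum matrices with
parameter `q`. -/
structure IsQuantumMatrix {R T α β : Type*} [CommRing R] [Ring T] [Algebra R T] [LinearOrder α]
    [LinearOrder β] (q : Rˣ) (X : α → β → T) : Prop where
  row : ∀ (i : α) (j l : β), j < l → X i j * X i l = (q : R) • (X i l * X i j)
  col : ∀ (i k : α) (j : β), i < k → X i j * X k j = (q : R) • (X k j * X i j)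
  antidiag : ∀ (i k : α) (j l : β), k < i → j < l → X i j * X k l = X k l * X i j
  diag : ∀ (i k : α) (j l : β), i < k → j < l →
    X i j * X k l = X k l * X i j + ((q : R) - ((q⁻¹ : Rˣ) : R)) • (X i l * X k j)

/-- The quantum minor with an arbitrary word of rows and a set of columns, defined by expansion
along the first row. -/
def rowMinor {R T α β : Type*} [CommRing R] [Ring T] [Algebra R T] [LinearOrder β]
    (q : Rˣ) (X : α → β → T) : List α → Finset β → T
  | [], S => if S = ∅ then 1 else 0
  | a :: l, S => ∑ s ∈ S, (-(q : R)) ^ (S.filter (· < s)).card •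
      (X a s * rowMinor q X l (S.erase s))

section minors

variable {R T α β : Type*} [CommRing R] [Ring T] [Algebra R T]
  [LinearOrder β] {q : Rˣ} {X : α → β → T}

theorem rowMinor_eq_zero_of_length_ne (l : List α) :
    ∀ S : Finset β, l.length ≠ S.card → rowMinor q X l S = 0 := by
  induction l with
  | nil =>
    intro S hS
    rw [rowMinor, if_neg]
    rintro rfl
    simp at hS
  | cons a l ih =>
    intro S hS
    rw [rowMinor]
    refine Finset.sum_eq_zero fun s hs => ?_
    rw [ih, mul_zero, smul_zero]
    rw [Finset.card_erase_of_mem hs]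
    have := Finset.card_pos.2 ⟨s, hs⟩
    simp only [List.length_cons] at hS
    omega

theorem sum_sum_erase_eq_sum_lt {M : Type*} [AddCommMonoid M] (S : Finset β) (f : β → β → M) :
    ∑ s ∈ S, ∑ t ∈ S.erase s, f s t = ∑ s ∈ S, ∑ t ∈ S with s < t, (f s t + f t s) := by
  have h1 : ∀ s ∈ S, ∑ t ∈ S.erase s, f s t
      = ∑ t ∈ S with s < t, f s t + ∑ t ∈ S with t < s, f s t := by
    intro s _
    rw [← Finset.sum_union]
    · refine Finset.sum_congr ?_ fun _ _ => rfl
      ext t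
      simp only [Finset.mem_erase, Finset.mem_union, Finset.mem_filter]
      constructor
      · rintro ⟨h, h'⟩
        rcases lt_or_gt_of_ne h with h | h <;> tauto
      · rintro (⟨h, h'⟩ | ⟨h, h'⟩)
        exacts [⟨h'.ne', h⟩, ⟨h'.ne, h⟩]
    · rw [Finset.disjoint_left]
      intro t ht ht'
      exact lt_asymm (Finset.mem_filter.1 ht).2 (Finset.mem_filter.1 ht').2
  rw [Finset.sum_congr rfl h1]
  simp only [Finset.sum_add_distrib]
  congr 1
  refine Finset.sum_comm' fun s t => ?_
  simp only [Finset.mem_filter]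
  tauto

theorem rowMinor_cons_cons (a b : α) (l : List α) (S : Finset β) :
    rowMinor q X (a :: b :: l) S = ∑ s ∈ S, ∑ t ∈ S with s < t,
      (-(q : R)) ^ ((S.filter (· < s)).card + ((S.erase s).filter (· < t)).card) •
        ((X a s * X b t - (q : R) • (X a t * X b s)) *
          rowMinor q X l ((S.erase s).erase t)) := by
  have h0 : rowMinor q X (a :: b :: l) S = ∑ s ∈ S, ∑ t ∈ S.erase s,
      (-(q : R)) ^ ((S.filter (· < s)).card + ((S.erase s).filter (· < t)).card) •
        (X a s * X b t * rowMinor q X l ((S.erase s).erase t)) := by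
    simp only [rowMinor, Finset.mul_sum, Finset.smul_sum, mul_smul_comm, smul_smul, pow_add,
      mul_assoc]
  rw [h0, sum_sum_erase_eq_sum_lt]
  refine Finset.sum_congr rfl fun s hs => Finset.sum_congr rfl fun t ht => ?_
  obtain ⟨ht, hst⟩ := Finset.mem_filter.1 ht
  have hts : ((S.erase t).filter (· < s)).card = (S.filter (· < s)).card := by
    congr 1
    ext x
    simp only [Finset.mem_filter, Finset.mem_erase]
    constructor
    · tauto
    · rintro ⟨h, h'⟩
      exact ⟨⟨(h'.trans hst).ne, h⟩, h'⟩
  have hst' : (S.filter (· < t)).card = ((S.erase s).filter (· < t)).card + 1 := by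
    rw [← Finset.card_erase_add_one (Finset.mem_filter.2 ⟨hs, hst⟩), Finset.filter_erase]
  rw [hts, hst', Finset.erase_right_comm, sub_mul, smul_sub, smul_mul_assoc, smul_smul,
    sub_eq_add_neg, ← neg_smul]
  congr 2
  ring

theorem rowMinor_append (l₁ l₂ : List α) : ∀ S : Finset β,
    rowMinor q X (l₁ ++ l₂) S = ∑ P ∈ S.powerset,
      (-(q : R)) ^ (∑ p ∈ P, ((S \ P).filter (· < p)).card) •
        (rowMinor q X l₁ P * rowMinor q X l₂ (S \ P)) := by
  induction l₁ with
  | nil =>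
    intro S
    rw [Finset.sum_eq_single ∅]
    · simp [rowMinor]
    · intro P _ hP
      simp [rowMinor, hP]
    · simp
  | cons a l₁ ih =>
    intro S
    simp only [List.cons_append, rowMinor, ih, Finset.mul_sum, Finset.smul_sum, Finset.sum_mul]
    rw [Finset.sum_sigma', Finset.sum_sigma']
    refine Finset.sum_bij' (fun x _ => ⟨insert x.1 x.2, x.1⟩) (fun x _ => ⟨x.2, x.1.erase x.2⟩)
      ?_ ?_ ?_ ?_ ?_
    · rintro ⟨s, P⟩ h
      simp only [Finset.mem_sigma, Finset.mem_powerset] at h ⊢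
      exact ⟨Finset.insert_subset h.1 (h.2.trans (Finset.erase_subset _ _)),
        Finset.mem_insert_self _ _⟩
    · rintro ⟨P, s⟩ h
      simp only [Finset.mem_sigma, Finset.mem_powerset] at h ⊢
      exact ⟨h.1 h.2, Finset.erase_subset_erase _ h.1⟩
    · rintro ⟨s, P⟩ h
      simp only [Finset.mem_sigma, Finset.mem_powerset] at h ⊢
      rw [Finset.erase_insert fun hs => by simpa using h.2 hs]
    · rintro ⟨P, s⟩ h
      simp only [Finset.mem_sigma, Finset.mem_powerset] at h ⊢
      rw [Finset.insert_erase h.2]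
    · rintro ⟨s, P⟩ h
      simp only [Finset.mem_sigma, Finset.mem_powerset] at h ⊢
      have hsP : s ∉ P := fun hs => by simpa using h.2 hs
      have hsd : S.erase s \ P = S \ insert s P := by
        ext x; simp only [Finset.mem_sdiff, Finset.mem_erase, Finset.mem_insert]; tauto
      have hPS : insert s P ⊆ S :=
        Finset.insert_subset h.1 (h.2.trans (Finset.erase_subset _ _))
      have hcard : (S.filter (· < s)).card
          = ((insert s P).filter (· < s)).card + ((S \ insert s P).filter (· < s)).card := by
        conv_lhs => rw [← Finset.union_sdiff_of_subset hPS]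
        rw [Finset.filter_union, Finset.card_union_of_disjoint]
        exact Finset.disjoint_filter_filter Finset.disjoint_sdiff
      rw [Finset.erase_insert hsP, Finset.sum_insert hsP, hsd, hcard]
      simp only [mul_smul_comm, smul_mul_assoc, smul_smul, mul_assoc, pow_add]
      congr 1
      ring

theorem rowMinor_cons_insert (a : α) (l : List α) {s : β} {S : Finset β} (hs : ∀ t ∈ S, s < t) :
    rowMinor q X (a :: l) (insert s S) = X a s * rowMinor q X l S +
      ∑ t ∈ S, (-(q : R)) ^ ((S.filter (· < t)).card + 1) •
        (X a t * rowMinor q X l (insert s (S.erase t))) := by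
  have hsS : s ∉ S := fun h => lt_irrefl _ (hs s h)
  rw [rowMinor, Finset.sum_insert hsS]
  congr 1
  · rw [Finset.erase_insert hsS, Finset.card_eq_zero.2, pow_zero, one_smul]
    refine Finset.filter_eq_empty_iff.2 fun t ht => ?_
    rcases Finset.mem_insert.1 ht with rfl | ht
    · exact lt_irrefl _
    · exact (hs t ht).not_gt
  · refine Finset.sum_congr rfl fun t ht => ?_
    rw [Finset.filter_insert, if_pos (hs t ht), Finset.card_insert_of_notMem (by simp [hsS]),
      Finset.erase_insert_of_ne (hs t ht).ne]

variable [LinearOrder α]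

theorem IsQuantumMatrix.transpose (h : IsQuantumMatrix q X) :
    IsQuantumMatrix q (fun j i => X i j) where
  row i j l hjl := h.col j l i hjl
  col i k j hik := h.row j i k hik
  antidiag i k j l hki hjl := (h.antidiag l j k i hjl hki).symm
  diag i k j l hik hjl := by
    rw [h.diag j l i k hjl hik, h.antidiag l j i k hjl hik]

theorem rowMinor_swap (h : IsQuantumMatrix q X) {a b : α} (hab : a < b) (l : List α)
    (S : Finset β) :
    rowMinor q X (b :: a :: l) S = (-(q : R)) • rowMinor q X (a :: b :: l) S := by
  rw [rowMinor_cons_cons, rowMinor_cons_cons, Finset.smul_sum]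
  refine Finset.sum_congr rfl fun s _ => ?_
  rw [Finset.smul_sum]
  refine Finset.sum_congr rfl fun t ht => ?_
  have hst := (Finset.mem_filter.1 ht).2
  have key : X b s * X a t - (q : R) • (X b t * X a s)
      = (-(q : R)) • (X a s * X b t - (q : R) • (X a t * X b s)) := by
    rw [h.antidiag b a s t hab hst, h.diag a b s t hab hst]
    have hq : (q : R) * ((q⁻¹ : Rˣ) : R) = 1 := by simp
    generalize X a t * X b s = y
    generalize X b t * X a s = z
    match_scalars
    · linear_combination -hq
    · ring
  rw [key, smul_mul_assoc, smul_comm]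

theorem rowMinor_self_self (h : IsQuantumMatrix q X) (a : α) (l : List α) (S : Finset β) :
    rowMinor q X (a :: a :: l) S = 0 := by
  rw [rowMinor_cons_cons]
  refine Finset.sum_eq_zero fun s _ => Finset.sum_eq_zero fun t ht => ?_
  rw [h.row a s t (Finset.mem_filter.1 ht).2, sub_self, zero_mul, smul_zero]

theorem rowMinor_perm (h : IsQuantumMatrix q X) {l l' : List α} (hl : l.Perm l') :
    ∃ c : Rˣ, ∀ S : Finset β, rowMinor q X l S = (c : R) • rowMinor q X l' S := by
  induction hl with
  | nil => exact ⟨1, by simp⟩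
  | cons a _ ih =>
    obtain ⟨c, hc⟩ := ih
    refine ⟨c, fun S => ?_⟩
    simp only [rowMinor, hc, Finset.smul_sum, mul_smul_comm]
    exact Finset.sum_congr rfl fun s _ => smul_comm _ _ _
  | swap a b l =>
    rcases lt_trichotomy a b with hab | rfl | hab
    · exact ⟨-q, fun S => by rw [rowMinor_swap h hab, Units.val_neg]⟩
    · exact ⟨1, by simp⟩
    · refine ⟨(-q)⁻¹, fun S => ?_⟩
      rw [rowMinor_swap h hab, ← Units.val_neg, smul_smul]
      simp
  | trans _ _ ih₁ ih₂ =>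
    obtain ⟨c, hc⟩ := ih₁
    obtain ⟨d, hd⟩ := ih₂
    exact ⟨c * d, fun S => by rw [hc, hd, smul_smul, Units.val_mul]⟩

theorem rowMinor_eq_zero_of_not_nodup (h : IsQuantumMatrix q X) {l : List α} (hl : ¬ l.Nodup)
    (S : Finset β) : rowMinor q X l S = 0 := by
  obtain ⟨a, ha⟩ := List.exists_duplicate_iff_not_nodup.2 hl
  obtain ⟨l', hl'⟩ := (List.duplicate_iff_sublist.1 ha).exists_perm_append
  obtain ⟨c, hc⟩ := rowMinor_perm h hl'
  rw [hc]
  simp only [List.cons_append, List.nil_append, rowMinor_self_self h, smul_zero]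

/-- The expansions of a quantum minor by rows and by columns agree. -/
theorem rowMinor_sort_eq_transpose (h : IsQuantumMatrix q X) (k : ℕ) :
    ∀ (A : Finset α) (S : Finset β), A.card = k →
      rowMinor q X (A.sort (· ≤ ·)) S
        = rowMinor q (fun j i => X i j) (S.sort (· ≤ ·)) A := by
  induction k using Nat.strong_induction_on with
  | _ k ih =>
    intro A S hA
    induction A using Finset.induction_on_min with
    | empty =>
      induction S using Finset.induction_on_min with
      | empty => simp [rowMinor]
      | insert s S hs _ =>
        rw [Finset.sort_insert _ (fun t ht => (hs t ht).le) fun h => lt_irrefl _ (hs s h)]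
        simp [rowMinor]
    | insert a A ha _ =>
      have haA : a ∉ A := fun h => lt_irrefl _ (ha a h)
      rw [Finset.card_insert_of_notMem haA] at hA
      rw [Finset.sort_insert _ (fun t ht => (ha t ht).le) haA]
      induction S using Finset.induction_on_min with
      | empty => simp [rowMinor]
      | insert s S hs _ =>
        have hsS : s ∉ S := fun h => lt_irrefl _ (hs s h)
        rw [Finset.sort_insert _ (fun t ht => (hs t ht).le) hsS, rowMinor_cons_insert _ _ hs,
          rowMinor_cons_insert _ _ ha, ih A.card (by omega) A S rfl]
        congr 1
        have h1 : ∀ t ∈ S, rowMinor q X (A.sort (· ≤ ·)) (insert s (S.erase t)) =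
            ∑ b ∈ A, (-(q : R)) ^ (A.filter (· < b)).card • (X b s *
              rowMinor q (fun j i => X i j) ((S.erase t).sort (· ≤ ·)) (A.erase b)) := by
          intro t _
          rw [ih A.card (by omega) _ _ rfl, Finset.sort_insert _
            (fun x hx => (hs x (Finset.mem_of_mem_erase hx)).le)
            fun hx => hsS (Finset.mem_of_mem_erase hx), rowMinor]
        have h2 : ∀ b ∈ A,
            rowMinor q (fun j i => X i j) (S.sort (· ≤ ·)) (insert a (A.erase b)) =
            ∑ t ∈ S, (-(q : R)) ^ (S.filter (· < t)).card • (X a t *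
              rowMinor q (fun j i => X i j) ((S.erase t).sort (· ≤ ·)) (A.erase b)) := by
          intro b hb
          have haAb : a ∉ A.erase b := fun hx => haA (Finset.mem_of_mem_erase hx)
          have hpos := Finset.card_pos.2 ⟨b, hb⟩
          rw [← ih A.card (by omega) _ _ (by
            rw [Finset.card_insert_of_notMem haAb, Finset.card_erase_of_mem hb]; omega),
            Finset.sort_insert _ (fun x hx => (ha x (Finset.mem_of_mem_erase hx)).le) haAb,
            rowMinor]
          refine Finset.sum_congr rfl fun t _ => ?_
          rw [ih (A.erase b).card (by rw [Finset.card_erase_of_mem hb]; omega) _ _ rfl]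
        refine (Finset.sum_congr rfl fun t ht => by
          rw [h1 t ht, Finset.mul_sum, Finset.smul_sum]).trans
          (Finset.sum_comm.trans (Finset.sum_congr rfl fun b hb => ?_))
        rw [h2 b hb, Finset.mul_sum, Finset.smul_sum]
        refine Finset.sum_congr rfl fun t ht => ?_
        simp only [mul_smul_comm, smul_smul, ← mul_assoc]
        rw [h.antidiag b a s t (ha b hb) (hs t ht)]
        congr 1
        ring

/-- Quantum Plücker relations: antisymmetrisation over more than `Fintype.card α` columns
vanishes. -/
theorem plucker_relation [Fintype α] (h : IsQuantumMatrix q X) (l₁ l₂ : List β) (S : Finset β)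
    (hS : Fintype.card α < S.card) :
    ∑ P ∈ S.powerset, (-(q : R)) ^ (∑ p ∈ P, ((S \ P).filter (· < p)).card) •
      (rowMinor q (fun j i => X i j) (l₁ ++ P.sort (· ≤ ·)) Finset.univ *
        rowMinor q (fun j i => X i j) ((S \ P).sort (· ≤ ·) ++ l₂) Finset.univ) = 0 := by
  simp only [rowMinor_append l₁, rowMinor_append _ l₂]
  simp only [← rowMinor_sort_eq_transpose h _ _ _ rfl, Finset.sum_mul, Finset.mul_sum,
    Finset.smul_sum]
  rw [Finset.sum_comm]
  refine Finset.sum_eq_zero fun B _ => ?_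
  rw [Finset.sum_comm]
  refine Finset.sum_eq_zero fun A _ => ?_
  have h0 : rowMinor q X ((Finset.univ \ A).sort (· ≤ ·) ++ B.sort (· ≤ ·)) S = 0 := by
    by_cases hd : ((Finset.univ \ A).sort (· ≤ ·) ++ B.sort (· ≤ ·)).Nodup
    · refine rowMinor_eq_zero_of_length_ne _ _ ?_
      have := hd.length_le_card
      omega
    · exact rowMinor_eq_zero_of_not_nodup h hd S
  rw [rowMinor_append] at h0
  have h3 := congrArg (fun x => (-(q : R)) ^
      (∑ p ∈ A, ((Finset.univ \ A).filter (· < p)).card) •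
    (-(q : R)) ^ (∑ p ∈ B, ((Finset.univ \ B).filter (· < p)).card) •
    (rowMinor q (fun j i => X i j) l₁ A * x *
      rowMinor q (fun j i => X i j) l₂ (Finset.univ \ B))) h0
  simp only [mul_zero, zero_mul, smul_zero, Finset.mul_sum, Finset.sum_mul,
    Finset.smul_sum] at h3
  rw [← h3]
  refine Finset.sum_congr rfl fun P _ => ?_
  simp only [mul_smul_comm, smul_mul_assoc, smul_smul, mul_assoc]
  congr 1
  ring

end minors

/-- The number of inversions of a word. -/
def inversionCount {k : ℕ} {β : Type*} [LinearOrder β] (w : Fin k → β) : ℕ :=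
  (Finset.univ.filter fun p : Fin k × Fin k => p.1 < p.2 ∧ w p.2 < w p.1).card

/-- The maximal quantum minor of a family `X i j` with column set `J`. -/
def maximalMinor {R T : Type*} [CommRing R] [Ring T] [Algebra R T] {m n : ℕ} (q : Rˣ)
    (X : Fin m → Fin n → T) (J : Fin m ↪o Fin n) : T :=
  ∑ σ : Equiv.Perm (Fin m),
    ((-(q : R)) ^ permLength σ) • (List.ofFn fun i : Fin m => X i (J (σ i))).prod

theorem inversionCount_cons {k : ℕ} {β : Type*} [LinearOrder β] (s : β) (w : Fin k → β) :
    inversionCount (Fin.cons s w : Fin (k + 1) → β)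
      = (Finset.univ.filter fun i => w i < s).card + inversionCount w := by
  simp only [inversionCount, Finset.card_filter, Fintype.sum_prod_type, Fin.sum_univ_succ,
    Fin.cons_zero, Fin.cons_succ, Fin.succ_lt_succ_iff, false_and, if_false,
    Fin.succ_pos, true_and, zero_add, Fin.not_lt_zero]

theorem Fintype.sum_fin_cons {k : ℕ} {β M : Type*} [Fintype β] [AddCommMonoid M]
    (f : (Fin (k + 1) → β) → M) :
    ∑ w, f w = ∑ s : β, ∑ w : Fin k → β, f (Fin.cons s w) := by
  rw [← Fintype.sum_prod_type', ← (Fin.consEquiv fun _ => β).sum_comp]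
  rfl

section

variable {R T : Type*} [CommRing R] [Ring T] [Algebra R T] {q : Rˣ}

theorem rowMinor_ofFn {α β : Type*} [LinearOrder β] [Fintype β] {X : α → β → T} (k : ℕ) :
    ∀ (r : Fin k → α) (S : Finset β), rowMinor q X (List.ofFn r) S =
      ∑ w : Fin k → β, if Function.Injective w ∧ Finset.univ.image w = S then
        (-(q : R)) ^ inversionCount w • (List.ofFn fun i => X (r i) (w i)).prod else 0 := by
  classical
  induction k with
  | zero =>
    intro r S
    simp [rowMinor, inversionCount, Function.injective_of_subsingleton, eq_comm]
  | succ k ih =>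
    intro r S
    rw [List.ofFn_succ, rowMinor, Fintype.sum_fin_cons, ← Finset.sum_subset (Finset.subset_univ S)]
    · refine Finset.sum_congr rfl fun s hs => ?_
      rw [ih, Finset.mul_sum, Finset.smul_sum]
      refine Finset.sum_congr rfl fun w _ => ?_
      have himg : Finset.univ.image (Fin.cons s w : Fin (k + 1) → β)
          = insert s (Finset.univ.image w) := by
        ext x
        simp [Fin.exists_fin_succ, eq_comm]
      have hiff : (Function.Injective (Fin.cons s w : Fin (k + 1) → β) ∧
          Finset.univ.image (Fin.cons s w : Fin (k + 1) → β) = S) ↔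
          (Function.Injective w ∧ Finset.univ.image w = S.erase s) := by
        rw [himg, Fin.cons_injective_iff]
        have hmem : s ∈ Finset.univ.image w ↔ s ∈ Set.range w := by simp
        rw [← hmem]
        constructor
        · rintro ⟨⟨h1, h2⟩, rfl⟩
          exact ⟨h2, (Finset.erase_insert h1).symm⟩
        · rintro ⟨h1, h2⟩
          rw [h2, Finset.insert_erase hs]
          exact ⟨⟨Finset.notMem_erase _ _, h1⟩, rfl⟩
      by_cases hw : Function.Injective w ∧ Finset.univ.image w = S.erase s
      · rw [if_pos hw, if_pos (hiff.2 hw), inversionCount_cons, List.ofFn_succ, List.prod_cons,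
          pow_add, mul_smul_comm, smul_smul]
        simp only [Fin.cons_zero, Fin.cons_succ]
        congr 3
        have : S.filter (· < s) = (Finset.univ.filter fun i => w i < s).image w := by
          ext x
          have hx : x ∈ Finset.univ.image w ↔ x ∈ S.erase s := by rw [hw.2]
          simp only [Finset.mem_image, Finset.mem_univ, true_and, Finset.mem_erase] at hx
          simp only [Finset.mem_filter, Finset.mem_image, Finset.mem_univ, true_and]
          constructor
          · rintro ⟨h1, h2⟩
            obtain ⟨i, rfl⟩ := hx.2 ⟨h2.ne, h1⟩
            exact ⟨i, h2, rfl⟩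
          · rintro ⟨i, h1, rfl⟩
            exact ⟨(hx.1 ⟨i, rfl⟩).2, h1⟩
        rw [this, Finset.card_image_of_injective _ hw.1]
      · rw [if_neg hw, if_neg (mt hiff.1 hw), mul_zero, smul_zero]
    · intro s _ hs
      refine Finset.sum_eq_zero fun w _ => if_neg ?_
      rintro ⟨_, h⟩
      exact hs (h ▸ Finset.mem_image.2 ⟨0, Finset.mem_univ _, rfl⟩)

variable {m n : ℕ} {X : Fin m → Fin n → T}

theorem maximalMinor_eq_rowMinor (J : Fin m ↪o Fin n) :
    maximalMinor q X J = rowMinor q X (List.ofFn id) (Finset.univ.image J) := by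
  classical
  rw [rowMinor_ofFn, ← Finset.sum_filter, maximalMinor]
  refine Finset.sum_nbij (fun σ => J ∘ σ) ?_ ?_ ?_ ?_
  · intro σ _
    refine Finset.mem_filter.2 ⟨Finset.mem_univ _, J.injective.comp σ.injective, ?_⟩
    rw [← Finset.image_image, Finset.image_univ_equiv]
  · intro σ _ τ _ h
    ext i
    exact congrArg Fin.val (J.injective (congrFun h i))
  · intro w hw
    obtain ⟨hw1, hw2⟩ := (Finset.mem_filter.1 (Finset.mem_coe.1 hw)).2
    have hex : ∀ i, ∃ k, J k = w i := fun i => by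
      have : w i ∈ Finset.univ.image J := hw2 ▸ Finset.mem_image_of_mem w (Finset.mem_univ i)
      simpa using this
    choose σ hσ using hex
    have hinj : Function.Injective σ := fun i j h => hw1 (by rw [← hσ, ← hσ, h])
    exact ⟨Equiv.ofBijective σ (Finite.injective_iff_bijective.1 hinj), Finset.mem_coe.2
      (Finset.mem_univ _), funext hσ⟩
  · intro σ _
    simp [permLength, inversionCount]

theorem sort_image_orderEmbedding (J : Fin m ↪o Fin n) :
    (Finset.univ.image J).sort (· ≤ ·) = List.ofFn J := by
  have h1 : (List.ofFn J).toFinset = Finset.univ.image J := by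
    ext x
    simp [List.mem_ofFn]
  rw [← h1]
  refine (List.toFinset_sort (· ≤ ·) (List.nodup_ofFn.2 J.injective)).2 ?_
  exact (List.sortedLE_ofFn_iff.2 J.monotone).pairwise

theorem maximalMinor_eq_colMinor (h : IsQuantumMatrix q X) (J : Fin m ↪o Fin n) :
    maximalMinor q X J = rowMinor q (fun j i => X i j) (List.ofFn J) Finset.univ := by
  rw [maximalMinor_eq_rowMinor, ← sort_image_orderEmbedding,
    ← rowMinor_sort_eq_transpose h _ _ _ rfl]
  congr 1
  have := sort_image_orderEmbedding (RelEmbedding.refl (· ≤ ·) : Fin m ↪o Fin m)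
  simpa using this.symm

theorem colMinor_eq_zero_or_smul_maximalMinor (h : IsQuantumMatrix q X) (l : List (Fin n)) :
    rowMinor q (fun j i => X i j) l Finset.univ = 0 ∨
      ∃ (c : R) (K : Fin m ↪o Fin n), (List.ofFn K).Perm l ∧
        rowMinor q (fun j i => X i j) l Finset.univ = c • maximalMinor q X K := by
  by_cases hl : l.length = m
  swap
  · exact Or.inl (rowMinor_eq_zero_of_length_ne _ _ (by simpa using hl))
  by_cases hd : l.Nodup
  swap
  · exact Or.inl (rowMinor_eq_zero_of_not_nodup h.transpose hd _)
  right
  have hcard : l.toFinset.card = m := by rw [List.toFinset_card_of_nodup hd, hl]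
  have hperm : (List.ofFn (l.toFinset.orderEmbOfFin hcard)).Perm l := by
    rw [List.ofFn_eq_map, Finset.listMap_orderEmbOfFin_finRange]
    exact (List.perm_ext_iff_of_nodup (Finset.sort_nodup _ _) hd).2 (by simp)
  obtain ⟨c, hc⟩ := rowMinor_perm h.transpose hperm.symm
  exact ⟨c, _, hperm, by rw [hc, maximalMinor_eq_colMinor h]⟩

end

theorem sum_val_lt_of_exchange {n : ℕ} {P U V : Finset (Fin n)} (hP : P ⊆ U ∪ V) (hne : P ≠ V)
    (hcard : P.card = V.card) (hUV : ∀ x ∈ U, ∀ y ∈ V, x < y) :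
    ∑ x ∈ P, (x : ℕ) < ∑ x ∈ V, (x : ℕ) := by
  have hPV : (P \ V).Nonempty := by
    rw [Finset.sdiff_nonempty]
    exact fun h => hne (Finset.eq_of_subset_of_card_le h hcard.ge)
  have hc : (P \ V).card = (V \ P).card := by
    have h1 := Finset.card_sdiff_add_card_inter P V
    have h2 := Finset.card_sdiff_add_card_inter V P
    rw [Finset.inter_comm] at h2
    omega
  obtain ⟨p, hp, hmax⟩ := Finset.exists_max_image (P \ V) (fun x => (x : ℕ)) hPV
  have hU : ∀ x ∈ P \ V, x ∈ U := fun x hx => by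
    have hx' := Finset.mem_sdiff.1 hx
    rcases Finset.mem_union.1 (hP hx'.1) with h | h
    exacts [h, absurd h hx'.2]
  have h1 := Finset.sum_le_card_nsmul (P \ V) (fun x => (x : ℕ)) p hmax
  have h2 := Finset.card_nsmul_le_sum (V \ P) (fun x => (x : ℕ)) (p + 1) fun x hx =>
    hUV p (hU p hp) x (Finset.mem_sdiff.1 hx).1
  have h3 := Finset.sum_inter_add_sum_sdiff P V (fun x => (x : ℕ))
  have h4 := Finset.sum_inter_add_sum_sdiff V P (fun x => (x : ℕ))
  rw [Finset.inter_comm] at h4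
  have h5 := Finset.card_pos.2 hPV
  simp only [smul_eq_mul] at h1 h2
  rw [← hc] at h2
  nlinarith

section

variable {R T : Type*} [CommRing R] [Ring T] [Algebra R T] {q : Rˣ} {m n : ℕ}
  {X : Fin m → Fin n → T}

/-- A product of two maximal minors that is not standard is a combination of products whose
first factor has a smaller sum of column indices. -/
theorem maximalMinor_mul_mem_span (h : IsQuantumMatrix q X) {I J : Fin m ↪o Fin n}
    (hIJ : ¬ I ≤ J) :
    maximalMinor q X I * maximalMinor q X J ∈ Submodule.span R
      {x | ∃ K L : Fin m ↪o Fin n, ∑ i, (K i : ℕ) < ∑ i, (I i : ℕ) ∧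
        x = maximalMinor q X K * maximalMinor q X L} := by
  obtain ⟨r, hr⟩ : ∃ r, J r < I r := by
    by_contra! hc
    exact hIJ hc
  have hsI : (List.ofFn I).Pairwise (· < ·) := (List.sortedLT_ofFn_iff.2 I.strictMono).pairwise
  have hsJ : (List.ofFn J).Pairwise (· < ·) := (List.sortedLT_ofFn_iff.2 J.strictMono).pairwise
  set V := ((List.ofFn I).drop r).toFinset with hV
  set U := ((List.ofFn J).take (r + 1)).toFinset with hU
  have hVsort : V.sort (· ≤ ·) = (List.ofFn I).drop r :=
    (List.toFinset_sort (· ≤ ·) (hsI.drop.imp ne_of_lt)).2 (hsI.drop.imp le_of_lt)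
  have hUsort : U.sort (· ≤ ·) = (List.ofFn J).take (r + 1) :=
    (List.toFinset_sort (· ≤ ·) (hsJ.take.imp ne_of_lt)).2 (hsJ.take.imp le_of_lt)
  have hUV : ∀ x ∈ U, ∀ y ∈ V, x < y := by
    intro x hx y hy
    rw [hU, List.mem_toFinset, List.mem_take_iff_getElem] at hx
    rw [hV, List.mem_toFinset, List.mem_drop_iff_getElem] at hy
    obtain ⟨i, hi, rfl⟩ := hx
    obtain ⟨j, hj, rfl⟩ := hy
    simp only [List.getElem_ofFn]
    refine lt_of_le_of_lt (J.monotone ?_) (hr.trans_le (I.monotone ?_))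
    · rw [Fin.le_def]; simp only; omega
    · rw [Fin.le_def]; simp only; omega
  have hdisj : Disjoint U V :=
    Finset.disjoint_left.2 fun x hx hy => lt_irrefl _ (hUV x hx x hy)
  have hVcard : V.card = m - r := by
    rw [← Finset.length_sort (· ≤ ·), hVsort]; simp
  have hUcard : U.card = r + 1 := by
    rw [← Finset.length_sort (· ≤ ·), hUsort]; simp
  have hrel := plucker_relation h ((List.ofFn I).take r) ((List.ofFn J).drop (r + 1)) (U ∪ V)
    (by rw [Finset.card_union_of_disjoint hdisj, hVcard, hUcard, Fintype.card_fin]; omega)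
  rw [← Finset.add_sum_erase _ _ (Finset.mem_powerset.2 (Finset.subset_union_right :
    V ⊆ U ∪ V)), Finset.union_sdiff_cancel_right hdisj, hVsort, hUsort, List.take_append_drop,
    List.take_append_drop, ← maximalMinor_eq_colMinor h, ← maximalMinor_eq_colMinor h] at hrel
  have hunit : ∀ k : ℕ, (-(q : R)) ^ k = (((-q) ^ k : Rˣ) : R) := fun k => by simp
  rw [hunit] at hrel
  set c : Rˣ := (-q) ^ _
  rw [← one_smul R (maximalMinor q X I * _), ← c.inv_mul, ← smul_smul,
    eq_neg_of_add_eq_zero_left hrel]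
  refine Submodule.smul_mem _ _ (Submodule.neg_mem _ (Submodule.sum_mem _ fun P hP =>
    Submodule.smul_mem _ _ ?_))
  obtain ⟨hPV, hP⟩ := Finset.mem_erase.1 hP
  rcases colMinor_eq_zero_or_smul_maximalMinor h ((List.ofFn I).take r ++ P.sort (· ≤ ·)) with
    h0 | ⟨c₁, K, hK, hK'⟩
  · rw [h0, zero_mul]
    exact Submodule.zero_mem _
  rcases colMinor_eq_zero_or_smul_maximalMinor h
    (((U ∪ V) \ P).sort (· ≤ ·) ++ (List.ofFn J).drop (r + 1)) with h0 | ⟨c₂, L, _, hL'⟩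
  · rw [h0, mul_zero]
    exact Submodule.zero_mem _
  rw [hK', hL', smul_mul_assoc, mul_smul_comm]
  refine Submodule.smul_mem _ _ (Submodule.smul_mem _ _ (Submodule.subset_span ⟨K, L, ?_, rfl⟩))
  have hlen := hK.length_eq
  simp only [List.length_ofFn, List.length_append, List.length_take, Finset.length_sort] at hlen
  have hPcard : P.card = V.card := by omega
  have hlt := sum_val_lt_of_exchange (Finset.mem_powerset.1 hP) hPV hPcard hUV
  have hsum : ∀ Q : Finset (Fin n), ((Q.sort (· ≤ ·)).map Fin.val).sum = ∑ x ∈ Q, (x : ℕ) :=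
    fun Q => by
      rw [Finset.sum_eq_multiset_sum, ← Finset.sort_eq Q (· ≤ ·), Multiset.map_coe,
        Multiset.sum_coe]
  have hofFn : ∀ K : Fin m ↪o Fin n, ((List.ofFn K).map Fin.val).sum = ∑ i, (K i : ℕ) :=
    fun K => by rw [List.map_ofFn, List.sum_ofFn]; rfl
  rw [← hofFn K, ← hofFn I, (hK.map Fin.val).sum_eq, List.map_append, List.sum_append, hsum]
  conv_rhs => rw [← List.take_append_drop r (List.ofFn I), ← hVsort, List.map_append,
    List.sum_append, hsum]
  omega

/-- The span of the standard monomials of degree `s`. -/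
def standardSpan (q : Rˣ) (X : Fin m → Fin n → T) (s : ℕ) : Submodule R T :=
  Submodule.span R {x | ∃ l : List (Fin m ↪o Fin n), l.IsChain (· ≤ ·) ∧ l.length = s ∧
    x = (l.map (maximalMinor q X)).prod}

theorem prod_maximalMinor_mem_standardSpan (h : IsQuantumMatrix q X)
    (l : List (Fin m ↪o Fin n)) :
    (l.map (maximalMinor q X)).prod ∈ standardSpan q X l.length := by
  suffices hmul : ∀ s, (∀ l : List (Fin m ↪o Fin n), l.length = s →
      (l.map (maximalMinor q X)).prod ∈ standardSpan q X s) → ∀ (N : ℕ) (I : Fin m ↪o Fin n),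
      ∑ i, (I i : ℕ) = N → ∀ x ∈ standardSpan q X s,
        maximalMinor q X I * x ∈ standardSpan q X (s + 1) by
    suffices hall : ∀ s, ∀ l : List (Fin m ↪o Fin n), l.length = s →
      (l.map (maximalMinor q X)).prod ∈ standardSpan q X s from hall _ l rfl
    intro s
    induction s with
    | zero =>
      intro l hl
      rw [List.length_eq_zero_iff] at hl
      subst hl
      exact Submodule.subset_span ⟨[], by simp, rfl, rfl⟩
    | succ s ih =>
      rintro (_ | ⟨I, l⟩) hl
      · simp at hl
      · rw [List.map_cons, List.prod_cons]
        exact hmul s ih _ I rfl _ (ih l (by simpa using hl))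
  intro s hs N
  induction N using Nat.strong_induction_on with
  | _ N ih =>
    rintro I rfl x hx
    induction hx using Submodule.span_induction with
    | zero => rw [mul_zero]; exact Submodule.zero_mem _
    | add x y _ _ hx hy => rw [mul_add]; exact Submodule.add_mem _ hx hy
    | smul a x _ hx => rw [mul_smul_comm]; exact Submodule.smul_mem _ _ hx
    | mem x hx =>
      obtain ⟨l, hl, rfl, rfl⟩ := hx
      rcases l with _ | ⟨J, l⟩
      · exact Submodule.subset_span ⟨[I], by simp, rfl, rfl⟩
      by_cases hIJ : I ≤ J
      · exact Submodule.subset_span ⟨I :: J :: l, by simp [hIJ, hl], rfl, rfl⟩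
      rw [List.map_cons, List.prod_cons, ← mul_assoc]
      have key := maximalMinor_mul_mem_span h hIJ
      generalize maximalMinor q X I * maximalMinor q X J = z at key
      induction key using Submodule.span_induction with
      | zero => rw [zero_mul]; exact Submodule.zero_mem _
      | add x y _ _ hx hy => rw [add_mul]; exact Submodule.add_mem _ hx hy
      | smul a x _ hx => rw [smul_mul_assoc]; exact Submodule.smul_mem _ _ hx
      | mem x hx =>
        obtain ⟨K, L, hlt, rfl⟩ := hx
        rw [mul_assoc]
        exact ih _ hlt K rfl _ (hs (L :: l) rfl)

end

section products

variable {R T : Type*} [CommRing R] [Ring T] [Algebra R T] {q : Rˣ}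

/-- Quantum matrices are the solutions of a single quadratic (RTT type) equation. -/
theorem isQuantumMatrix_iff {α β : Type*} [LinearOrder α] [LinearOrder β] {X : α → β → T} :
    IsQuantumMatrix q X ↔ ∀ i k j l,
      (if i = k then (q : R) else 1) • (X k j * X i l) +
        (if i < k then (q : R) - ((q⁻¹ : Rˣ) : R) else 0) • (X i j * X k l) =
      (if j = l then (q : R) else 1) • (X i l * X k j) +
        (if j < l then (q : R) - ((q⁻¹ : Rˣ) : R) else 0) • (X i j * X k l) := by
  have hq : (q : R) * ((q⁻¹ : Rˣ) : R) = 1 := q.mul_inv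
  constructor
  · intro h i k j l
    rcases lt_trichotomy i k with hik | rfl | hik <;> rcases lt_trichotomy j l with hjl | rfl | hjl
    · simp [hik, hjl, hik.ne, hjl.ne, h.antidiag k i j l hik hjl]
    · simp only [hik.ne, hik, lt_irrefl, if_true, if_false, h.col i k j hik, smul_smul]
      match_scalars
      linear_combination -hq
    · simp only [hik.ne, hik, hjl.ne', hjl.not_gt, if_true, if_false, h.diag i k l j hik hjl]
      module
    · simp only [hjl.ne, hjl, lt_irrefl, if_true, if_false, h.row i j l hjl, smul_smul]
      match_scalars
      linear_combination hq
    · simp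
    · simp [hjl.ne', hjl.not_gt, h.row i l j hjl]
    · simp only [hik.ne', hik.not_gt, hjl.ne, hjl, if_true, if_false, h.diag k i j l hik hjl,
        h.antidiag i k j l hik hjl]
      module
    · simp [hik.ne', hik.not_gt, h.col k i j hik]
    · simp [hik.ne', hik.not_gt, hjl.ne', hjl.not_gt, h.antidiag i k l j hik hjl]
  · intro h
    refine ⟨fun i j l hjl => ?_, fun i k j hik => ?_, fun i k j l hik hjl => ?_,
      fun i k j l hik hjl => ?_⟩
    · have := h i i l j
      simpa [hjl.ne', hjl.not_gt, eq_comm] using this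
    · have := h k i j j
      simpa [hik.ne', hik.not_gt] using this
    · have := h i k l j
      simp only [hik.ne', hik.not_gt, hjl.ne', hjl.not_gt, if_false, one_smul, zero_smul,
        add_zero] at this
      exact this.symm
    · have := h i k l j
      simp only [hik.ne, hik, hjl.ne', hjl.not_gt, if_false, if_true, one_smul, zero_smul,
        add_zero] at this
      exact this.symm

/-- The product of two quantum matrices with commuting entries is a quantum matrix. -/
theorem IsQuantumMatrix.mul {α β γ : Type*} [LinearOrder α] [LinearOrder β] [LinearOrder γ]
    [Fintype β] {X : α → β → T} {Y : β → γ → T} (hX : IsQuantumMatrix q X)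
    (hY : IsQuantumMatrix q Y) (hc : ∀ i j k l, Commute (X i j) (Y k l)) :
    IsQuantumMatrix q fun i k => ∑ j, X i j * Y j k := by
  rw [isQuantumMatrix_iff] at *
  intro i k p r
  have key : ∀ a b c d, (∑ j, X a j * Y j c) * (∑ l, X b l * Y l d)
      = ∑ j, ∑ l, (X a j * X b l) * (Y j c * Y l d) := by
    intro a b c d
    rw [Finset.sum_mul_sum]
    refine Finset.sum_congr rfl fun j _ => Finset.sum_congr rfl fun l _ => ?_
    rw [mul_assoc, ← mul_assoc (Y j c), ← (hc b l j c).eq]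
    simp only [mul_assoc]
  have e1 : (if i = k then (q : R) else 1) • ((∑ j, X k j * Y j p) * ∑ j, X i j * Y j r) +
        (if i < k then (q : R) - ((q⁻¹ : Rˣ) : R) else 0) •
          ((∑ j, X i j * Y j p) * ∑ j, X k j * Y j r)
      = ∑ j, ∑ l, ((if j = l then (q : R) else 1) • (X i l * X k j) +
        (if j < l then (q : R) - ((q⁻¹ : Rˣ) : R) else 0) • (X i j * X k l)) *
          (Y j p * Y l r) := by
    rw [key, key]
    simp only [← hX, Finset.smul_sum, Finset.sum_add_distrib, smul_mul_assoc, add_mul]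
  have e2 : ∑ j, ∑ l, ((if j = l then (q : R) else 1) • (X i l * X k j) +
        (if j < l then (q : R) - ((q⁻¹ : Rˣ) : R) else 0) • (X i j * X k l)) * (Y j p * Y l r)
      = ∑ j, ∑ l, (X i j * X k l) * ((if j = l then (q : R) else 1) • (Y l p * Y j r) +
        (if j < l then (q : R) - ((q⁻¹ : Rˣ) : R) else 0) • (Y j p * Y l r)) := by
    simp only [add_mul, mul_add, Finset.sum_add_distrib, smul_mul_assoc, mul_smul_comm]
    congr 1
    rw [Finset.sum_comm]
    simp only [eq_comm]
  rw [e1, e2, key, key]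
  simp only [hY, Finset.smul_sum, Finset.sum_add_distrib, mul_smul_comm, mul_add]

/-- The block diagonal matrix with blocks `1` and `X`. -/
def blockOne {m n : ℕ} (X : Fin m → Fin n → T) : Fin (m + 1) → Fin (n + 1) → T :=
  Fin.cases (Fin.cases 1 fun _ => 0) fun i => Fin.cases 0 (X i)

theorem IsQuantumMatrix.blockOne {m n : ℕ} {X : Fin m → Fin n → T} (h : IsQuantumMatrix q X) :
    IsQuantumMatrix q (blockOne X) := by
  refine ⟨fun i j l hjl => ?_, fun i k j hik => ?_, fun i k j l hik hjl => ?_,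
    fun i k j l hik hjl => ?_⟩
  · induction i using Fin.cases <;> induction j using Fin.cases <;>
      induction l using Fin.cases <;> simp_all [_root_.blockOne]
    exact h.row _ _ _ hjl
  · induction i using Fin.cases <;> induction k using Fin.cases <;>
      induction j using Fin.cases <;> simp_all [_root_.blockOne]
    exact h.col _ _ _ hik
  · induction i using Fin.cases <;> induction k using Fin.cases <;> induction j using Fin.cases <;>
      induction l using Fin.cases <;> simp_all [_root_.blockOne]
    exact h.antidiag _ _ _ _ hik hjl
  · induction i using Fin.cases <;> induction k using Fin.cases <;> induction j using Fin.cases <;>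
      induction l using Fin.cases <;> simp_all [_root_.blockOne]
    exact h.diag _ _ _ _ hik hjl

/-- The matrix with first row `x` above the upper triangular matrix with entries `g l * x j`. -/
def triangularFactor {n : ℕ} (x g : Fin n → T) : Fin (n + 1) → Fin n → T :=
  Fin.cases x fun l j => if l ≤ j then g l * x j else 0

theorem isQuantumMatrix_triangularFactor {n : ℕ} {x g : Fin n → T}
    (hxx : ∀ j l, j < l → x j * x l = (q : R) • (x l * x j))
    (hgg : ∀ j l, j < l → g j * g l = (q : R) • (g l * g j))
    (hxg : ∀ j l, l ≤ j → x j * g l = (q : R) • (g l * x j))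
    (hxg' : ∀ j l, j < l → x j * g l = ((q⁻¹ : Rˣ) : R) • (g l * x j)) :
    IsQuantumMatrix q (triangularFactor x g) := by
  have hq : (q : R) * ((q⁻¹ : Rˣ) : R) = 1 := q.mul_inv
  have hxg1 : ∀ j l, l ≤ j → ∀ z, x j * (g l * z) = (q : R) • (g l * (x j * z)) := by
    intro j l h z
    rw [← mul_assoc, hxg j l h, smul_mul_assoc, mul_assoc]
  have hxg2 : ∀ j l, j < l → ∀ z, x j * (g l * z) = ((q⁻¹ : Rˣ) : R) • (g l * (x j * z)) := by
    intro j l h z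
    rw [← mul_assoc, hxg' j l h, smul_mul_assoc, mul_assoc]
  have hgg1 : ∀ j l, j < l → ∀ z, g j * (g l * z) = (q : R) • (g l * (g j * z)) := by
    intro j l h z
    rw [← mul_assoc, hgg j l h, smul_mul_assoc, mul_assoc]
  refine ⟨fun i j p hjp => ?_, fun i k j hik => ?_, fun i k j p hik hjp => ?_,
    fun i k j p hik hjp => ?_⟩
  · induction i using Fin.cases with
    | zero => exact hxx j p hjp
    | succ i =>
      simp only [triangularFactor, Fin.cases_succ]
      split_ifs with h1 h2 h2
      · simp only [mul_assoc, hxg1 j i h1, hxg1 p i h2, hxx j p hjp, mul_smul_comm, smul_smul]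
      · exact absurd (h1.trans hjp.le) h2
      all_goals simp
  · induction k using Fin.cases with
    | zero => simp at hik
    | succ k =>
      induction i using Fin.cases with
      | zero =>
        simp only [triangularFactor, Fin.cases_succ, Fin.cases_zero]
        split_ifs with h1
        · simp only [mul_assoc, hxg1 j k h1]
        · simp
      | succ i =>
        rw [Fin.succ_lt_succ_iff] at hik
        simp only [triangularFactor, Fin.cases_succ]
        split_ifs with h1 h2 h2
        · simp only [mul_assoc, hxg1 j k h2, hxg1 j i h1, hgg1 i k hik, mul_smul_comm, smul_smul]
        all_goals simp
  · induction i using Fin.cases with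
    | zero => simp at hik
    | succ i =>
      induction k using Fin.cases with
      | zero =>
        simp only [triangularFactor, Fin.cases_succ, Fin.cases_zero]
        split_ifs with h1
        · simp only [mul_assoc, hxg1 p i (h1.trans hjp.le), hxx j p hjp, mul_smul_comm]
        · simp
      | succ k =>
        rw [Fin.succ_lt_succ_iff] at hik
        simp only [triangularFactor, Fin.cases_succ]
        split_ifs with h1 h2 h2
        · simp only [mul_assoc, hxg1 j k (hik.le.trans h1), hxg1 p i (h1.trans hjp.le),
            hgg1 k i hik, hxx j p hjp, mul_smul_comm, smul_smul]
        all_goals simp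
  · induction k using Fin.cases with
    | zero => simp at hik
    | succ k =>
      induction i using Fin.cases with
      | zero =>
        simp only [triangularFactor, Fin.cases_succ, Fin.cases_zero]
        split_ifs with h1 h2 h2
        · simp only [mul_assoc, hxg1 j k h2, hxg1 p k h1, hxx j p hjp, mul_smul_comm, smul_smul]
          match_scalars
          linear_combination hq
        · simp only [mul_assoc, hxg2 j k (not_le.1 h2), hxx j p hjp, mul_smul_comm, smul_smul,
            mul_zero, smul_zero, add_zero]
          match_scalars
          linear_combination hq
        · exact absurd (h2.trans hjp.le) h1
        · simp
      | succ i =>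
        rw [Fin.succ_lt_succ_iff] at hik
        simp only [triangularFactor, Fin.cases_succ]
        by_cases h1 : k ≤ p
        · by_cases h2 : i ≤ j
          · by_cases h3 : k ≤ j
            · simp only [h1, h2, h3, h2.trans hjp.le, if_true, mul_assoc, hxg1 j k h3,
                hxg1 p i (h2.trans hjp.le), hxg1 p k h1, hgg1 i k hik, hxx j p hjp,
                mul_smul_comm, smul_smul]
              match_scalars
              linear_combination (q : R) * hq
            · simp only [h1, h2, h3, h2.trans hjp.le, if_true, if_false, mul_zero, smul_zero,
                add_zero, mul_assoc, hxg2 j k (not_le.1 h3), hxg1 p i (h2.trans hjp.le),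
                hgg1 i k hik, hxx j p hjp, mul_smul_comm, smul_smul]
              match_scalars
              linear_combination (q : R) * hq
          · have h3 : ¬ k ≤ j := fun h => h2 (hik.le.trans h)
            simp [h2, h3]
        · have h3 : ¬ k ≤ j := fun h => h1 (h.trans hjp.le)
          simp [h1, h3]

end products

section shifts

variable {R G : Type*} [CommRing R] [AddCommGroup G]

/-- The operator on the group algebra of `G` sending `e v` to `q ^ (φ v) • e (v + a)`. -/
noncomputable def shiftOp (q : Rˣ) (a : G) (φ : G →+ ℤ) : Module.End R (G →₀ R) :=
  Finsupp.linearCombination R fun v => Finsupp.single (v + a) ((q ^ φ v : Rˣ) : R)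

theorem shiftOp_single (q : Rˣ) (a : G) (φ : G →+ ℤ) (v : G) (c : R) :
    shiftOp q a φ (Finsupp.single v c) = Finsupp.single (v + a) (c * ((q ^ φ v : Rˣ) : R)) := by
  simp [shiftOp]

theorem shiftOp_mul_comm (q : Rˣ) (a b : G) (φ ψ : G →+ ℤ) :
    shiftOp q a φ * shiftOp q b ψ
      = ((q ^ (φ b - ψ a) : Rˣ) : R) • (shiftOp q b ψ * shiftOp q a φ) := by
  refine Finsupp.lhom_ext fun v c => ?_
  simp only [Module.End.mul_apply, LinearMap.smul_apply, shiftOp_single, Finsupp.smul_single,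
    map_add, add_right_comm v b a, smul_eq_mul]
  congr 1
  rw [mul_left_comm, mul_assoc, mul_assoc]
  simp only [← Units.val_mul, ← zpow_add]
  congr 3
  ring

end shifts

section realization

variable {R : Type*} [CommRing R]

/-- The sum of the coordinates `v (k, l)` with `p l`. -/
noncomputable def levelSum {n : ℕ} (k : ℕ) (p : Fin n → Prop) [DecidablePred p] :
    (ℕ × Fin n →₀ ℤ) →+ ℤ :=
  ∑ l with p l, Finsupp.applyAddHom (k, l)

theorem levelSum_single {n : ℕ} (k : ℕ) (p : Fin n → Prop) [DecidablePred p] (k' : ℕ) (j : Fin n)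
    (c : ℤ) : levelSum k p (Finsupp.single (k', j) c) = if k' = k ∧ p j then c else 0 := by
  simp only [levelSum, AddMonoidHom.finsetSum_apply, Finsupp.applyAddHom_apply,
    Finsupp.single_apply, Prod.mk.injEq]
  by_cases h : k' = k
  · simp [h]
  · simp [h]

/-- Quantum coordinates of the affine space of level `k`. -/
noncomputable def levelX (q : Rˣ) {n : ℕ} (k : ℕ) (j : Fin n) :
    Module.End R ((ℕ × Fin n →₀ ℤ) →₀ R) :=
  shiftOp q (Finsupp.single (k, j) 1) (levelSum k (j < ·))

/-- Inverse quantum coordinates of level `k`, up to a twist. -/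
noncomputable def levelG (q : Rˣ) {n : ℕ} (k : ℕ) (l : Fin n) :
    Module.End R ((ℕ × Fin n →₀ ℤ) →₀ R) :=
  shiftOp q (-Finsupp.single (k, l) 1) (-levelSum k (l ≤ ·))

theorem isQuantumMatrix_level (q : Rˣ) {n : ℕ} (k : ℕ) :
    IsQuantumMatrix q (triangularFactor (levelX q (n := n) k) (levelG q k)) := by
  refine isQuantumMatrix_triangularFactor ?_ ?_ ?_ ?_ <;> intro j l hjl
  · rw [levelX, levelX, shiftOp_mul_comm]
    simp [levelSum_single, hjl, hjl.not_gt]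
  · rw [levelG, levelG, shiftOp_mul_comm]
    simp [levelSum_single, hjl.le, hjl.not_ge]
  · rw [levelX, levelG, shiftOp_mul_comm]
    simp [levelSum_single, hjl, hjl.not_gt]
  · rw [levelX, levelG, shiftOp_mul_comm]
    simp [levelSum_single, hjl, hjl.not_ge]

theorem commute_levelX_triangularFactor (q : Rˣ) {n : ℕ} {k k' : ℕ} (h : k ≠ k') (j : Fin n)
    (l : Fin (n + 1)) (p : Fin n) :
    Commute (levelX q k j) (triangularFactor (levelX q k') (levelG q k') l p) := by
  have hx : ∀ l, Commute (levelX q k j) (levelX q k' l) := fun l => by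
    rw [commute_iff_eq, levelX, levelX, shiftOp_mul_comm]
    simp [levelSum_single, h, h.symm]
  induction l using Fin.cases with
  | zero => exact hx p
  | succ l =>
    simp only [triangularFactor, Fin.cases_succ]
    split_ifs
    · refine Commute.mul_right ?_ (hx p)
      rw [commute_iff_eq, levelX, levelG, shiftOp_mul_comm]
      simp [levelSum_single, h, h.symm]
    · exact Commute.zero_right _

theorem commute_levelG_triangularFactor (q : Rˣ) {n : ℕ} {k k' : ℕ} (h : k ≠ k') (j : Fin n)
    (l : Fin (n + 1)) (p : Fin n) :
    Commute (levelG q k j) (triangularFactor (levelX q k') (levelG q k') l p) := by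
  have hx : ∀ l, Commute (levelG q k j) (levelX q k' l) := fun l => by
    rw [commute_iff_eq, levelX, levelG, shiftOp_mul_comm]
    simp [levelSum_single, h, h.symm]
  induction l using Fin.cases with
  | zero => exact hx p
  | succ l =>
    simp only [triangularFactor, Fin.cases_succ]
    split_ifs
    · refine Commute.mul_right ?_ (hx p)
      rw [commute_iff_eq, levelG, levelG, shiftOp_mul_comm]
      simp [levelSum_single, h, h.symm]
    · exact Commute.zero_right _

theorem commute_triangularFactor (q : Rˣ) {n : ℕ} {k k' : ℕ} (h : k ≠ k')
    (i : Fin (n + 1)) (j : Fin n) (l : Fin (n + 1)) (p : Fin n) :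
    Commute (triangularFactor (levelX q k) (levelG q k) i j)
      (triangularFactor (levelX q k') (levelG q k') l p) := by
  have hx := fun j => commute_levelX_triangularFactor q h j l p
  induction i using Fin.cases with
  | zero => exact hx j
  | succ i =>
    change Commute (if i ≤ j then levelG q k i * levelX q k j else 0) _
    split_ifs
    · exact (commute_levelG_triangularFactor q h i l p).mul_left (hx j)
    · exact Commute.zero_left _

/-- A quantum `m × n` matrix of operators, built from the levels `k, k + 1, …` by successive
multiplication by triangular factors. -/
noncomputable def opMatrix (q : Rˣ) (n : ℕ) :
    (m : ℕ) → ℕ → Fin m → Fin n → Module.End R ((ℕ × Fin n →₀ ℤ) →₀ R)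
  | 0, _ => Fin.elim0
  | m + 1, k => fun i j => ∑ l, blockOne (opMatrix q n m (k + 1)) i l *
      triangularFactor (levelX q k) (levelG q k) l j

theorem commute_blockOne {T : Type*} [Ring T] {m n : ℕ} {X : Fin m → Fin n → T} {y : T}
    (h : ∀ i j, Commute (X i j) y) (i : Fin (m + 1)) (j : Fin (n + 1)) :
    Commute (blockOne X i j) y := by
  induction i using Fin.cases <;> induction j using Fin.cases <;> simp [blockOne, h]

theorem commute_opMatrix (q : Rˣ) {n : ℕ} (m : ℕ) : ∀ {k k' : ℕ}, k' < k →
    ∀ (i : Fin m) (j : Fin n) (l : Fin (n + 1)) (p : Fin n),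
      Commute (opMatrix q n m k i j) (triangularFactor (levelX q k') (levelG q k') l p) := by
  induction m with
  | zero => exact fun _ i => i.elim0
  | succ m ih =>
    intro k k' h i j l p
    refine Commute.sum_left _ _ _ fun r _ => Commute.mul_left ?_ ?_
    · exact commute_blockOne (fun i j => ih (Nat.lt_succ_of_lt h) i j l p) i r
    · exact commute_triangularFactor q h.ne' r j l p

theorem isQuantumMatrix_opMatrix (q : Rˣ) (n m : ℕ) :
    ∀ k, IsQuantumMatrix q (opMatrix q n m k) := by
  induction m with
  | zero =>
    exact fun k => ⟨fun i => i.elim0, fun i => i.elim0, fun i => i.elim0, fun i => i.elim0⟩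
  | succ m ih =>
    exact fun k => (ih (k + 1)).blockOne.mul (isQuantumMatrix_level q k) fun i j l p =>
      commute_blockOne (fun i j => commute_opMatrix q m (Nat.lt_succ_self k) i j l p) i j

end realization

section leading

variable {R G : Type*} [CommRing R] [AddCommGroup G] {deg : G →+ ℤ}

/-- The span of the basis vectors of degree less than `d`. -/
def lowPart (R : Type*) {G : Type*} [CommRing R] [AddCommGroup G] (deg : G →+ ℤ) (d : ℤ) :
    Submodule R (G →₀ R) :=
  Finsupp.supported R R {v | deg v < d}

/-- The operator `S` raises degrees by less than `d`. -/
def RaisesDegreeLT (deg : G →+ ℤ) (S : Module.End R (G →₀ R)) (d : ℤ) : Prop :=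
  ∀ v, S (Finsupp.single v 1) ∈ lowPart R deg (deg v + d)

/-- Up to invertible coefficients and terms of lower degree, `S` is the shift by `a`. -/
def HasLeadingShift (deg : G →+ ℤ) (S : Module.End R (G →₀ R)) (a : G) : Prop :=
  ∃ c : G → Rˣ, ∀ v,
    S (Finsupp.single v 1) - Finsupp.single (v + a) (c v : R) ∈ lowPart R deg (deg v + deg a)

theorem lowPart_mono {d e : ℤ} (h : d ≤ e) : lowPart R deg d ≤ lowPart R deg e :=
  Finsupp.supported_mono fun _ hv => lt_of_lt_of_le hv h

theorem single_mem_lowPart {v : G} {d : ℤ} (h : deg v < d) (c : R) :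
    Finsupp.single v c ∈ lowPart R deg d :=
  Finsupp.single_mem_supported R c h

theorem RaisesDegreeLT.map_mem {S : Module.End R (G →₀ R)} {d e : ℤ}
    (h : RaisesDegreeLT deg S (d + 1)) {w : G →₀ R} (hw : w ∈ lowPart R deg e) :
    S w ∈ lowPart R deg (e + d) := by
  have hw' : w = w.sum fun v c => c • Finsupp.single v (1 : R) := by simp
  rw [hw', map_finsuppSum]
  refine Submodule.sum_mem _ fun v hv => ?_
  beta_reduce
  rw [map_smul]
  refine Submodule.smul_mem _ _ (lowPart_mono ?_ (h v))
  have : deg v < e := hw hv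
  lia

theorem RaisesDegreeLT.sum {ι : Type*} {s : Finset ι} {S : ι → Module.End R (G →₀ R)} {d : ℤ}
    (h : ∀ i ∈ s, RaisesDegreeLT deg (S i) d) : RaisesDegreeLT deg (∑ i ∈ s, S i) d := by
  intro v
  rw [LinearMap.sum_apply]
  exact Submodule.sum_mem _ fun i hi => h i hi v

theorem RaisesDegreeLT.smul {S : Module.End R (G →₀ R)} {d : ℤ}
    (h : RaisesDegreeLT deg S d) (c : R) : RaisesDegreeLT deg (c • S) d :=
  fun v => Submodule.smul_mem _ c (h v)

theorem HasLeadingShift.raisesDegreeLT {S : Module.End R (G →₀ R)} {a : G} {d : ℤ}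
    (h : HasLeadingShift deg S a) (hd : deg a < d) : RaisesDegreeLT deg S d := by
  obtain ⟨c, hc⟩ := h
  intro v
  have h1 := lowPart_mono (show deg v + deg a ≤ deg v + d by lia) (hc v)
  have h2 : Finsupp.single (v + a) (c v : R) ∈ lowPart R deg (deg v + d) :=
    single_mem_lowPart (by rw [map_add]; lia) _
  simpa using Submodule.add_mem _ h1 h2

theorem HasLeadingShift.add {S S' : Module.End R (G →₀ R)} {a : G}
    (h : HasLeadingShift deg S a) (h' : RaisesDegreeLT deg S' (deg a)) :
    HasLeadingShift deg (S + S') a := by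
  obtain ⟨c, hc⟩ := h
  refine ⟨c, fun v => ?_⟩
  rw [LinearMap.add_apply, add_sub_right_comm]
  exact Submodule.add_mem _ (hc v) (h' v)

theorem HasLeadingShift.mul {S S' : Module.End R (G →₀ R)} {a b : G}
    (h : HasLeadingShift deg S a) (h' : HasLeadingShift deg S' b) :
    HasLeadingShift deg (S * S') (a + b) := by
  have hlow := h.raisesDegreeLT (lt_add_one (deg a))
  obtain ⟨c, hc⟩ := h
  obtain ⟨c', hc'⟩ := h'
  refine ⟨fun v => c' v * c (v + b), fun v => ?_⟩
  have h1 := hlow.map_mem (hc' v)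
  have h2 := Submodule.smul_mem _ (c' v : R) (hc (v + b))
  have h3 := Submodule.add_mem _ (lowPart_mono (e := deg v + deg (a + b)) (by simp; lia) h1)
    (lowPart_mono (by simp; lia) h2)
  convert h3 using 1
  rw [map_sub, smul_sub, ← map_smul, Finsupp.smul_single, Finsupp.smul_single, Module.End.mul_apply,
    smul_eq_mul, mul_one, smul_eq_mul, ← Units.val_mul, add_assoc, add_comm b a]
  abel

theorem hasLeadingShift_one : HasLeadingShift deg (1 : Module.End R (G →₀ R)) 0 :=
  ⟨fun _ => 1, fun v => by simp⟩

theorem hasLeadingShift_list_prod {ι : Type*} {S : ι → Module.End R (G →₀ R)} {a : ι → G}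
    (h : ∀ i, HasLeadingShift deg (S i) (a i)) (l : List ι) :
    HasLeadingShift deg (l.map S).prod (l.map a).sum := by
  induction l with
  | nil => exact hasLeadingShift_one
  | cons i l ih => simpa using (h i).mul ih

theorem hasLeadingShift_shiftOp (q : Rˣ) (a : G) (φ : G →+ ℤ) :
    HasLeadingShift deg (shiftOp q a φ) a :=
  ⟨fun v => q ^ φ v, fun v => by simp [shiftOp_single]⟩

/-- Operators with pairwise distinct leading shifts are linearly independent. -/
theorem linearIndependent_of_hasLeadingShift {ι : Type*} {S : ι → Module.End R (G →₀ R)}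
    {a : ι → G} (h : ∀ i, HasLeadingShift deg (S i) (a i)) (ha : Function.Injective a) :
    LinearIndependent R S := by
  classical
  refine (linearIndependent_iff (R := R) (v := S)).2 fun f hf => ?_
  by_contra hne
  obtain ⟨i, hi, hmax⟩ := f.support.exists_max_image (fun i => deg (a i))
    (Finsupp.support_nonempty_iff.2 hne)
  have h0 : ∑ k ∈ f.support, f k * S k (Finsupp.single 0 1) (a i) = 0 := by
    have := congrArg (fun L : Module.End R (G →₀ R) => L (Finsupp.single 0 1) (a i)) hf
    simpa [Finsupp.linearCombination_apply, Finsupp.sum, LinearMap.sum_apply] using this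
  have hlow : ∀ {w : G →₀ R} {d : ℤ}, w ∈ lowPart R deg d → d ≤ deg (a i) → w (a i) = 0 := by
    intro w d hw hd
    by_contra hwa
    exact absurd (hw (Finsupp.mem_support_iff.2 hwa)) (not_lt.2 hd)
  have hoff : ∀ k ∈ f.support, k ≠ i → S k (Finsupp.single 0 1) (a i) = 0 := by
    intro k hk hki
    obtain ⟨c, hc⟩ := h k
    have := hlow (hc 0) (by simpa using hmax k hk)
    simpa [Finsupp.single_apply, ha.ne hki] using this
  rw [Finset.sum_eq_single_of_mem i hi fun k hk hki => by rw [hoff k hk hki, mul_zero]] at h0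
  obtain ⟨c, hc⟩ := h i
  have := hlow (hc 0) (by simp)
  simp only [zero_add, Finsupp.sub_apply, Finsupp.single_eq_same, sub_eq_zero] at this
  rw [this, Units.mul_left_eq_zero] at h0
  exact Finsupp.mem_support_iff.1 hi h0

end leading

section opMatrix

variable {R : Type*} [CommRing R]

/-- The weighted degree in which the `(k, j)`-th coordinate has weight `(k + 1) * j`. -/
noncomputable def levelDegree (n : ℕ) : (ℕ × Fin n →₀ ℤ) →+ ℤ :=
  Finsupp.liftAddHom fun p => AddMonoidHom.mulRight (((p.1 : ℤ) + 1) * (p.2 : ℤ))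

theorem levelDegree_single {n : ℕ} (k : ℕ) (j : Fin n) (c : ℤ) :
    levelDegree n (Finsupp.single (k, j) c) = c * (((k : ℤ) + 1) * (j : ℤ)) := by
  simp [levelDegree]

theorem hasLeadingShift_opMatrix (q : Rˣ) (n m : ℕ) : ∀ (k : ℕ) (i : Fin m) (j : Fin n),
    HasLeadingShift (levelDegree n) (opMatrix q n m k i j) (Finsupp.single (k + i, j) 1) := by
  induction m with
  | zero => exact fun _ i => i.elim0
  | succ m ih =>
    intro k i j
    have hX : ∀ j, HasLeadingShift (levelDegree n) (levelX q k j) (Finsupp.single (k, j) 1) :=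
      fun j => hasLeadingShift_shiftOp q _ _
    have hG : ∀ j, HasLeadingShift (levelDegree n) (levelG q k j) (-Finsupp.single (k, j) 1) :=
      fun j => hasLeadingShift_shiftOp q _ _
    rw [opMatrix]
    beta_reduce
    rw [Fin.sum_univ_succ]
    induction i using Fin.cases with
    | zero => simpa [blockOne, triangularFactor] using hX j
    | succ i =>
      simp only [blockOne, triangularFactor, Fin.cases_zero, Fin.cases_succ, zero_mul, zero_add]
      rw [← Finset.add_sum_erase _ _ (Finset.mem_univ j), if_pos le_rfl]
      refine HasLeadingShift.add ?_ (RaisesDegreeLT.sum fun l hl => ?_)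
      · have := (ih (k + 1) i j).mul ((hG j).mul (hX j))
        rw [neg_add_cancel, add_zero] at this
        convert this using 3
        simp
        ring
      · split_ifs with h
        · refine ((ih (k + 1) i l).mul ((hG l).mul (hX j))).raisesDegreeLT ?_
          have hlt : (l : ℤ) < j := by
            exact_mod_cast Fin.lt_def.1 (lt_of_le_of_ne h (Finset.ne_of_mem_erase hl))
          simp only [map_add, map_neg, levelDegree_single, Fin.val_succ]
          push_cast
          nlinarith
        · intro v
          simp

end opMatrix

section minorShift

variable {R : Type*} [CommRing R] {m n : ℕ}

/-- The exponent of the diagonal term of the maximal minor with column set `J`. -/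
noncomputable def minorShift (J : Fin m → Fin n) : ℕ × Fin n →₀ ℤ :=
  ∑ i : Fin m, Finsupp.single ((i : ℕ), J i) 1

theorem levelDegree_minorShift (J : Fin m → Fin n) :
    levelDegree n (minorShift J) = ∑ i : Fin m, ((i : ℤ) + 1) * (J i : ℤ) := by
  simp [minorShift, levelDegree_single]

theorem levelDegree_minorShift_comp_perm_lt (J : Fin m ↪o Fin n) {σ : Equiv.Perm (Fin m)}
    (hσ : σ ≠ 1) : levelDegree n (minorShift (J ∘ σ)) < levelDegree n (minorShift J) := by
  rw [levelDegree_minorShift, levelDegree_minorShift]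
  have hmono : Monovary (fun i : Fin m => (i : ℤ) + 1) fun i : Fin m => (J i : ℤ) := by
    intro i j hij
    have : i < j := J.lt_iff_lt.1 (Fin.lt_def.2 (Int.ofNat_lt.1 hij))
    simpa using this.le
  refine (hmono.sum_mul_comp_perm_lt_sum_mul_iff (σ := σ)).2 fun hvary => hσ ?_
  have hstrict : StrictMono σ.symm := by
    intro i j hij
    refine lt_of_le_of_ne ?_ (σ.symm.injective.ne hij.ne)
    have : ((J i : Fin n) : ℤ) < (J j : Fin n) := by
      exact_mod_cast Fin.lt_def.1 (J.lt_iff_lt.2 hij)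
    simpa using hvary (i := σ.symm i) (j := σ.symm j) (by simpa using this)
  have hid : (σ.symm : Fin m → Fin m) = id :=
    (hstrict.range_inj strictMono_id).1 (by simp [σ.symm.surjective.range_eq])
  rw [← inv_eq_one]
  exact Equiv.ext fun i => congrFun hid i

theorem permLength_one : permLength (1 : Equiv.Perm (Fin m)) = 0 := by
  rw [permLength, Finset.card_eq_zero, Finset.filter_eq_empty_iff]
  exact fun p _ h => lt_asymm h.1 h.2

theorem hasLeadingShift_maximalMinor (q : Rˣ) (J : Fin m ↪o Fin n) :
    HasLeadingShift (levelDegree n) (maximalMinor q (opMatrix q n m 0) J) (minorShift J) := by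
  have hterm : ∀ K : Fin m → Fin n, HasLeadingShift (levelDegree n)
      (List.ofFn fun i => opMatrix q n m 0 i (K i)).prod (minorShift K) := by
    intro K
    have := hasLeadingShift_list_prod
      (fun i => hasLeadingShift_opMatrix q n m 0 i (K i)) (List.finRange m)
    simpa [List.ofFn_eq_map, minorShift, Fin.sum_univ_def] using this
  rw [maximalMinor, ← Finset.add_sum_erase _ _ (Finset.mem_univ 1)]
  refine HasLeadingShift.add ?_ (RaisesDegreeLT.sum fun σ hσ => ?_)
  · simpa [permLength_one] using hterm J
  · exact ((hterm (J ∘ σ)).raisesDegreeLT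
      (levelDegree_minorShift_comp_perm_lt J (Finset.ne_of_mem_erase hσ))).smul _

theorem minorShift_apply (J : Fin m → Fin n) (i : Fin m) (j : Fin n) :
    minorShift J ((i : ℕ), j) = if J i = j then 1 else 0 := by
  simp [minorShift, Finsupp.finsetSum_apply, Finsupp.single_apply, Fin.val_inj, ite_and]

theorem sum_minorShift_apply (l : List (Fin m ↪o Fin n)) (i : Fin m) (j : Fin n) :
    (l.map fun J : Fin m ↪o Fin n => minorShift J).sum ((i : ℕ), j)
      = (l.map fun J => J i).count j := by
  induction l with
  | nil => simp
  | cons J l ih =>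
    rw [List.map_cons, List.sum_cons, Finsupp.add_apply, ih, minorShift_apply, List.map_cons,
      List.count_cons]
    simp only [beq_iff_eq]
    split_ifs <;> push_cast <;> ring

theorem eq_of_sum_minorShift_eq (hm : 0 < m) {l l' : List (Fin m ↪o Fin n)}
    (hl : l.IsChain (· ≤ ·)) (hl' : l'.IsChain (· ≤ ·))
    (h : (l.map fun J : Fin m ↪o Fin n => minorShift J).sum
      = (l'.map fun J : Fin m ↪o Fin n => minorShift J).sum) : l = l' := by
  have hsorted : ∀ {l : List (Fin m ↪o Fin n)}, l.IsChain (· ≤ ·) → ∀ i,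
      (l.map fun J => J i).Pairwise (· ≤ ·) := by
    intro l hl i
    rw [List.pairwise_map]
    exact (List.isChain_iff_pairwise.1 hl).imp fun {I J} hIJ => hIJ i
  have hmap : ∀ i, (l.map fun J => J i) = l'.map fun J => J i := by
    intro i
    refine List.Perm.eq_of_pairwise (fun a b _ _ => le_antisymm) (hsorted hl i) (hsorted hl' i) ?_
    rw [List.perm_iff_count]
    intro j
    have := DFunLike.congr_fun h ((i : ℕ), j)
    rw [sum_minorShift_apply, sum_minorShift_apply] at this
    exact_mod_cast this
  refine List.ext_getElem (by simpa using congrArg List.length (hmap ⟨0, hm⟩)) fun t ht ht' => ?_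
  refine DFunLike.ext _ _ fun i => ?_
  simpa [ht, ht'] using congrArg (fun l => l[t]?) (hmap i)

end minorShift

section quantumMat

variable {R : Type*} [CommRing R] {m n : ℕ}

theorem isQuantumMatrix_qX (u : Rˣ) : IsQuantumMatrix u (qX R u (m := m) (n := n)) := by
  refine ⟨fun i j l h => ?_, fun i k j h => ?_, fun i k j l h h' => ?_, fun i k j l h h' => ?_⟩
  · simpa [qX] using RingQuot.mkAlgHom_rel R (qMatrixRel.row (u := u) i j l h)
  · simpa [qX] using RingQuot.mkAlgHom_rel R (qMatrixRel.col (u := u) i k j h)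
  · simpa [qX] using RingQuot.mkAlgHom_rel R (qMatrixRel.antidiag (u := u) i k j l h h')
  · simpa [qX] using RingQuot.mkAlgHom_rel R (qMatrixRel.diag (u := u) i k j l h h')

/-- The universal property of the algebra of quantum matrices. -/
noncomputable def IsQuantumMatrix.lift {T : Type*} [Ring T] [Algebra R T] {u : Rˣ}
    {X : Fin m → Fin n → T} (h : IsQuantumMatrix u X) : QuantumMat R u m n →ₐ[R] T :=
  RingQuot.liftAlgHom R ⟨FreeAlgebra.lift R fun p => X p.1 p.2, fun a b hab => by
    cases hab with
    | row i j l hjl => simpa using h.row i j l hjl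
    | col i k j hik => simpa using h.col i k j hik
    | antidiag i k j l hik hjl => simpa using h.antidiag i k j l hik hjl
    | diag i k j l hik hjl => simpa using h.diag i k j l hik hjl⟩

theorem IsQuantumMatrix.lift_qX {T : Type*} [Ring T] [Algebra R T] {u : Rˣ}
    {X : Fin m → Fin n → T} (h : IsQuantumMatrix u X) (i : Fin m) (j : Fin n) :
    h.lift (qX R u i j) = X i j := by
  simp [lift, qX]

theorem IsQuantumMatrix.lift_qMaximalMinor {T : Type*} [Ring T] [Algebra R T] {u : Rˣ}
    {X : Fin m → Fin n → T} (h : IsQuantumMatrix u X) (J : Fin m ↪o Fin n) :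
    h.lift (qMaximalMinor R u J) = maximalMinor u X J := by
  simp [qMaximalMinor, maximalMinor, map_list_prod, List.map_ofFn, Function.comp_def, h.lift_qX]

theorem linearIndependent_standardMonomials (u : Rˣ) (hm : 0 < m) :
    LinearIndependent R fun l : {l : List (Fin m ↪o Fin n) // l.IsChain (· ≤ ·)} =>
      ((l : List (Fin m ↪o Fin n)).map (qMaximalMinor R u)).prod := by
  have hop := isQuantumMatrix_opMatrix u n m 0
  refine LinearIndependent.of_comp hop.lift.toLinearMap ?_
  have := linearIndependent_of_hasLeadingShift
    (fun l : {l : List (Fin m ↪o Fin n) // l.IsChain (· ≤ ·)} =>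
      hasLeadingShift_list_prod (hasLeadingShift_maximalMinor u) l.1)
    fun l l' h => Subtype.ext (eq_of_sum_minorShift_eq hm l.2 l'.2 h)
  have hfun : (hop.lift.toLinearMap ∘ fun l : {l : List (Fin m ↪o Fin n) // l.IsChain (· ≤ ·)} =>
      ((l : List (Fin m ↪o Fin n)).map (qMaximalMinor R u)).prod)
      = fun l => (l.1.map (maximalMinor u (opMatrix u n m 0))).prod := by
    funext l
    simp [map_list_prod, Function.comp_def, hop.lift_qMaximalMinor]
  rw [hfun]
  exact this

end quantumMat

section fractionRing

variable {A : Type*} [CommRing A] [IsDomain A] {m n : ℕ}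

theorem isQuantumMatrix_qX_uFrac (u : Aˣ) :
    IsQuantumMatrix u (qX (FractionRing A) (uFrac A u) (m := m) (n := n)) := by
  have h := isQuantumMatrix_qX (uFrac A u) (m := m) (n := n)
  have h1 : ((uFrac A u : (FractionRing A)ˣ) : FractionRing A)
      = algebraMap A (FractionRing A) u := rfl
  have h2 : (((uFrac A u)⁻¹ : (FractionRing A)ˣ) : FractionRing A)
      = algebraMap A (FractionRing A) ((u⁻¹ : Aˣ) : A) := rfl
  refine ⟨fun i j l hjl => ?_, fun i k j hik => ?_, h.antidiag, fun i k j l hik hjl => ?_⟩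
  · rw [h.row i j l hjl, h1, algebraMap_smul]
  · rw [h.col i k j hik, h1, algebraMap_smul]
  · rw [h.diag i k j l hik hjl, h1, h2, ← map_sub, algebraMap_smul]

theorem qMaximalMinor_uFrac (u : Aˣ) (J : Fin m ↪o Fin n) :
    qMaximalMinor _ (uFrac A u) J
      = maximalMinor u (qX (FractionRing A) (uFrac A u)) J := by
  have h1 : ((uFrac A u : (FractionRing A)ˣ) : FractionRing A)
      = algebraMap A (FractionRing A) u := rfl
  simp only [qMaximalMinor, maximalMinor, h1, ← map_neg, ← map_pow, algebraMap_smul]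

end fractionRing

/-- Let `A` be a commutative integral domain, `u` a unit of `A` and
`m ≤ n` positive integers.  The standard monomials on `Π_{m,n}` (products `[I₁]⋯[I_s]` of
maximal quantum minors along `≤st`-nondecreasing lists, the empty product being `1`) form an
`A`-module basis of the quantum grassmannian `O_u(G_{m,n}(A))`: they are linearly independent
over `A` and span it as an `A`-module. -/
theorem quantumGrassmannian_standard_monomials_basis (A : Type*) [CommRing A] [IsDomain A]
    (u : Aˣ) (m n : ℕ) (hm : 0 < m) (hmn : m ≤ n) :
    LinearIndependent A
      (fun l : {l : List (Fin m ↪o Fin n) // l.Chain' (· ≤ ·)} =>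
        ((l : List (Fin m ↪o Fin n)).map (qMaximalMinor _ (uFrac A u))).prod) ∧
    Submodule.span A
        (Set.range fun l : {l : List (Fin m ↪o Fin n) // l.Chain' (· ≤ ·)} =>
          ((l : List (Fin m ↪o Fin n)).map (qMaximalMinor _ (uFrac A u))).prod)
      = Subalgebra.toSubmodule (quantumGrassmannianSubmodule A u m n) := by
  have hminor : (qMaximalMinor _ (uFrac A u) : (Fin m ↪o Fin n) → _)
      = maximalMinor u (qX (FractionRing A) (uFrac A u)) := funext (qMaximalMinor_uFrac u)
  refine ⟨?_, le_antisymm (Submodule.span_le.2 ?_) ?_⟩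
  · exact (linearIndependent_standardMonomials (uFrac A u) hm).restrict_scalars' A
  · rintro _ ⟨l, rfl⟩
    refine Subalgebra.list_prod_mem _ fun x hx => ?_
    obtain ⟨J, -, rfl⟩ := List.mem_map.1 hx
    exact Algebra.subset_adjoin ⟨J, rfl⟩
  · rw [quantumGrassmannianSubmodule, Algebra.adjoin_eq_span, Submodule.span_le]
    intro x hx
    obtain ⟨l, hl, rfl⟩ := Submonoid.exists_list_of_mem_closure hx
    obtain ⟨l, rfl⟩ : l ∈ Set.range (List.map (qMaximalMinor _ (uFrac A u))) := by
      rw [Set.range_list_map]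
      exact hl
    rw [hminor]
    refine Submodule.span_mono ?_
      (prod_maximalMinor_mem_standardSpan (isQuantumMatrix_qX_uFrac u) l)
    rintro _ ⟨l', hl', -, rfl⟩
    exact ⟨⟨l', hl'⟩, rfl⟩
end

section
/- Let A be a commutative integral domain, u a unit of A, and m ≤ n positive integers. Let I, J ∈ Π_{m,n} be incomparable with respect to ≤st. Then in O_u(G_{m,n}(A)) the product [I][J] may be rewritten as [I][J] = Σ_{i=1}^{s} k_i [I_i][J_i], with k_i ∈ A and I_i, J_i ∈ Π_{m,n} satisfying I_i ≤st J_i, I_i <st I and I_i <st J for each i. -/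
/-- The defining relations of quantum matrices. -/
structure IsQuantumMatrix_s11 {R T : Type*} [CommRing R] [Ring T] [Algebra R T] {ι κ : Type*}
    [LinearOrder ι] [LinearOrder κ] (u : Rˣ) (X : ι → κ → T) : Prop where
  row : ∀ i j l, j < l → X i j * X i l = (u : R) • (X i l * X i j)
  col : ∀ i k j, i < k → X i j * X k j = (u : R) • (X k j * X i j)
  antidiag : ∀ i k j l, k < i → j < l → X i j * X k l = X k l * X i j
  diag : ∀ i k j l, i < k → j < l → X i j * X k l =
    X k l * X i j + ((u : R) - ((u⁻¹ : Rˣ) : R)) • (X i l * X k j)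

theorem IsQuantumMatrix_s11.transpose {R T : Type*} [CommRing R] [Ring T] [Algebra R T]
    {ι κ : Type*} [LinearOrder ι] [LinearOrder κ] {u : Rˣ} {X : ι → κ → T}
    (h : IsQuantumMatrix_s11 u X) : IsQuantumMatrix_s11 u (fun j i => X i j) where
  row i j l := h.col j l i
  col i k j := h.row j i k
  antidiag i k j l hik hjl := (h.antidiag l j k i hjl hik).symm
  diag i k j l hik hjl := by rw [h.diag j l i k hjl hik, h.antidiag l j i k hjl hik]

section Minor

variable {R T : Type*} [CommRing R] [Ring T] [Algebra R T] {ι κ : Type*} [LinearOrder κ]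

/-- The quantum minor with rows listed by the word `w` and column set `K`, defined by expansion
along the first row. -/
def wordMinor (u : R) (X : ι → κ → T) : List ι → Finset κ → T
  | [], K => if K = ∅ then 1 else 0
  | i :: w, K => ∑ j ∈ K, (-u) ^ (K.filter (· < j)).card • (X i j * wordMinor u X w (K.erase j))

theorem wordMinor_eq_zero_of_card_ne (u : R) (X : ι → κ → T) (w : List ι) (K : Finset κ)
    (h : K.card ≠ w.length) : wordMinor u X w K = 0 := by
  induction w generalizing K with
  | nil =>
    have : K ≠ ∅ := by rintro rfl; simp at h
    simp [wordMinor, this]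
  | cons i w ih =>
    refine Finset.sum_eq_zero fun j hj => ?_
    rw [ih, mul_zero, smul_zero]
    have := Finset.card_erase_add_one hj
    simp only [List.length_cons] at h
    omega

/-- Expansion of a quantum minor along its first two rows. -/
theorem wordMinor_cons_cons (u : R) (X : ι → κ → T) (a b : ι) (w : List ι) (K : Finset κ) :
    wordMinor u X (a :: b :: w) K = ∑ j ∈ K, ∑ l ∈ K.filter (j < ·),
      (-u) ^ ((K.filter (· < j)).card + ((K.erase j).filter (· < l)).card) •
        ((X a j * X b l - u • (X a l * X b j)) * wordMinor u X w ((K.erase j).erase l)) := by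
  have expand : wordMinor u X (a :: b :: w) K = ∑ j ∈ K, ∑ l ∈ K.erase j,
      (-u) ^ ((K.filter (· < j)).card + ((K.erase j).filter (· < l)).card) •
        (X a j * X b l * wordMinor u X w ((K.erase j).erase l)) := by
    simp only [wordMinor, Finset.mul_sum, Finset.smul_sum, mul_smul_comm, smul_smul, pow_add,
      mul_assoc]
  have split : ∀ j ∈ K, ∀ f : κ → T, ∑ l ∈ K.erase j, f l =
      ∑ l ∈ K.filter (j < ·), f l + ∑ l ∈ K.filter (· < j), f l := by
    intro j hj f
    rw [← Finset.sum_union (Finset.disjoint_filter.2 fun _ _ h => not_lt.2 h.le)]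
    congr 1
    ext l
    simp only [Finset.mem_erase, Finset.mem_union, Finset.mem_filter, ne_eq]
    constructor
    · rintro ⟨h, hl⟩
      rcases lt_or_gt_of_ne h with h | h <;> simp [h, hl]
    · rintro (⟨h, hl⟩ | ⟨h, hl⟩)
      exacts [⟨hl.ne', h⟩, ⟨hl.ne, h⟩]
  rw [expand, Finset.sum_congr rfl fun j hj => split j hj _, Finset.sum_add_distrib]
  conv_lhs => rw [add_comm]
  rw [Finset.sum_comm' (t' := K) (s' := fun j => K.filter (j < ·))
    (by intro x y; simp only [Finset.mem_filter]; tauto), ← Finset.sum_add_distrib]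
  refine Finset.sum_congr rfl fun j hj => ?_
  rw [← Finset.sum_add_distrib]
  refine Finset.sum_congr rfl fun l hl => ?_
  obtain ⟨hl, hjl⟩ := Finset.mem_filter.1 hl
  have e1 : ((K.erase l).filter (· < j)) = K.filter (· < j) := by
    rw [Finset.filter_erase, Finset.erase_eq_of_notMem]
    simp [hjl.le]
  have e2 : (K.filter (· < l)).card = ((K.erase j).filter (· < l)).card + 1 := by
    rw [Finset.filter_erase, Finset.card_erase_add_one]
    simp [hj, hjl]
  rw [e1, e2, Finset.erase_right_comm, sub_mul, smul_sub, smul_mul_assoc, smul_smul, pow_add,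
    pow_add, pow_add, pow_one, sub_eq_add_neg, ← neg_smul, add_comm]
  congr 2
  ring

variable [LinearOrder ι] {u : Rˣ} {X : ι → κ → T}

theorem wordMinor_cons_self (hX : IsQuantumMatrix_s11 u X) (i : ι) (w : List ι) (K : Finset κ) :
    wordMinor (u : R) X (i :: i :: w) K = 0 := by
  rw [wordMinor_cons_cons]
  refine Finset.sum_eq_zero fun j _ => Finset.sum_eq_zero fun l hl => ?_
  rw [hX.row i j l (Finset.mem_filter.1 hl).2, sub_self, zero_mul, smul_zero]

theorem wordMinor_swap (hX : IsQuantumMatrix_s11 u X) {i k : ι} (hik : i < k) (w : List ι)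
    (K : Finset κ) :
    wordMinor (u : R) X (k :: i :: w) K = (-(u : R)) • wordMinor (u : R) X (i :: k :: w) K := by
  rw [wordMinor_cons_cons, wordMinor_cons_cons, Finset.smul_sum]
  refine Finset.sum_congr rfl fun j _ => ?_
  rw [Finset.smul_sum]
  refine Finset.sum_congr rfl fun l hl => ?_
  have hjl := (Finset.mem_filter.1 hl).2
  have key : X k j * X i l - (u : R) • (X k l * X i j) =
      (-(u : R)) • (X i j * X k l - (u : R) • (X i l * X k j)) := by
    rw [hX.antidiag k i j l hik hjl, hX.diag i k j l hik hjl]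
    simp only [smul_sub, smul_add, neg_smul, sub_smul, smul_smul, neg_mul, Units.mul_inv, one_smul]
    abel
  rw [key, smul_comm, smul_mul_assoc]

theorem wordMinor_perm (hX : IsQuantumMatrix_s11 u X) {w w' : List ι} (h : w.Perm w') :
    ∃ v : Rˣ, ∀ K, wordMinor (u : R) X w K = (v : R) • wordMinor (u : R) X w' K := by
  induction h with
  | nil => exact ⟨1, by simp⟩
  | cons a _ ih =>
    obtain ⟨v, hv⟩ := ih
    refine ⟨v, fun K => ?_⟩
    simp only [wordMinor, hv, Finset.smul_sum, mul_smul_comm, smul_comm (v : R)]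
  | swap a b w =>
    rcases lt_trichotomy a b with h | rfl | h
    · exact ⟨-u, fun K => by rw [wordMinor_swap hX h]; simp⟩
    · exact ⟨1, by simp⟩
    · refine ⟨(-u)⁻¹, fun K => ?_⟩
      rw [wordMinor_swap hX h, smul_smul, ← Units.val_neg, Units.inv_mul, one_smul]
  | trans _ _ ih₁ ih₂ =>
    obtain ⟨v, hv⟩ := ih₁
    obtain ⟨v', hv'⟩ := ih₂
    exact ⟨v * v', fun K => by rw [hv, hv', smul_smul, Units.val_mul]⟩

theorem wordMinor_eq_zero_of_not_nodup (hX : IsQuantumMatrix_s11 u X) {w : List ι}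
    (h : ¬ w.Nodup) (K : Finset κ) : wordMinor (u : R) X w K = 0 := by
  obtain ⟨a, ha⟩ := List.exists_duplicate_iff_not_nodup.2 h
  obtain ⟨l, hl⟩ := (List.duplicate_iff_sublist.1 ha).exists_perm_append
  obtain ⟨v, hv⟩ := wordMinor_perm hX hl
  rw [hv, List.cons_append, List.cons_append, List.nil_append, wordMinor_cons_self hX, smul_zero]

end Minor

section Laplace

variable {R T : Type*} [CommRing R] [Ring T] [Algebra R T] {ι κ : Type*} [LinearOrder κ]

/-- The number of pairs `(a, b)` in `A × B` with `b < a`. -/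
def inversionsBetween (A B : Finset κ) : ℕ := ((A ×ˢ B).filter fun p => p.2 < p.1).card

theorem inversionsBetween_eq_sum (A B : Finset κ) :
    inversionsBetween A B = ∑ a ∈ A, (B.filter (· < a)).card := by
  rw [inversionsBetween, Finset.card_filter, Finset.sum_product]
  simp only [Finset.card_filter]

theorem inversionsBetween_erase {A K : Finset κ} (hA : A ⊆ K) {j : κ} (hj : j ∈ A) :
    inversionsBetween A (K \ A) + (A.filter (· < j)).card =
      (K.filter (· < j)).card + inversionsBetween (A.erase j) (K \ A) := by
  rw [inversionsBetween_eq_sum, inversionsBetween_eq_sum, ← Finset.add_sum_erase _ _ hj]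
  have : (K.filter (· < j)).card = ((K \ A).filter (· < j)).card + (A.filter (· < j)).card := by
    rw [← Finset.card_union_of_disjoint, ← Finset.filter_union, Finset.sdiff_union_of_subset hA]
    exact Finset.disjoint_filter_filter Finset.sdiff_disjoint
  omega

/-- Laplace expansion of a quantum minor along an initial segment of its rows. -/
theorem wordMinor_append (u : R) (X : ι → κ → T) (w w' : List ι) (K : Finset κ) :
    wordMinor u X (w ++ w') K = ∑ A ∈ K.powerset, (-u) ^ inversionsBetween A (K \ A) •
      (wordMinor u X w A * wordMinor u X w' (K \ A)) := by
  induction w generalizing K with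
  | nil =>
    rw [Finset.sum_eq_single_of_mem ∅ (Finset.empty_mem_powerset K)]
    · simp [wordMinor, inversionsBetween]
    · intro A _ hA
      simp [wordMinor, hA]
  | cons i w ih =>
    simp only [List.cons_append, wordMinor, ih, Finset.mul_sum, Finset.smul_sum, Finset.sum_mul,
      mul_smul_comm, smul_mul_assoc, smul_smul, ← pow_add, Finset.sum_sigma']
    refine Finset.sum_bij' (fun p _ => ⟨insert p.1 p.2, p.1⟩) (fun p _ => ⟨p.2, p.1.erase p.2⟩)
      ?_ ?_ ?_ ?_ ?_
    · rintro ⟨j, A⟩ h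
      simp only [Finset.mem_sigma, Finset.mem_powerset] at h ⊢
      exact ⟨Finset.insert_subset h.1 (h.2.trans (Finset.erase_subset _ _)),
        Finset.mem_insert_self _ _⟩
    · rintro ⟨A, j⟩ h
      simp only [Finset.mem_sigma, Finset.mem_powerset] at h ⊢
      exact ⟨h.1 h.2, Finset.erase_subset_erase _ h.1⟩
    · rintro ⟨j, A⟩ h
      simp only [Finset.mem_sigma, Finset.mem_powerset] at h
      have : j ∉ A := fun hj => Finset.notMem_erase j K (h.2 hj)
      simp [Finset.erase_insert this]
    · rintro ⟨A, j⟩ h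
      simp only [Finset.mem_sigma, Finset.mem_powerset] at h
      simp [Finset.insert_erase h.2]
    · rintro ⟨j, A⟩ h
      simp only [Finset.mem_sigma, Finset.mem_powerset] at h
      have hj : j ∉ A := fun hj => Finset.notMem_erase j K (h.2 hj)
      have hA : insert j A ⊆ K :=
        Finset.insert_subset h.1 (h.2.trans (Finset.erase_subset _ _))
      have e : K.erase j \ A = K \ insert j A := by
        ext x; simp only [Finset.mem_sdiff, Finset.mem_erase, Finset.mem_insert]; tauto
      have := inversionsBetween_erase hA (Finset.mem_insert_self j A)
      rw [Finset.erase_insert hj] at this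
      simp only [Finset.erase_insert hj, e, this, mul_assoc]

theorem wordMinor_cons_insert (u : R) (X : ι → κ → T) (i : ι) (w : List ι) {c : κ} {K : Finset κ}
    (hc : ∀ j ∈ K, c < j) :
    wordMinor u X (i :: w) (insert c K) = X i c * wordMinor u X w K + ∑ j ∈ K,
      (-u) ^ ((K.filter (· < j)).card + 1) •
        (X i j * wordMinor u X w (insert c (K.erase j))) := by
  have hcK : c ∉ K := fun h => lt_irrefl c (hc c h)
  rw [wordMinor, Finset.sum_insert hcK, Finset.erase_insert hcK]
  congr 1
  · have : (insert c K).filter (· < c) = ∅ := by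
      rw [Finset.filter_eq_empty_iff]
      intro x hx
      rcases Finset.mem_insert.1 hx with rfl | h
      exacts [lt_irrefl _, (hc x h).not_gt]
    simp [this]
  · refine Finset.sum_congr rfl fun j hj => ?_
    rw [Finset.filter_insert, if_pos (hc j hj), Finset.card_insert_of_notMem (by simp [hcK]),
      Finset.erase_insert_of_ne (hc j hj).ne]

variable [LinearOrder ι] {u : Rˣ} {X : ι → κ → T}

theorem Finset.exists_eq_insert_of_lt {α : Type*} [LinearOrder α] {S : Finset α}
    (h : S.Nonempty) : ∃ a S', S = insert a S' ∧ (∀ b ∈ S', a < b) ∧ S'.card + 1 = S.card :=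
  ⟨S.min' h, S.erase (S.min' h), (Finset.insert_erase (S.min'_mem h)).symm,
    fun _ hb => S.min'_lt_of_mem_erase_min' h hb, Finset.card_erase_add_one (S.min'_mem h)⟩

theorem Finset.sort_insert_of_lt {α : Type*} [LinearOrder α] {a : α} {S : Finset α}
    (h : ∀ b ∈ S, a < b) : (insert a S).sort = a :: S.sort :=
  Finset.sort_insert _ (fun b hb => (h b hb).le) fun ha => lt_irrefl a (h a ha)

/-- A quantum minor may be expanded along rows or along columns. -/
theorem wordMinor_sort_transpose (hX : IsQuantumMatrix_s11 u X) (S : Finset ι) (K : Finset κ) :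
    wordMinor (u : R) X S.sort K = wordMinor (u : R) (fun j i => X i j) K.sort S := by
  induction hd : S.card + K.card using Nat.strong_induction_on generalizing S K with
  | _ d ih =>
  rcases S.eq_empty_or_nonempty with rfl | hS
  · rcases K.eq_empty_or_nonempty with rfl | hK
    · simp [wordMinor]
    · rw [wordMinor_eq_zero_of_card_ne, wordMinor_eq_zero_of_card_ne] <;>
        simp [hK.ne_empty, eq_comm]
  rcases K.eq_empty_or_nonempty with rfl | hK
  · rw [wordMinor_eq_zero_of_card_ne, wordMinor_eq_zero_of_card_ne] <;>
      simp [hS.ne_empty, eq_comm]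
  obtain ⟨i, S, rfl, hi, hSc⟩ := Finset.exists_eq_insert_of_lt hS
  obtain ⟨c, K, rfl, hc, hKc⟩ := Finset.exists_eq_insert_of_lt hK
  have hi' : ∀ k, ∀ b ∈ S.erase k, i < b := fun k b hb => hi b (Finset.mem_of_mem_erase hb)
  have hc' : ∀ k, ∀ b ∈ K.erase k, c < b := fun k b hb => hc b (Finset.mem_of_mem_erase hb)
  rw [Finset.sort_insert_of_lt hi, Finset.sort_insert_of_lt hc, wordMinor_cons_insert _ _ _ _ hc,
    wordMinor_cons_insert _ _ _ _ hi, ih (S.card + K.card) (by omega) S K rfl]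
  congr 1
  have left : ∀ j ∈ K, wordMinor (u : R) X S.sort (insert c (K.erase j)) = ∑ k ∈ S,
      (-(u : R)) ^ (S.filter (· < k)).card • (X k c *
        wordMinor (u : R) X (S.erase k).sort (K.erase j)) := by
    intro j hj
    have hj' := Finset.card_erase_add_one hj
    have hins : (insert c (K.erase j)).card = K.card := by
      rw [Finset.card_insert_of_notMem fun h => lt_irrefl c (hc' j c h), hj']
    rw [ih (S.card + K.card) (by omega) S _ (by rw [hins]), Finset.sort_insert_of_lt (hc' j),
      wordMinor]
    refine Finset.sum_congr rfl fun k hk => ?_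
    have := Finset.card_erase_add_one hk
    rw [ih ((S.erase k).card + (K.erase j).card) (by omega) _ _ rfl]
  have right : ∀ k ∈ S, wordMinor (u : R) (fun j i => X i j) K.sort (insert i (S.erase k)) =
      ∑ j ∈ K, (-(u : R)) ^ (K.filter (· < j)).card • (X i j *
        wordMinor (u : R) X (S.erase k).sort (K.erase j)) := by
    intro k hk
    have hk' := Finset.card_erase_add_one hk
    have hins : (insert i (S.erase k)).card = S.card := by
      rw [Finset.card_insert_of_notMem fun h => lt_irrefl i (hi' k i h), hk']
    rw [← ih (S.card + K.card) (by omega) _ K (by rw [hins]), Finset.sort_insert_of_lt (hi' k),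
      wordMinor]
  rw [Finset.sum_congr rfl fun j hj => by rw [left j hj, Finset.mul_sum, Finset.smul_sum],
    Finset.sum_comm]
  refine Finset.sum_congr rfl fun k hk => ?_
  rw [right k hk, Finset.mul_sum, Finset.smul_sum]
  refine Finset.sum_congr rfl fun j hj => ?_
  rw [mul_smul_comm, mul_smul_comm, smul_smul, smul_smul, ← mul_assoc, ← mul_assoc,
    hX.antidiag k i c j (hi k hk) (hc j hj)]
  congr 1
  ring

/-- Quantum Garnir relations between maximal minors of an `m`-rowed quantum matrix. -/
theorem garnir_relation [Fintype ι] (hX : IsQuantumMatrix_s11 u X) (c c' : List κ) (K : Finset κ)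
    (hK : Fintype.card ι < K.card) :
    ∑ A ∈ K.powerset, (-(u : R)) ^ inversionsBetween A (K \ A) •
      (wordMinor (u : R) (fun j i => X i j) (c ++ A.sort) Finset.univ *
        wordMinor (u : R) (fun j i => X i j) ((K \ A).sort ++ c') Finset.univ) = 0 := by
  have key : ∀ S S' : Finset ι, ∑ A ∈ K.powerset, (-(u : R)) ^ inversionsBetween A (K \ A) •
      (wordMinor (u : R) (fun j i => X i j) A.sort S *
        wordMinor (u : R) (fun j i => X i j) (K \ A).sort S') = 0 := by
    intro S S'
    simp only [← wordMinor_sort_transpose hX]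
    rw [← wordMinor_append]
    by_cases hl : K.card = (S.sort ++ S'.sort).length
    · apply wordMinor_eq_zero_of_not_nodup hX
      intro h
      have := h.length_le_card
      omega
    · exact wordMinor_eq_zero_of_card_ne _ _ _ _ hl
  simp only [wordMinor_append, Finset.sum_mul_sum, Finset.smul_sum]
  rw [Finset.sum_comm]
  refine Finset.sum_eq_zero fun S _ => ?_
  rw [Finset.sum_comm]
  refine Finset.sum_eq_zero fun S' _ => ?_
  have := congr_arg (fun t => (-(u : R)) ^ inversionsBetween S (Finset.univ \ S) •
    (-(u : R)) ^ inversionsBetween S' (Finset.univ \ S') •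
    (wordMinor (u : R) (fun j i => X i j) c S * t *
      wordMinor (u : R) (fun j i => X i j) c' (Finset.univ \ S'))) (key (Finset.univ \ S) S')
  simp only [mul_zero, zero_mul, smul_zero] at this
  rw [← this, Finset.mul_sum, Finset.sum_mul, Finset.smul_sum, Finset.smul_sum]
  refine Finset.sum_congr rfl fun A _ => ?_
  simp only [mul_smul_comm, smul_mul_assoc, mul_assoc, smul_smul]
  congr 1
  ring

end Laplace

section Permutations

/-- The permutation of `Fin (t + 1)` sending `0` to `p` and acting as `τ` on the other places. -/
def consPerm {t : ℕ} (p : Fin (t + 1)) (τ : Equiv.Perm (Fin t)) : Equiv.Perm (Fin (t + 1)) :=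
  (finSuccEquiv t).trans ((Equiv.optionCongr τ).trans (finSuccEquiv' p).symm)

@[simp]
theorem consPerm_zero {t : ℕ} (p : Fin (t + 1)) (τ : Equiv.Perm (Fin t)) :
    consPerm p τ 0 = p := by
  simp [consPerm]

@[simp]
theorem consPerm_succ {t : ℕ} (p : Fin (t + 1)) (τ : Equiv.Perm (Fin t)) (i : Fin t) :
    consPerm p τ i.succ = p.succAbove (τ i) := by
  simp [consPerm]

theorem consPerm_bijective (t : ℕ) :
    Function.Bijective fun x : Fin (t + 1) × Equiv.Perm (Fin t) => consPerm x.1 x.2 := by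
  rw [Fintype.bijective_iff_injective_and_card]
  constructor
  · rintro ⟨p, τ⟩ ⟨p', τ'⟩ h
    have hp : p = p' := by simpa using congr_arg (fun σ => σ 0) h
    subst hp
    have hτ : τ = τ' := Equiv.ext fun i => by simpa using congr_arg (fun σ => σ i.succ) h
    rw [hτ]
  · simp [Fintype.card_perm, Nat.factorial_succ]

theorem permLength_consPerm {t : ℕ} (p : Fin (t + 1)) (τ : Equiv.Perm (Fin t)) :
    permLength (consPerm p τ) = p + permLength τ := by
  have hp : ∑ k : Fin t, (if p.succAbove k < p then 1 else 0) = (p : ℕ) := by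
    have := Fin.sum_univ_succAbove (fun j => if j < p then 1 else 0) p
    rw [← Finset.card_filter, Finset.filter_gt_eq_Iio, Fin.card_Iio] at this
    simpa using this.symm
  simp only [permLength, Finset.card_filter, ← Finset.univ_product_univ, Finset.sum_product]
  rw [Fin.sum_univ_succ]
  simp only [Fin.sum_univ_succ, consPerm_zero, consPerm_succ, Fin.succ_lt_succ_iff, Fin.succ_pos,
    Fin.not_lt_zero, lt_irrefl, true_and, false_and, if_false, zero_add,
    (Fin.strictMono_succAbove p).lt_iff_lt]
  congr 1
  rw [← hp]
  exact Equiv.sum_comp τ fun k => if p.succAbove k < p then 1 else 0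

theorem wordMinor_ofFn {R T : Type*} [CommRing R] [Ring T] [Algebra R T] {ι κ : Type*}
    [LinearOrder κ] (u : R) (X : ι → κ → T) {t : ℕ} (w : Fin t → ι) (J : Fin t ↪o κ) :
    wordMinor u X (List.ofFn w) (Finset.univ.map J.toEmbedding) =
      ∑ σ : Equiv.Perm (Fin t),
        (-u) ^ permLength σ • (List.ofFn fun i => X (w i) (J (σ i))).prod := by
  induction t with
  | zero => simp [wordMinor, permLength]
  | succ t ih =>
    rw [List.ofFn_succ, wordMinor, Finset.sum_map,
      ← (consPerm_bijective t).sum_comp, Fintype.sum_prod_type]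
    refine Finset.sum_congr rfl fun p _ => ?_
    have hcard : ((Finset.univ.map J.toEmbedding).filter (· < J p)).card = p := by
      rw [Finset.filter_map, Finset.card_map]
      simp [Finset.filter_gt_eq_Iio]
    have herase : (Finset.univ.map J.toEmbedding).erase (J p) =
        Finset.univ.map ((Fin.succAboveOrderEmb p).trans J).toEmbedding := by
      ext x
      simp only [Finset.mem_erase, Finset.mem_map, Finset.mem_univ, true_and]
      constructor
      · rintro ⟨hx, q, rfl⟩
        obtain ⟨k, rfl⟩ := Fin.exists_succAbove_eq (x := q) (y := p) (by rintro rfl; simp at hx)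
        exact ⟨k, rfl⟩
      · rintro ⟨k, rfl⟩
        exact ⟨fun h => Fin.succAbove_ne p k (J.injective h), _, rfl⟩
    have := ih (fun i => w i.succ) ((Fin.succAboveOrderEmb p).trans J)
    simp only [RelEmbedding.coe_toEmbedding] at *
    rw [hcard, herase, this, Finset.mul_sum, Finset.smul_sum]
    refine Finset.sum_congr rfl fun τ _ => ?_
    rw [List.ofFn_succ, List.prod_cons, permLength_consPerm, mul_smul_comm, smul_smul, ← pow_add]
    simp

end Permutations

section Spanning

variable {R T : Type*} [CommRing R] [Ring T] [Algebra R T] {m n : ℕ}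

/-- The maximal quantum minor of an `m × n` matrix with column set the range of `I`. -/
def maxMinor (u : R) (X : Fin m → Fin n → T) (I : Fin m ↪o Fin n) : T :=
  wordMinor u X (List.finRange m) (Finset.univ.map I.toEmbedding)

/-- The multiset of columns occurring in a pair of column sets. -/
def pairContent (I J : Fin m ↪o Fin n) : Multiset (Fin n) :=
  (Finset.univ.map I.toEmbedding).val + (Finset.univ.map J.toEmbedding).val

variable {u : Rˣ} {X : Fin m → Fin n → T}

theorem exists_wordMinor_eq_smul_maxMinor (hX : IsQuantumMatrix_s11 u X) {c : List (Fin n)}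
    {I : Fin m ↪o Fin n} (hc : (c : Multiset (Fin n)) = (Finset.univ.map I.toEmbedding).val) :
    ∃ v : Rˣ, wordMinor (u : R) (fun j i => X i j) c Finset.univ =
      (v : R) • maxMinor (u : R) X I := by
  have hp : c.Perm (Finset.univ.map I.toEmbedding).sort := by
    rw [← Multiset.coe_eq_coe, Finset.sort_eq, hc]
  obtain ⟨v, hv⟩ := wordMinor_perm hX.transpose hp
  refine ⟨v, ?_⟩
  rw [hv, ← wordMinor_sort_transpose hX, Fin.sort_univ, maxMinor]

theorem wordMinor_eq_zero_or_exists_maxMinor (hX : IsQuantumMatrix_s11 u X) (c : List (Fin n)) :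
    wordMinor (u : R) (fun j i => X i j) c Finset.univ = 0 ∨
      ∃ (I : Fin m ↪o Fin n) (v : Rˣ), (c : Multiset (Fin n)) =
        (Finset.univ.map I.toEmbedding).val ∧
        wordMinor (u : R) (fun j i => X i j) c Finset.univ = (v : R) • maxMinor (u : R) X I := by
  by_cases hn : c.Nodup
  swap
  · exact .inl (wordMinor_eq_zero_of_not_nodup hX.transpose hn _)
  by_cases hl : c.length = m
  swap
  · exact .inl (wordMinor_eq_zero_of_card_ne _ _ _ _ (by simpa using Ne.symm hl))
  have hcard : c.toFinset.card = m := by rw [List.toFinset_card_of_nodup hn, hl]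
  have hc : (c : Multiset (Fin n)) =
      (Finset.univ.map (c.toFinset.orderEmbOfFin hcard).toEmbedding).val := by
    rw [Finset.map_orderEmbOfFin_univ, List.toFinset_val, hn.dedup]
  obtain ⟨v, hv⟩ := exists_wordMinor_eq_smul_maxMinor hX hc
  exact .inr ⟨_, v, hc, hv⟩

theorem card_filter_lt_map (I : Fin m ↪o Fin n) (s : Fin m) :
    ((Finset.univ.map I.toEmbedding).filter (· < I s)).card = s := by
  rw [Finset.filter_map, Finset.card_map]
  simp [Finset.filter_gt_eq_Iio]

theorem card_filter_le_map (I : Fin m ↪o Fin n) (s : Fin m) :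
    ((Finset.univ.map I.toEmbedding).filter (· ≤ I s)).card = s + 1 := by
  rw [Finset.filter_map, Finset.card_map]
  simp [Finset.filter_ge_eq_Iic]

theorem Finset.sum_val_lt_of_exchange {A B C : Finset (Fin n)} (hA : A ⊆ B ∪ C)
    (hcard : A.card = C.card) (hne : A ≠ C) (hlt : ∀ b ∈ B, ∀ c ∈ C, b < c) :
    ∑ a ∈ A, (a : ℕ) < ∑ c ∈ C, (c : ℕ) := by
  have hsd : (A \ C).card = (C \ A).card := Finset.card_sdiff_comm hcard
  have hpos : (C \ A).Nonempty := by
    rw [Finset.sdiff_nonempty]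
    exact fun h => hne (Finset.eq_of_subset_of_card_le h hcard.le).symm
  obtain ⟨c, hc, hmin⟩ := Finset.exists_min_image (C \ A) (fun c => (c : ℕ)) hpos
  rw [← Finset.sum_inter_add_sum_sdiff A C, ← Finset.sum_inter_add_sum_sdiff C A,
    Finset.inter_comm C A]
  refine Nat.add_lt_add_left ?_ _
  calc ∑ a ∈ A \ C, (a : ℕ) < ∑ a ∈ A \ C, (c : ℕ) := by
        refine Finset.sum_lt_sum_of_nonempty (Finset.card_pos.1 (hsd ▸ hpos.card_pos)) ?_
        intro a ha
        rw [Finset.mem_sdiff] at ha hc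
        exact hlt a ((Finset.mem_union.1 (hA ha.1)).resolve_right ha.2) c hc.1
    _ = (C \ A).card • (c : ℕ) := by rw [Finset.sum_const, hsd]
    _ ≤ ∑ a ∈ C \ A, (a : ℕ) := Finset.card_nsmul_le_sum _ _ _ hmin

theorem sum_val_map (I : Fin m ↪o Fin n) :
    ∑ x ∈ Finset.univ.map I.toEmbedding, (x : ℕ) = ∑ i, (I i : ℕ) := by simp

/-- Products of two maximal minors are combinations of standard ones with the same content. -/
theorem maxMinor_mul_mem_span (hX : IsQuantumMatrix_s11 u X) (I J : Fin m ↪o Fin n) :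
    maxMinor (u : R) X I * maxMinor (u : R) X J ∈ Submodule.span R
      {x | ∃ L M : Fin m ↪o Fin n, L ≤ M ∧ pairContent L M = pairContent I J ∧
        x = maxMinor (u : R) X L * maxMinor (u : R) X M} := by
  induction hN : ∑ i, (I i : ℕ) using Nat.strong_induction_on generalizing I J with
  | _ N ih =>
  by_cases hIJ : I ≤ J
  · exact Submodule.subset_span ⟨I, J, hIJ, rfl, rfl⟩
  obtain ⟨s, hs⟩ : ∃ s, J s < I s := by
    by_contra! h
    exact hIJ h
  set SI := Finset.univ.map I.toEmbedding with hSI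
  set SJ := Finset.univ.map J.toEmbedding with hSJ
  set I₁ := SI.filter (· < I s) with hI₁
  set I₂ := SI.filter (¬ · < I s) with hI₂
  set J₁ := SJ.filter (· ≤ J s) with hJ₁
  set J₂ := SJ.filter (¬ · ≤ J s) with hJ₂
  have hIval : I₁.val + I₂.val = SI.val := by
    rw [hI₁, hI₂, Finset.filter_val, Finset.filter_val, Multiset.filter_add_not]
  have hJval : J₁.val + J₂.val = SJ.val := by
    rw [hJ₁, hJ₂, Finset.filter_val, Finset.filter_val, Multiset.filter_add_not]
  have hlt : ∀ b ∈ J₁, ∀ c ∈ I₂, b < c := by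
    intro b hb c hc
    exact ((Finset.mem_filter.1 hb).2.trans_lt hs).trans_le (not_lt.1 (Finset.mem_filter.1 hc).2)
  have hdisj : Disjoint J₁ I₂ :=
    Finset.disjoint_left.2 fun b hb hc => lt_irrefl _ (hlt b hb b hc)
  have hI₁card : I₁.card = s := card_filter_lt_map I s
  have hJ₁card : J₁.card = s + 1 := card_filter_le_map J s
  have hIcard : I₁.card + I₂.card = m := by
    have := congr_arg Multiset.card hIval
    simpa [hSI] using this
  have hKval : (J₁ ∪ I₂).val = J₁.val + I₂.val := by
    rw [← Finset.disjUnion_eq_union _ _ hdisj, Finset.disjUnion_val]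
  have hK : Fintype.card (Fin m) < (J₁ ∪ I₂).card := by
    rw [Finset.card_union_of_disjoint hdisj, Fintype.card_fin]
    omega
  have hgarnir := garnir_relation hX I₁.sort J₂.sort _ hK
  have hI₂mem : I₂ ∈ (J₁ ∪ I₂).powerset := Finset.mem_powerset.2 Finset.subset_union_right
  rw [← Finset.add_sum_erase _ _ hI₂mem, Finset.union_sdiff_cancel_right hdisj,
    add_eq_zero_iff_eq_neg] at hgarnir
  obtain ⟨v, hv⟩ := exists_wordMinor_eq_smul_maxMinor hX (I := I) (c := I₁.sort ++ I₂.sort)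
    (by rw [← Multiset.coe_add, Finset.sort_eq, Finset.sort_eq, hIval])
  obtain ⟨v', hv'⟩ := exists_wordMinor_eq_smul_maxMinor hX (I := J) (c := J₁.sort ++ J₂.sort)
    (by rw [← Multiset.coe_add, Finset.sort_eq, Finset.sort_eq, hJval])
  rw [hv, hv', smul_mul_smul_comm, smul_smul] at hgarnir
  have hunit : IsUnit ((-(u : R)) ^ inversionsBetween I₂ J₁ * ((v : R) * v')) :=
    (u.isUnit.neg.pow _).mul (v.isUnit.mul v'.isUnit)
  rw [← Submodule.smul_mem_iff_of_isUnit _ hunit, hgarnir]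
  refine Submodule.neg_mem _ (Submodule.sum_mem _ fun A hA => Submodule.smul_mem _ _ ?_)
  rw [Finset.mem_erase, Finset.mem_powerset] at hA
  rcases wordMinor_eq_zero_or_exists_maxMinor hX (I₁.sort ++ A.sort) with h | ⟨L, w, hL, hw⟩
  · rw [h, zero_mul]
    exact Submodule.zero_mem _
  rcases wordMinor_eq_zero_or_exists_maxMinor hX (((J₁ ∪ I₂) \ A).sort ++ J₂.sort)
    with h | ⟨M, w', hM, hw'⟩
  · rw [h, mul_zero]
    exact Submodule.zero_mem _
  rw [hw, hw', smul_mul_smul_comm]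
  refine Submodule.smul_mem _ _ ?_
  rw [← Multiset.coe_add, Finset.sort_eq, Finset.sort_eq] at hL hM
  have hcontent : pairContent L M = pairContent I J := by
    have hA' : A.val + ((J₁ ∪ I₂) \ A).val = (J₁ ∪ I₂).val := by
      rw [← Finset.disjUnion_val _ _ Finset.disjoint_sdiff, Finset.disjUnion_eq_union,
        Finset.union_sdiff_of_subset hA.2]
    calc pairContent L M = I₁.val + (A.val + ((J₁ ∪ I₂) \ A).val) + J₂.val := by
          rw [pairContent, ← hL, ← hM]; abel
      _ = pairContent I J := by
          rw [hA', hKval, pairContent, ← hSI, ← hSJ, ← hIval, ← hJval]; abel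
  have hcard : A.card = I₂.card := by
    have := congr_arg Multiset.card hL
    simp only [Multiset.card_add, Finset.card_val, Finset.card_map, Finset.card_univ,
      Fintype.card_fin] at this
    omega
  have hsum : ∑ i, (L i : ℕ) < N := by
    have hL' := congr_arg (fun t => (t.map fun x : Fin n => (x : ℕ)).sum) hL
    have hI' := congr_arg (fun t => (t.map fun x : Fin n => (x : ℕ)).sum) hIval
    simp only [Multiset.map_add, Multiset.sum_add] at hL' hI'
    have hlt := Finset.sum_val_lt_of_exchange hA.2 hcard hA.1 hlt
    have hL'' := sum_val_map L
    have hI'' := sum_val_map I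
    rw [← hSI] at hI''
    simp only [Finset.sum] at hlt hL'' hI'' hN ⊢
    omega
  have := ih _ hsum L M rfl
  rwa [hcontent] at this

end Spanning

open scoped TensorProduct

section Lift

variable {R T : Type*} [CommRing R] [Ring T] [Algebra R T] {m n : ℕ} {u : Rˣ}

theorem isQuantumMatrix_qX_s11 (R : Type*) [CommRing R] (u : Rˣ) (m n : ℕ) :
    IsQuantumMatrix_s11 u (qX R u : Fin m → Fin n → QuantumMat R u m n) where
  row i j l h := by
    have := RingQuot.mkAlgHom_rel R (qMatrixRel.row (u := u) i j l h)
    simpa [qX] using this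
  col i k j h := by
    have := RingQuot.mkAlgHom_rel R (qMatrixRel.col (u := u) i k j h)
    simpa [qX] using this
  antidiag i k j l h h' := by
    have := RingQuot.mkAlgHom_rel R (qMatrixRel.antidiag (u := u) i k j l h h')
    simpa [qX] using this
  diag i k j l h h' := by
    have := RingQuot.mkAlgHom_rel R (qMatrixRel.diag (u := u) i k j l h h')
    simpa [qX] using this

theorem IsQuantumMatrix_s11.exists_algHom {Y : Fin m → Fin n → T} (hY : IsQuantumMatrix_s11 u Y) :
    ∃ φ : QuantumMat R u m n →ₐ[R] T, ∀ i j, φ (qX R u i j) = Y i j := by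
  refine ⟨RingQuot.liftAlgHom R ⟨FreeAlgebra.lift R fun p => Y p.1 p.2, ?_⟩, fun i j => ?_⟩
  · intro x y h
    cases h with
    | row i j l h => simpa using hY.row i j l h
    | col i k j h => simpa using hY.col i k j h
    | antidiag i k j l h h' => simpa using hY.antidiag i k j l h h'
    | diag i k j l h h' => simpa using hY.diag i k j l h h'
  · rw [qX, RingQuot.liftAlgHom_mkAlgHom_apply, FreeAlgebra.lift_ι_apply]

theorem map_wordMinor {T' : Type*} [Ring T'] [Algebra R T'] (φ : T →ₐ[R] T') {ι κ : Type*}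
    [LinearOrder κ] (v : R) (X : ι → κ → T) (w : List ι) (K : Finset κ) :
    φ (wordMinor v X w K) = wordMinor v (fun i j => φ (X i j)) w K := by
  induction w generalizing K with
  | nil => simp only [wordMinor]; split_ifs <;> simp
  | cons i w ih => simp [wordMinor, ih]

theorem map_univ_val_eq_ofFn (I : Fin m ↪o Fin n) :
    (Finset.univ.map I.toEmbedding).val = (List.ofFn I : Multiset (Fin n)) := by
  rw [Finset.map_val, Fin.univ_val_map]
  rfl

theorem maxMinor_eq_wordMinor_ofFn {X : Fin m → Fin n → T} (hX : IsQuantumMatrix_s11 u X)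
    (I : Fin m ↪o Fin n) :
    maxMinor (u : R) X I = wordMinor (u : R) (fun j i => X i j) (List.ofFn I) Finset.univ := by
  have hsort : (Finset.univ.map I.toEmbedding).sort = List.ofFn I := by
    refine List.Perm.eq_of_sortedLE (Finset.sortedLT_sort _).sortedLE
      (List.sortedLT_ofFn_iff.2 I.strictMono).sortedLE ?_
    rw [← Multiset.coe_eq_coe, Finset.sort_eq, map_univ_val_eq_ofFn]
  rw [maxMinor, ← Fin.sort_univ, wordMinor_sort_transpose hX, hsort]

theorem qMaximalMinor_eq_maxMinor (R : Type*) [CommRing R] (u : Rˣ) (I : Fin m ↪o Fin n) :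
    qMaximalMinor R u I = maxMinor (u : R) (qX R u) I := by
  rw [maxMinor, ← List.ofFn_id, wordMinor_ofFn, qMaximalMinor]
  rfl

end Lift

section ColumnShift

variable {R T B : Type*} [CommRing R] [Ring T] [Algebra R T] [Ring B] [Algebra R B]
  {ι κ : Type*} [LinearOrder κ]

/-- The matrix obtained from `X` by the coaction of the quantum group `SL₂` embedded in the
columns `c, c'`, evaluated at a lower triangular quantum matrix with diagonal entries `a, d` and
off-diagonal entry `b`. -/
def shiftColumns (X : ι → κ → T) (c c' : κ) (a b d : B) (i : ι) (j : κ) : T ⊗[R] B :=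
  if j = c then X i c ⊗ₜ a else if j = c' then X i c ⊗ₜ b + X i c' ⊗ₜ d else X i j ⊗ₜ 1

variable {X : ι → κ → T} {c c' : κ} {a b d : B} {u : Rˣ}

theorem shiftColumns_left (i : ι) :
    shiftColumns (R := R) X c c' a b d i c = X i c ⊗ₜ a := by simp [shiftColumns]

theorem shiftColumns_right (h : c ≠ c') (i : ι) :
    shiftColumns (R := R) X c c' a b d i c' = X i c ⊗ₜ b + X i c' ⊗ₜ d := by
  simp [shiftColumns, h.symm]

theorem shiftColumns_other {j : κ} (h : j ≠ c) (h' : j ≠ c') (i : ι) :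
    shiftColumns (R := R) X c c' a b d i j = X i j ⊗ₜ 1 := by simp [shiftColumns, h, h']

variable [LinearOrder ι]

theorem IsQuantumMatrix_s11.shiftColumns (hX : IsQuantumMatrix_s11 u X) (hcc : c ⋖ c')
    (had : a * d = 1) (hda : d * a = 1) (hab : a * b = (u : R) • (b * a))
    (hbd : b * d = (u : R) • (d * b)) :
    IsQuantumMatrix_s11 u (shiftColumns (R := R) X c c' a b d) := by
  have hu : (u : R) * ((u⁻¹ : Rˣ) : R) = 1 := u.mul_inv
  have hlt := hcc.lt
  have hne := hlt.ne
  have hlow : ∀ j, j < c' → j ≠ c → j < c := fun j h h' =>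
    lt_of_le_of_ne (le_of_not_gt fun h'' => hcc.2 h'' h) h'
  constructor
  · intro i j l hjl
    rcases eq_or_ne j c with rfl | hj
    · rcases eq_or_ne l c' with rfl | hl
      · simp only [shiftColumns_left, shiftColumns_right hne, add_mul, mul_add,
          Algebra.TensorProduct.tmul_mul_tmul, hX.row i _ _ hjl, hab, had, hda,
          TensorProduct.tmul_smul, ← TensorProduct.smul_tmul', smul_add]
      · simp only [shiftColumns_left, shiftColumns_other hjl.ne' hl,
          Algebra.TensorProduct.tmul_mul_tmul, hX.row i _ _ hjl, mul_one, one_mul,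
          ← TensorProduct.smul_tmul']
    rcases eq_or_ne j c' with rfl | hj'
    · simp only [shiftColumns_right hne, shiftColumns_other (hlt.trans hjl).ne' hjl.ne',
        add_mul, mul_add, Algebra.TensorProduct.tmul_mul_tmul, hX.row i _ _ hjl,
        hX.row i _ _ (hlt.trans hjl), mul_one, one_mul, ← TensorProduct.smul_tmul', smul_add]
    rcases eq_or_ne l c with rfl | hl
    · simp only [shiftColumns_left, shiftColumns_other hj hj',
        Algebra.TensorProduct.tmul_mul_tmul, hX.row i _ _ hjl, mul_one, one_mul,
        ← TensorProduct.smul_tmul']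
    rcases eq_or_ne l c' with rfl | hl'
    · simp only [shiftColumns_right hne, shiftColumns_other hj hj', add_mul, mul_add,
        Algebra.TensorProduct.tmul_mul_tmul, hX.row i _ _ hjl, hX.row i _ _ (hlow j hjl hj),
        mul_one, one_mul, ← TensorProduct.smul_tmul', smul_add]
    · simp only [shiftColumns_other hj hj', shiftColumns_other hl hl',
        Algebra.TensorProduct.tmul_mul_tmul, hX.row i _ _ hjl, ← TensorProduct.smul_tmul']
  · intro i k j hik
    rcases eq_or_ne j c with rfl | hj
    · simp only [shiftColumns_left, Algebra.TensorProduct.tmul_mul_tmul, hX.col i k _ hik,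
        TensorProduct.smul_tmul']
    rcases eq_or_ne j c' with rfl | hj'
    · simp only [shiftColumns_right hne, add_mul, mul_add,
        Algebra.TensorProduct.tmul_mul_tmul, hbd, hX.col i k _ hik,
        hX.diag i k c j hik hlt, hX.antidiag k i c j hik hlt, TensorProduct.tmul_smul,
        ← TensorProduct.smul_tmul', TensorProduct.add_tmul]
      match_scalars <;> first | ring1 | linear_combination (-1 : R) * hu
    · simp only [shiftColumns_other hj hj', Algebra.TensorProduct.tmul_mul_tmul,
        hX.col i k _ hik, TensorProduct.smul_tmul']
  · intro i k j l hki hjl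
    rcases eq_or_ne j c with rfl | hj
    · rcases eq_or_ne l c' with rfl | hl
      · simp only [shiftColumns_left, shiftColumns_right hne, add_mul, mul_add,
          Algebra.TensorProduct.tmul_mul_tmul, hX.antidiag i k _ _ hki hjl, hab, had, hda,
          hX.col k i _ hki, TensorProduct.tmul_smul, ← TensorProduct.smul_tmul']
      · simp only [shiftColumns_left, shiftColumns_other hjl.ne' hl,
          Algebra.TensorProduct.tmul_mul_tmul, hX.antidiag i k _ _ hki hjl, mul_one, one_mul]
    rcases eq_or_ne j c' with rfl | hj'
    · simp only [shiftColumns_right hne, shiftColumns_other (hlt.trans hjl).ne' hjl.ne',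
        add_mul, mul_add, Algebra.TensorProduct.tmul_mul_tmul, hX.antidiag i k _ _ hki hjl,
        hX.antidiag i k _ _ hki (hlt.trans hjl), mul_one, one_mul]
    rcases eq_or_ne l c with rfl | hl
    · simp only [shiftColumns_left, shiftColumns_other hj hj',
        Algebra.TensorProduct.tmul_mul_tmul, hX.antidiag i k _ _ hki hjl, mul_one, one_mul]
    rcases eq_or_ne l c' with rfl | hl'
    · simp only [shiftColumns_right hne, shiftColumns_other hj hj', add_mul, mul_add,
        Algebra.TensorProduct.tmul_mul_tmul, hX.antidiag i k _ _ hki hjl,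
        hX.antidiag i k _ _ hki (hlow j hjl hj), mul_one, one_mul]
    · simp only [shiftColumns_other hj hj', shiftColumns_other hl hl',
        Algebra.TensorProduct.tmul_mul_tmul, hX.antidiag i k _ _ hki hjl]
  · intro i k j l hik hjl
    rcases eq_or_ne j c with rfl | hj
    · rcases eq_or_ne l c' with rfl | hl
      · simp only [shiftColumns_left, shiftColumns_right hne, add_mul, mul_add,
          Algebra.TensorProduct.tmul_mul_tmul, hX.diag i k _ _ hik hjl, hab, had, hda,
          hX.col i k _ hik, TensorProduct.tmul_smul, ← TensorProduct.smul_tmul',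
          TensorProduct.add_tmul]
        match_scalars <;> first | ring1 | linear_combination hu
      · simp only [shiftColumns_left, shiftColumns_other hjl.ne' hl,
          Algebra.TensorProduct.tmul_mul_tmul, hX.diag i k _ _ hik hjl, mul_one, one_mul,
          TensorProduct.add_tmul, ← TensorProduct.smul_tmul']
    rcases eq_or_ne j c' with rfl | hj'
    · simp only [shiftColumns_right hne, shiftColumns_other (hlt.trans hjl).ne' hjl.ne',
        add_mul, mul_add, Algebra.TensorProduct.tmul_mul_tmul, hX.diag i k _ _ hik hjl,
        hX.diag i k _ _ hik (hlt.trans hjl), mul_one, one_mul,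
        TensorProduct.add_tmul, ← TensorProduct.smul_tmul']
      module
    rcases eq_or_ne l c with rfl | hl
    · simp only [shiftColumns_left, shiftColumns_other hj hj',
        Algebra.TensorProduct.tmul_mul_tmul, hX.diag i k _ _ hik hjl, mul_one, one_mul,
        TensorProduct.add_tmul, ← TensorProduct.smul_tmul']
    rcases eq_or_ne l c' with rfl | hl'
    · simp only [shiftColumns_right hne, shiftColumns_other hj hj', add_mul, mul_add,
        Algebra.TensorProduct.tmul_mul_tmul, hX.diag i k _ _ hik hjl,
        hX.diag i k _ _ hik (hlow j hjl hj), mul_one, one_mul,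
        TensorProduct.add_tmul, ← TensorProduct.smul_tmul']
      module
    · simp only [shiftColumns_other hj hj', shiftColumns_other hl hl',
        Algebra.TensorProduct.tmul_mul_tmul, hX.diag i k _ _ hik hjl,
        TensorProduct.add_tmul, ← TensorProduct.smul_tmul']

end ColumnShift

section ShiftedMinors

variable {R T B : Type*} [CommRing R] [Ring T] [Algebra R T] [Ring B] [Algebra R B]
  {ι κ : Type*} [LinearOrder ι] [LinearOrder κ]
  {X : ι → κ → T} {c c' : κ} {a b d : B}

theorem wordMinor_shiftColumns_append (v : R) {s w p q : List κ} {x y : B} (hs : c ∉ s)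
    (hs' : c' ∉ s) (h : ∀ S, wordMinor v (fun j i => shiftColumns (R := R) X c c' a b d i j) w S =
      wordMinor v (fun j i => X i j) p S ⊗ₜ x + wordMinor v (fun j i => X i j) q S ⊗ₜ y)
    (S : Finset ι) :
    wordMinor v (fun j i => shiftColumns (R := R) X c c' a b d i j) (s ++ w) S =
      wordMinor v (fun j i => X i j) (s ++ p) S ⊗ₜ x +
        wordMinor v (fun j i => X i j) (s ++ q) S ⊗ₜ y := by
  induction s generalizing S with
  | nil => exact h S
  | cons j s ih =>
    simp only [List.mem_cons, not_or] at hs hs'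
    simp only [List.cons_append, wordMinor, ih hs.2 hs'.2,
      shiftColumns_other (Ne.symm hs.1) (Ne.symm hs'.1), mul_add,
      Algebra.TensorProduct.tmul_mul_tmul, one_mul, TensorProduct.sum_tmul, smul_add,
      Finset.sum_add_distrib, TensorProduct.smul_tmul']

theorem wordMinor_shiftColumns_cons_left (v : R) {w p q : List κ} {x y : B}
    (h : ∀ S, wordMinor v (fun j i => shiftColumns (R := R) X c c' a b d i j) w S =
      wordMinor v (fun j i => X i j) p S ⊗ₜ x + wordMinor v (fun j i => X i j) q S ⊗ₜ y)
    (S : Finset ι) :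
    wordMinor v (fun j i => shiftColumns (R := R) X c c' a b d i j) (c :: w) S =
      wordMinor v (fun j i => X i j) (c :: p) S ⊗ₜ (a * x) +
        wordMinor v (fun j i => X i j) (c :: q) S ⊗ₜ (a * y) := by
  simp only [wordMinor, h, shiftColumns_left, mul_add, Algebra.TensorProduct.tmul_mul_tmul,
    TensorProduct.sum_tmul, smul_add, Finset.sum_add_distrib, TensorProduct.smul_tmul']

theorem wordMinor_shiftColumns_cons_right (v : R) {w : List κ} (hcc : c ≠ c')
    (h : ∀ S, wordMinor v (fun j i => shiftColumns (R := R) X c c' a b d i j) w S =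
      wordMinor v (fun j i => X i j) w S ⊗ₜ 1)
    (S : Finset ι) :
    wordMinor v (fun j i => shiftColumns (R := R) X c c' a b d i j) (c' :: w) S =
      wordMinor v (fun j i => X i j) (c' :: w) S ⊗ₜ d +
        wordMinor v (fun j i => X i j) (c :: w) S ⊗ₜ b := by
  simp only [wordMinor, h, shiftColumns_right hcc, add_mul,
    Algebra.TensorProduct.tmul_mul_tmul, mul_one,
    TensorProduct.sum_tmul, smul_add, Finset.sum_add_distrib, TensorProduct.smul_tmul']
  rw [add_comm]

theorem wordMinor_shiftColumns_of_notMem (v : R) {w : List κ} (hw : c ∉ w) (hw' : c' ∉ w)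
    (S : Finset ι) :
    wordMinor v (fun j i => shiftColumns (R := R) X c c' a b d i j) w S =
      wordMinor v (fun j i => X i j) w S ⊗ₜ 1 := by
  have := wordMinor_shiftColumns_append (R := R) (X := X) (a := a) (b := b) (d := d) (w := [])
    (p := []) (q := []) (x := 1) (y := 0) v hw hw' (fun S => by
      simp only [wordMinor, TensorProduct.tmul_zero, add_zero]
      split_ifs <;> simp [Algebra.TensorProduct.one_def]) S
  simpa using this

/-- Minors containing `c'` but not `c` split into two terms. -/
theorem wordMinor_shiftColumns_lower (v : R) {s t : List κ} (hcc : c ≠ c')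
    (hs : c ∉ s) (hs' : c' ∉ s) (ht : c ∉ t) (ht' : c' ∉ t) (S : Finset ι) :
    wordMinor v (fun j i => shiftColumns (R := R) X c c' a b d i j) (s ++ c' :: t) S =
      wordMinor v (fun j i => X i j) (s ++ c' :: t) S ⊗ₜ d +
        wordMinor v (fun j i => X i j) (s ++ c :: t) S ⊗ₜ b :=
  wordMinor_shiftColumns_append v hs hs' (wordMinor_shiftColumns_cons_right v hcc
    (wordMinor_shiftColumns_of_notMem v ht ht')) S

theorem wordMinor_shiftColumns_left (v : R) {s t : List κ}
    (hs : c ∉ s) (hs' : c' ∉ s) (ht : c ∉ t) (ht' : c' ∉ t) (S : Finset ι) :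
    wordMinor v (fun j i => shiftColumns (R := R) X c c' a b d i j) (s ++ c :: t) S =
      wordMinor v (fun j i => X i j) (s ++ c :: t) S ⊗ₜ a := by
  have := wordMinor_shiftColumns_append (R := R) (X := X) (a := a) (b := b) (d := d) v hs hs'
    (wordMinor_shiftColumns_cons_left (p := t) (q := t) (x := 1) (y := 0) v fun S => by
      rw [wordMinor_shiftColumns_of_notMem v ht ht', TensorProduct.tmul_zero, add_zero]) S
  simpa using this

theorem wordMinor_shiftColumns_both {u : Rˣ} (hX : IsQuantumMatrix_s11 u X) {s t r : List κ}
    (hcc : c ≠ c') (had : a * d = 1) (hs : c ∉ s) (hs' : c' ∉ s) (ht : c ∉ t) (ht' : c' ∉ t)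
    (hr : c ∉ r) (hr' : c' ∉ r) (S : Finset ι) :
    wordMinor (u : R) (fun j i => shiftColumns (R := R) X c c' a b d i j)
        (s ++ c :: (t ++ c' :: r)) S =
      wordMinor (u : R) (fun j i => X i j) (s ++ c :: (t ++ c' :: r)) S ⊗ₜ 1 := by
  rw [wordMinor_shiftColumns_append _ hs hs' (wordMinor_shiftColumns_cons_left _
    (wordMinor_shiftColumns_lower _ hcc ht ht' hr hr')), had,
    wordMinor_eq_zero_of_not_nodup hX.transpose (w := s ++ c :: (t ++ c :: r))
      (by simp [List.nodup_append]), TensorProduct.zero_tmul, add_zero]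

end ShiftedMinors

section Lowering

variable {m n : ℕ} {c c' : Fin n}

/-- The column set `I` contains `c'` but not `c`. -/
def IsLowerable (c c' : Fin n) (I : Fin m ↪o Fin n) : Prop :=
  c' ∈ Set.range I ∧ c ∉ Set.range I

open Classical in
/-- Replace the column `c'` by its predecessor `c` in the column set `I`, if possible. -/
noncomputable def lower (hcc : c ⋖ c') (I : Fin m ↪o Fin n) : Fin m ↪o Fin n :=
  if h : IsLowerable c c' I then
    OrderEmbedding.ofStrictMono (fun i => if I i = c' then c else I i) (by
      intro i j hij
      have hlt := I.strictMono hij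
      have hc : ∀ k, I k ≠ c := fun k hk => h.2 ⟨k, hk⟩
      dsimp only
      split_ifs with hi hj hj
      · exact absurd (hi.trans hj.symm) hlt.ne
      · exact hcc.lt.trans (hi ▸ hlt)
      · exact lt_of_le_of_ne (le_of_not_gt fun h' => hcc.2 h' (hj ▸ hlt)) (hc i)
      · exact hlt)
  else I

theorem lower_of_not (hcc : c ⋖ c') {I : Fin m ↪o Fin n} (h : ¬ IsLowerable c c' I) :
    lower hcc I = I := dif_neg h

theorem lower_apply (hcc : c ⋖ c') {I : Fin m ↪o Fin n} (h : IsLowerable c c' I) (i : Fin m) :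
    lower hcc I i = if I i = c' then c else I i := by
  rw [lower, dif_pos h]
  rfl

theorem lower_le (hcc : c ⋖ c') (I : Fin m ↪o Fin n) : lower hcc I ≤ I := by
  intro i
  by_cases h : IsLowerable c c' I
  · dsimp only
    rw [lower_apply hcc h]
    split_ifs with hi
    · rw [hi]
      exact hcc.le
    · exact le_rfl
  · rw [lower_of_not hcc h]

theorem lower_lt (hcc : c ⋖ c') {I : Fin m ↪o Fin n} (h : IsLowerable c c' I) :
    ∑ i, (lower hcc I i : ℕ) < ∑ i, (I i : ℕ) := by
  obtain ⟨i, hi⟩ := h.1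
  refine Finset.sum_lt_sum (fun i _ => lower_le hcc I i) ⟨i, Finset.mem_univ _, ?_⟩
  rw [lower_apply hcc h, if_pos hi, hi]
  exact hcc.lt

theorem lower_le_lower (hcc : c ⋖ c') {L M : Fin m ↪o Fin n} (h : L ≤ M)
    (hM : IsLowerable c c' M) : lower hcc L ≤ lower hcc M := by
  intro i
  dsimp only
  rw [lower_apply hcc hM]
  split_ifs with hi
  · have hle : L i ≤ c' := hi ▸ h i
    rcases hle.lt_or_eq with hlt | heq
    · exact (lower_le hcc L i).trans (le_of_not_gt fun h' => hcc.2 h' hlt)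
    · have hL : IsLowerable c c' L := by
        refine ⟨⟨i, heq⟩, ?_⟩
        rintro ⟨j, hj⟩
        have hji : j < i := L.lt_iff_lt.1 (by rw [hj, heq]; exact hcc.lt)
        have h1 : c ≤ M j := hj ▸ h j
        have h2 : M j < c' := hi ▸ M.strictMono hji
        rcases h1.lt_or_eq with h3 | h3
        · exact hcc.2 h3 h2
        · exact hM.2 ⟨j, h3.symm⟩
      rw [lower_apply hcc hL, if_pos heq]
  · exact (lower_le hcc L i).trans (h i)

theorem le_of_lower_le_lower (hcc : c ⋖ c') {L I : Fin m ↪o Fin n}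
    (h : lower hcc L ≤ lower hcc I) (hLI : IsLowerable c c' L → IsLowerable c c' I) : L ≤ I := by
  by_cases hL : IsLowerable c c' L
  · intro i
    have hi := h i
    dsimp only at hi ⊢
    rw [lower_apply hcc hL] at hi
    split_ifs at hi with hLi
    · rw [hLi]
      have hle : c ≤ I i := hi.trans (lower_le hcc I i)
      refine le_of_not_gt fun hlt => ?_
      rcases hle.lt_or_eq with h3 | h3
      · exact hcc.2 h3 hlt
      · exact (hLI hL).2 ⟨i, h3.symm⟩
    · exact hi.trans (lower_le hcc I i)
  · rw [lower_of_not hcc hL] at h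
    exact h.trans (lower_le hcc I)

theorem ofFn_lower (hcc : c ⋖ c') {I : Fin m ↪o Fin n} (h : IsLowerable c c' I) :
    List.ofFn (lower hcc I) = (List.ofFn I).map fun j => if j = c' then c else j := by
  rw [List.map_ofFn]
  congr 1
  funext i
  exact lower_apply hcc h i

theorem exists_ofFn_eq_append (hcc : c ⋖ c') {I : Fin m ↪o Fin n} (h : IsLowerable c c' I) :
    ∃ s t, c ∉ s ∧ c' ∉ s ∧ c ∉ t ∧ c' ∉ t ∧ List.ofFn I = s ++ c' :: t ∧
      List.ofFn (lower hcc I) = s ++ c :: t := by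
  obtain ⟨s, t, hst⟩ := List.append_of_mem (List.mem_ofFn.2 h.1)
  have hc : c ∉ List.ofFn I := fun hc => h.2 (List.mem_ofFn.1 hc)
  have hnd : (List.ofFn I).Nodup := List.nodup_ofFn.2 I.injective
  rw [hst] at hc hnd
  simp only [List.mem_append, List.mem_cons, not_or, List.nodup_append, List.nodup_cons] at hc hnd
  have hs' : c' ∉ s := fun h => hnd.2.2 _ h _ (.inl rfl) rfl
  refine ⟨s, t, hc.1, hs', hc.2.2, hnd.2.1.1, hst, ?_⟩
  have key : ∀ r : List (Fin n), c' ∉ r → r.map (fun j => if j = c' then c else j) = r := by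
    intro r hr
    refine (List.map_congr_left fun j hj => ?_).trans (List.map_id r)
    rw [if_neg (ne_of_mem_of_not_mem hj hr), id]
  rw [ofFn_lower hcc h, hst, List.map_append, List.map_cons, if_pos rfl, key s hs',
    key t hnd.2.1.1]

end Lowering

section Content

variable {m n : ℕ} {c c' : Fin n}

open Classical in
theorem count_pairContent (I J : Fin m ↪o Fin n) (x : Fin n) :
    (pairContent I J).count x =
      (if x ∈ Set.range I then 1 else 0) + (if x ∈ Set.range J then 1 else 0) := by
  rw [pairContent, Multiset.count_add, Multiset.count_eq_of_nodup (Finset.nodup _),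
    Multiset.count_eq_of_nodup (Finset.nodup _)]
  simp [Set.mem_range]

theorem IsLowerable.of_pairContent_eq {I J L M : Fin m ↪o Fin n}
    (h : pairContent I J = pairContent L M) (hL : IsLowerable c c' L) (hM : IsLowerable c c' M) :
    IsLowerable c c' I ∧ IsLowerable c c' J := by
  classical
  have h1 := congr_arg (Multiset.count c) h
  have h2 := congr_arg (Multiset.count c') h
  rw [count_pairContent, count_pairContent, if_neg hL.2, if_neg hM.2] at h1
  rw [count_pairContent, count_pairContent, if_pos hL.1, if_pos hM.1] at h2
  unfold IsLowerable
  split_ifs at h1 h2 <;> first | omega | tauto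

theorem map_lower_val_add (hcc : c ⋖ c') {I : Fin m ↪o Fin n} (h : IsLowerable c c' I) :
    (Finset.univ.map (lower hcc I).toEmbedding).val + {c'} =
      (Finset.univ.map I.toEmbedding).val + {c} := by
  obtain ⟨s, t, -, -, -, -, h1, h2⟩ := exists_ofFn_eq_append hcc h
  simp only [map_univ_val_eq_ofFn, h1, h2, ← Multiset.coe_add, ← Multiset.cons_coe,
    ← Multiset.singleton_add]
  abel

theorem pairContent_comm (I J : Fin m ↪o Fin n) : pairContent I J = pairContent J I :=
  add_comm _ _

theorem pairContent_lower_lower (hcc : c ⋖ c') {I J : Fin m ↪o Fin n}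
    (hI : IsLowerable c c' I) (hJ : IsLowerable c c' J) :
    pairContent (lower hcc I) (lower hcc J) + ({c'} + {c'}) = pairContent I J + ({c} + {c}) := by
  rw [pairContent, add_add_add_comm, map_lower_val_add hcc hI, map_lower_val_add hcc hJ,
    add_add_add_comm, pairContent]

theorem pairContent_lower_right (hcc : c ⋖ c') {I J : Fin m ↪o Fin n}
    (hI : ¬ IsLowerable c c' I) (hJ : IsLowerable c c' J) :
    pairContent (lower hcc I) (lower hcc J) + {c'} = pairContent I J + {c} := by
  rw [pairContent, add_assoc, lower_of_not hcc hI, map_lower_val_add hcc hJ, ← add_assoc,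
    pairContent]

theorem pairContent_lower_left (hcc : c ⋖ c') {I J : Fin m ↪o Fin n}
    (hI : IsLowerable c c' I) (hJ : ¬ IsLowerable c c' J) :
    pairContent (lower hcc I) (lower hcc J) + {c'} = pairContent I J + {c} := by
  rw [pairContent_comm, pairContent_lower_right hcc hJ hI, pairContent_comm]

theorem val_le_apply (L : Fin m ↪o Fin n) (i : Fin m) : (i : ℕ) ≤ L i := by
  obtain ⟨k, hk⟩ := i
  induction k with
  | zero => exact Nat.zero_le _
  | succ k ih =>
    have h1 := ih (by omega)
    have h2 : L ⟨k, by omega⟩ < L ⟨k + 1, hk⟩ := L.strictMono (Fin.mk_lt_mk.2 (by omega))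
    rw [Fin.lt_def] at h2
    dsimp only at h1 ⊢
    omega

/-- A column set other than `{1, …, m}` can be lowered. -/
theorem exists_isLowerable {M : Fin m ↪o Fin n} (h : ∃ i, (M i : ℕ) ≠ i) :
    ∃ c c' : Fin n, c ⋖ c' ∧ IsLowerable c c' M := by
  classical
  have hex : ∃ k, ∃ hk : k < m, (M ⟨k, hk⟩ : ℕ) ≠ k := by
    obtain ⟨i, hi⟩ := h
    exact ⟨i, i.2, hi⟩
  obtain ⟨hk, hne⟩ := Nat.find_spec hex
  set k := Nat.find hex with hkdef
  have hmin : ∀ j, j < k → ∀ hj : j < m, (M ⟨j, hj⟩ : ℕ) = j := fun j hjk hj =>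
    not_not.1 fun h' => Nat.find_min hex hjk ⟨hj, h'⟩
  have hgt : k < (M ⟨k, hk⟩ : ℕ) := lt_of_le_of_ne (val_le_apply M ⟨k, hk⟩) hne.symm
  have hbound := (M ⟨k, hk⟩).2
  refine ⟨⟨M ⟨k, hk⟩ - 1, by omega⟩, M ⟨k, hk⟩, ?_, ⟨_, rfl⟩, ?_⟩
  · refine ⟨Fin.lt_def.2 (by dsimp only; omega), fun x h1 h2 => ?_⟩
    rw [Fin.lt_def] at h1 h2
    dsimp only at h1
    omega
  · rintro ⟨j, hj⟩
    have hj' : (M j : ℕ) = M ⟨k, hk⟩ - 1 := by rw [hj]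
    have hlt : j < ⟨k, hk⟩ := M.lt_iff_lt.1 (Fin.lt_def.2 (by omega))
    have := hmin j hlt j.2
    rw [Fin.lt_def] at hlt
    dsimp only at hlt
    simp only [Fin.eta] at this
    omega

end Content

section Functional

variable {m n : ℕ} {c c' : Fin n}

theorem exists_shift_algHom {R B : Type*} [CommRing R] [Ring B] [Algebra R B] (u : Rˣ)
    (hcc : c ⋖ c') {a b d : B} (had : a * d = 1) (hda : d * a = 1)
    (hab : a * b = (u : R) • (b * a)) (hbd : b * d = (u : R) • (d * b)) :
    ∃ θ : QuantumMat R u m n →ₐ[R] QuantumMat R u m n ⊗[R] B, ∀ I : Fin m ↪o Fin n,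
      (IsLowerable c c' I → θ (maxMinor (u : R) (qX R u) I) =
        maxMinor (u : R) (qX R u) I ⊗ₜ d + maxMinor (u : R) (qX R u) (lower hcc I) ⊗ₜ b) ∧
      (¬ IsLowerable c c' I → ∃ e, (e = 1 ∨ e = a) ∧
        θ (maxMinor (u : R) (qX R u) I) = maxMinor (u : R) (qX R u) I ⊗ₜ e) := by
  have hX := isQuantumMatrix_qX_s11 R u m n
  obtain ⟨θ, hθ⟩ := (hX.shiftColumns hcc had hda hab hbd).exists_algHom
  refine ⟨θ, fun I => ?_⟩
  have hθI : θ (maxMinor (u : R) (qX R u) I) = wordMinor (u : R)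
      (fun j i => shiftColumns (R := R) (qX R u) c c' a b d i j) (List.ofFn I) Finset.univ := by
    rw [maxMinor_eq_wordMinor_ofFn hX, map_wordMinor]
    simp only [hθ]
  rw [hθI]
  have hne := hcc.lt.ne
  constructor
  · intro h
    obtain ⟨s, t, hs, hs', ht, ht', h1, h2⟩ := exists_ofFn_eq_append hcc h
    rw [maxMinor_eq_wordMinor_ofFn hX, maxMinor_eq_wordMinor_ofFn hX, h1, h2,
      wordMinor_shiftColumns_lower _ hne hs hs' ht ht']
  · intro h
    rw [maxMinor_eq_wordMinor_ofFn hX]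
    by_cases hc : c ∈ List.ofFn I
    · obtain ⟨s, t, hst⟩ := List.append_of_mem hc
      have hsorted := (List.sortedLT_ofFn_iff.2 I.strictMono).pairwise
      rw [hst, List.pairwise_append, List.pairwise_cons] at hsorted
      obtain ⟨-, ⟨htc, htp⟩, hsc⟩ := hsorted
      have hs : c ∉ s := fun h => lt_irrefl c (hsc c h c (by simp))
      have hs' : c' ∉ s := fun h => hcc.lt.not_gt (hsc c' h c (by simp))
      have ht : c ∉ t := fun h => lt_irrefl c (htc c h)
      rw [hst]
      by_cases hc' : c' ∈ t
      · obtain ⟨p, q, rfl⟩ := List.append_of_mem hc'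
        simp only [List.mem_append, List.mem_cons, not_or] at ht
        rw [List.pairwise_append, List.pairwise_cons] at htp
        exact ⟨1, .inl rfl, wordMinor_shiftColumns_both hX hne had hs hs' ht.1
          (fun h => lt_irrefl c' (htp.2.2 c' h c' (by simp))) ht.2.2
          (fun h => lt_irrefl c' (htp.2.1.1 c' h)) _⟩
      · exact ⟨a, .inr rfl, wordMinor_shiftColumns_left _ hs hs' ht hc' _⟩
    · have hc' : c' ∉ List.ofFn I := fun hc' =>
        h ⟨List.mem_ofFn.1 hc', fun h' => hc (List.mem_ofFn.2 h')⟩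
      exact ⟨1, .inl rfl, wordMinor_shiftColumns_of_notMem _ hc hc' _⟩

/-- The diagonal matrix with entries `1, t, t ^ 2`. -/
def powDiagonal {F : Type*} [Field F] (t : F) : Matrix (Fin 3) (Fin 3) F :=
  Matrix.diagonal fun i => t ^ (i : ℕ)

/-- The nilpotent matrix with ones on the subdiagonal. -/
def subdiagonal (F : Type*) [Field F] : Matrix (Fin 3) (Fin 3) F :=
  Matrix.of fun i j => if (i : ℕ) = j + 1 then 1 else 0

theorem powDiagonal_one {F : Type*} [Field F] : powDiagonal (1 : F) = 1 := by
  simp [powDiagonal]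

theorem powDiagonal_mul {F : Type*} [Field F] (s t : F) :
    powDiagonal s * powDiagonal t = powDiagonal (s * t) := by
  simp [powDiagonal, mul_pow]

theorem powDiagonal_mul_subdiagonal {F : Type*} [Field F] (t : F) :
    powDiagonal t * subdiagonal F = t • (subdiagonal F * powDiagonal t) := by
  ext i j
  simp only [powDiagonal, subdiagonal, Matrix.diagonal_mul, Matrix.smul_apply,
    Matrix.mul_diagonal, Matrix.of_apply, smul_eq_mul]
  split_ifs with h
  · rw [h, pow_succ]
    ring
  · simp

variable {F : Type*} [Field F] {u : Fˣ}

theorem exists_functional_bottom :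
    ∃ f : QuantumMat F u m n →ₗ[F] F, ∀ I J : Fin m ↪o Fin n, (∀ i, (I i : ℕ) = i) →
      (∀ i, (J i : ℕ) = i) →
      f (maxMinor (u : F) (qX F u) I * maxMinor (u : F) (qX F u) J) = 1 := by
  have hY : IsQuantumMatrix_s11 u
      (fun (i : Fin m) (j : Fin n) => if (i : ℕ) = j then (1 : F) else 0) := by
    constructor
    · intro i j l hjl
      rw [Fin.lt_def] at hjl
      split_ifs <;> first | omega | simp
    · intro i k j hik
      rw [Fin.lt_def] at hik
      split_ifs <;> first | omega | simp
    · intro i k j l _ _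
      exact mul_comm _ _
    · intro i k j l hik hjl
      rw [Fin.lt_def] at hik hjl
      split_ifs <;> first | omega | simp
  obtain ⟨φ, hφ⟩ := hY.exists_algHom
  have hone : ∀ I : Fin m ↪o Fin n, (∀ i, (I i : ℕ) = i) →
      φ (maxMinor (u : F) (qX F u) I) = 1 := by
    intro I hI
    rw [maxMinor, map_wordMinor, ← List.ofFn_id, wordMinor_ofFn,
      Finset.sum_eq_single (1 : Equiv.Perm (Fin m))]
    · have : permLength (1 : Equiv.Perm (Fin m)) = 0 := by
        rw [permLength, Finset.card_eq_zero, Finset.filter_eq_empty_iff]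
        exact fun p _ h => h.1.not_gt h.2
      simp [this, hφ, hI]
    · intro σ _ hσ
      obtain ⟨i, hi⟩ : ∃ i, σ i ≠ i := by
        by_contra! h
        exact hσ (Equiv.ext h)
      rw [List.prod_ofFn, Finset.prod_eq_zero (Finset.mem_univ i), smul_zero]
      rw [hφ, if_neg]
      rw [hI, id, ← Fin.ext_iff]
      exact hi.symm
    · simp
  refine ⟨φ.toLinearMap, fun I J hI hJ => ?_⟩
  rw [AlgHom.toLinearMap_apply, map_mul, hone I hI, hone J hJ, mul_one]

/-- The effect on products of maximal minors of lowering a column, seen in the `(r, 0)` entry. -/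
theorem exists_lowered_functional (hcc : c ⋖ c') (f' : QuantumMat F u m n →ₗ[F] F) (r : Fin 3) :
    ∃ f : QuantumMat F u m n →ₗ[F] F, ∀ I J : Fin m ↪o Fin n,
      (IsLowerable c c' I → IsLowerable c c' J → r = 2 →
        f (maxMinor (u : F) (qX F u) I * maxMinor (u : F) (qX F u) J) =
          f' (maxMinor (u : F) (qX F u) (lower hcc I) *
            maxMinor (u : F) (qX F u) (lower hcc J))) ∧
      ((IsLowerable c c' I ↔ ¬ IsLowerable c c' J) → r = 1 → ∃ t : F, t ≠ 0 ∧
        f (maxMinor (u : F) (qX F u) I * maxMinor (u : F) (qX F u) J) =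
          t * f' (maxMinor (u : F) (qX F u) (lower hcc I) *
            maxMinor (u : F) (qX F u) (lower hcc J))) ∧
      (¬ IsLowerable c c' I → ¬ IsLowerable c c' J → r = 1 →
        f (maxMinor (u : F) (qX F u) I * maxMinor (u : F) (qX F u) J) = 0) := by
  have hu : (u : F) ≠ 0 := u.ne_zero
  obtain ⟨θ, hθ⟩ := exists_shift_algHom (m := m) u hcc (a := powDiagonal (u : F))
    (b := subdiagonal F) (d := powDiagonal (u : F)⁻¹)
    (by rw [powDiagonal_mul, mul_inv_cancel₀ hu, powDiagonal_one])
    (by rw [powDiagonal_mul, inv_mul_cancel₀ hu, powDiagonal_one])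
    (powDiagonal_mul_subdiagonal _)
    (by rw [powDiagonal_mul_subdiagonal, smul_inv_smul₀ hu])
  have hlow : ∀ I : Fin m ↪o Fin n, ¬ IsLowerable c c' I → ∃ t : F, t ≠ 0 ∧
      θ (maxMinor (u : F) (qX F u) I) = maxMinor (u : F) (qX F u) I ⊗ₜ powDiagonal t := by
    intro I hI
    obtain ⟨e, rfl | rfl, he⟩ := (hθ I).2 hI
    · exact ⟨1, one_ne_zero, by rw [he, powDiagonal_one]⟩
    · exact ⟨u, hu, he⟩
  refine ⟨LinearMap.mul' F F ∘ₗ TensorProduct.map f' (Matrix.entryLinearMap F F r 0) ∘ₗ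
    θ.toLinearMap, fun I J => ⟨?_, ?_, ?_⟩⟩
  · rintro hI hJ rfl
    simp only [LinearMap.comp_apply, AlgHom.toLinearMap_apply, map_mul, (hθ I).1 hI,
      (hθ J).1 hJ, add_mul, mul_add, Algebra.TensorProduct.tmul_mul_tmul, map_add,
      TensorProduct.map_tmul, LinearMap.mul'_apply, Matrix.entryLinearMap_apply]
    simp [powDiagonal, subdiagonal, Matrix.mul_apply, Fin.sum_univ_three]
  · rintro hIJ rfl
    by_cases hI : IsLowerable c c' I
    · have hJ := hIJ.1 hI
      obtain ⟨t, ht, htJ⟩ := hlow J hJ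
      refine ⟨1, one_ne_zero, ?_⟩
      simp only [LinearMap.comp_apply, AlgHom.toLinearMap_apply, map_mul, (hθ I).1 hI,
        htJ, add_mul, Algebra.TensorProduct.tmul_mul_tmul, map_add, lower_of_not hcc hJ,
        TensorProduct.map_tmul, LinearMap.mul'_apply, Matrix.entryLinearMap_apply]
      simp [powDiagonal, subdiagonal]
    · have hJ : IsLowerable c c' J := by tauto
      obtain ⟨t, ht, htI⟩ := hlow I hI
      refine ⟨t, ht, ?_⟩
      simp only [LinearMap.comp_apply, AlgHom.toLinearMap_apply, map_mul, (hθ J).1 hJ,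
        htI, mul_add, Algebra.TensorProduct.tmul_mul_tmul, map_add, lower_of_not hcc hI,
        TensorProduct.map_tmul, LinearMap.mul'_apply, Matrix.entryLinearMap_apply]
      simp [powDiagonal, subdiagonal, mul_comm]
  · rintro hI hJ rfl
    obtain ⟨s, -, hsI⟩ := hlow I hI
    obtain ⟨t, -, htJ⟩ := hlow J hJ
    simp only [LinearMap.comp_apply, AlgHom.toLinearMap_apply, map_mul, hsI,
      htJ, Algebra.TensorProduct.tmul_mul_tmul,
      TensorProduct.map_tmul, LinearMap.mul'_apply, Matrix.entryLinearMap_apply]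
    simp [powDiagonal]

/-- For every standard pair there is a functional detecting it among the pairs of the same content,
which vanishes unless the first column set is below both members. -/
theorem exists_functional_of_le {L M : Fin m ↪o Fin n} (hLM : L ≤ M) :
    ∃ f : QuantumMat F u m n →ₗ[F] F,
      f (maxMinor (u : F) (qX F u) L * maxMinor (u : F) (qX F u) M) ≠ 0 ∧
      ∀ I J : Fin m ↪o Fin n, pairContent I J = pairContent L M →
        f (maxMinor (u : F) (qX F u) I * maxMinor (u : F) (qX F u) J) ≠ 0 → L ≤ I ∧ L ≤ J := by
  induction hN : ∑ i, (M i : ℕ) using Nat.strong_induction_on generalizing L M with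
  | _ N ih =>
  by_cases hM : ∀ i, (M i : ℕ) = i
  · have hL : ∀ i, (L i : ℕ) = i := fun i =>
      le_antisymm ((Fin.le_def.1 (hLM i)).trans (hM i).le) (val_le_apply L i)
    obtain ⟨f, hf⟩ := exists_functional_bottom (F := F) (u := u) (m := m) (n := n)
    have hbot : ∀ I : Fin m ↪o Fin n, L ≤ I := fun I i =>
      Fin.le_def.2 ((hL i).le.trans (val_le_apply I i))
    exact ⟨f, by rw [hf L M hL hM]; exact one_ne_zero, fun I J _ _ => ⟨hbot I, hbot J⟩⟩
  push Not at hM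
  obtain ⟨c, c', hcc, hMlow⟩ := exists_isLowerable hM
  obtain ⟨f', hf', hsep⟩ := ih _ (hN ▸ lower_lt hcc hMlow) (lower_le_lower hcc hLM hMlow) rfl
  by_cases hLlow : IsLowerable c c' L
  · obtain ⟨f, hf⟩ := exists_lowered_functional hcc f' 2
    refine ⟨f, by rwa [(hf L M).1 hLlow hMlow rfl], fun I J hIJ hne => ?_⟩
    obtain ⟨hI, hJ⟩ := IsLowerable.of_pairContent_eq hIJ hLlow hMlow
    rw [(hf I J).1 hI hJ rfl] at hne
    have hcont : pairContent (lower hcc I) (lower hcc J) =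
        pairContent (lower hcc L) (lower hcc M) := by
      rw [← add_left_inj ({c'} + {c'}), pairContent_lower_lower hcc hI hJ,
        pairContent_lower_lower hcc hLlow hMlow, hIJ]
    obtain ⟨h1, h2⟩ := hsep _ _ hcont hne
    exact ⟨le_of_lower_le_lower hcc h1 fun _ => hI, le_of_lower_le_lower hcc h2 fun _ => hJ⟩
  · obtain ⟨f, hf⟩ := exists_lowered_functional hcc f' 1
    obtain ⟨t, ht, htLM⟩ := (hf L M).2.1 (by tauto) rfl
    refine ⟨f, by rw [htLM]; exact mul_ne_zero ht hf', fun I J hIJ hne => ?_⟩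
    have hnot : ¬ (IsLowerable c c' I ∧ IsLowerable c c' J) := fun h =>
      hLlow (IsLowerable.of_pairContent_eq hIJ.symm h.1 h.2).1
    have hone : IsLowerable c c' I ↔ ¬ IsLowerable c c' J := by
      by_contra h
      exact hne ((hf I J).2.2 (by tauto) (by tauto) rfl)
    obtain ⟨s, -, hs⟩ := (hf I J).2.1 hone rfl
    have hcont : pairContent (lower hcc I) (lower hcc J) =
        pairContent (lower hcc L) (lower hcc M) := by
      rw [← add_left_inj {c'}, pairContent_lower_right hcc hLlow hMlow, ← hIJ]
      by_cases hI : IsLowerable c c' I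
      · exact pairContent_lower_left hcc hI (hone.1 hI)
      · exact pairContent_lower_right hcc hI (by tauto)
    obtain ⟨h1, h2⟩ := hsep _ _ hcont (right_ne_zero_of_mul (hs ▸ hne))
    exact ⟨le_of_lower_le_lower hcc h1 fun h => absurd h hLlow,
      le_of_lower_le_lower hcc h2 fun h => absurd h hLlow⟩

end Functional

section Straightening

theorem wordMinor_algebraMap {A F T : Type*} [CommRing A] [CommRing F] [Algebra A F] [Ring T]
    [Algebra F T] [Algebra A T] [IsScalarTower A F T] {ι κ : Type*} [LinearOrder κ] (v : A)
    (X : ι → κ → T) (w : List ι) (K : Finset κ) :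
    wordMinor (algebraMap A F v) X w K = wordMinor v X w K := by
  induction w generalizing K with
  | nil => rfl
  | cons i w ih =>
    refine Finset.sum_congr rfl fun j _ => ?_
    rw [ih, ← map_neg, ← map_pow, algebraMap_smul]

theorem IsQuantumMatrix_s11.restrictScalars {A F T : Type*} [CommRing A] [CommRing F] [Algebra A F]
    [Ring T] [Algebra F T] [Algebra A T] [IsScalarTower A F T] {ι κ : Type*} [LinearOrder ι]
    [LinearOrder κ] {u : Aˣ} {X : ι → κ → T}
    (hX : IsQuantumMatrix_s11 (Units.map (algebraMap A F).toMonoidHom u) X) : IsQuantumMatrix_s11 u X where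
  row i j l h := (hX.row i j l h).trans (algebraMap_smul F (u : A) _)
  col i k j h := (hX.col i k j h).trans (algebraMap_smul F (u : A) _)
  antidiag := hX.antidiag
  diag i k j l h h' := by
    rw [hX.diag i k j l h h', ← algebraMap_smul F ((u : A) - _), map_sub]
    rfl

theorem pairContent_right_injective {m n : ℕ} {L M M' : Fin m ↪o Fin n}
    (h : pairContent L M = pairContent L M') : M = M' := by
  have hval := Finset.val_injective (add_left_cancel h)
  refine OrderEmbedding.range_inj.1 (Set.ext fun x => ?_)
  simpa using Finset.ext_iff.1 hval x

/-- In the expansion of `[I][J]` in standard products of the same content, the first factors of the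
terms that occur lie below both `I` and `J`. -/
theorem le_of_coeff_ne_zero {A F : Type*} [CommRing A] [Field F] [Algebra A F]
    [FaithfulSMul A F] {m n : ℕ} {u : Fˣ} [Algebra A (QuantumMat F u m n)]
    [IsScalarTower A F (QuantumMat F u m n)] {I J : Fin m ↪o Fin n}
    {P : Finset ((Fin m ↪o Fin n) × (Fin m ↪o Fin n))} {k : (Fin m ↪o Fin n) × (Fin m ↪o Fin n) → A}
    (hP : ∀ p ∈ P, p.1 ≤ p.2 ∧ pairContent p.1 p.2 = pairContent I J)
    (hk : ∑ p ∈ P, k p • (maxMinor (u : F) (qX F u) p.1 * maxMinor (u : F) (qX F u) p.2) =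
      maxMinor (u : F) (qX F u) I * maxMinor (u : F) (qX F u) J) :
    ∀ p ∈ P, k p ≠ 0 → p.1 ≤ I ∧ p.1 ≤ J := by
  classical
  by_contra! hbad
  obtain ⟨p, hp, hmax⟩ := (P.filter fun p => k p ≠ 0 ∧ (p.1 ≤ I → ¬ p.1 ≤ J)).exists_maximalFor
    Prod.fst (by
      obtain ⟨p, hp, h⟩ := hbad
      exact ⟨p, Finset.mem_filter.2 ⟨hp, h⟩⟩)
  rw [Finset.mem_filter] at hp
  obtain ⟨hpP, hkp, hpIJ⟩ := hp
  obtain ⟨f, hf, hsep⟩ := exists_functional_of_le (F := F) (u := u) (hP p hpP).1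
  have hzero : f (maxMinor (u : F) (qX F u) I * maxMinor (u : F) (qX F u) J) = 0 := by
    by_contra h
    obtain ⟨h1, h2⟩ := hsep I J (hP p hpP).2.symm h
    exact hpIJ h1 h2
  rw [← hk, map_sum, Finset.sum_eq_single p] at hzero
  · rw [LinearMap.map_smul_of_tower, Algebra.smul_def, mul_eq_zero] at hzero
    rcases hzero with h | h
    · exact hkp ((map_eq_zero_iff _ (FaithfulSMul.algebraMap_injective A F)).1 h)
    · exact hf h
  · intro q hq hqp
    by_contra h
    rw [LinearMap.map_smul_of_tower] at h
    have hkq : k q ≠ 0 := fun h' => h (by rw [h', zero_smul])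
    have hcont : pairContent q.1 q.2 = pairContent p.1 p.2 :=
      (hP q hq).2.trans (hP p hpP).2.symm
    have hle := (hsep q.1 q.2 hcont fun h' => h (by rw [h', smul_zero])).1
    by_cases hqIJ : q.1 ≤ I → ¬ q.1 ≤ J
    · have heq : q.1 = p.1 := le_antisymm (hmax (Finset.mem_filter.2 ⟨hq, hkq, hqIJ⟩) hle) hle
      rw [heq] at hcont
      exact hqp (Prod.ext heq (pairContent_right_injective hcont))
    · push Not at hqIJ
      exact hpIJ (hle.trans hqIJ.1) (hle.trans hqIJ.2)
  · exact fun h => absurd hpP h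

end Straightening

/-- Let `A` be a commutative integral domain, `u` a unit of `A`, and
`m ≤ n` positive integers.  If `I, J ∈ Π_{m,n}` are incomparable for `≤st`, then in
`O_u(G_{m,n}(A))` (inside `O_u(M_{m,n}(Frac A))`) the product `[I][J]` is an `A`-linear
combination `Σᵢ kᵢ [Iᵢ][Jᵢ]` with `Iᵢ ≤st Jᵢ`, `Iᵢ <st I` and `Iᵢ <st J`. -/
theorem quantumGrassmannian_straightening (A : Type*) [CommRing A] [IsDomain A]
    (u : Aˣ) (m n : ℕ) (hm : 0 < m) (hmn : m ≤ n)
    (I J : Fin m ↪o Fin n) (hIJ : ¬ I ≤ J) (hJI : ¬ J ≤ I) :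
    qMaximalMinor _ (uFrac A u) I * qMaximalMinor _ (uFrac A u) J ∈
      Submodule.span A
        {x : QuantumMat (FractionRing A) (uFrac A u) m n |
          ∃ L M : Fin m ↪o Fin n, L ≤ M ∧ L < I ∧ L < J ∧
            x = qMaximalMinor _ (uFrac A u) L * qMaximalMinor _ (uFrac A u) M} := by
  have hX := isQuantumMatrix_qX_s11 (FractionRing A) (uFrac A u) m n
  have hXA : IsQuantumMatrix_s11 u _ := hX.restrictScalars
  have hminor : ∀ L : Fin m ↪o Fin n,
      maxMinor (u : A) (qX (FractionRing A) (uFrac A u)) L = qMaximalMinor _ (uFrac A u) L :=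
    fun L => by
      rw [qMaximalMinor_eq_maxMinor]
      exact (wordMinor_algebraMap (u : A) _ _ _).symm
  have hspan := maxMinor_mul_mem_span hXA I J
  simp only [hminor] at hspan
  classical
  have := Fintype.ofFinite (Fin m ↪o Fin n)
  set P : Finset ((Fin m ↪o Fin n) × (Fin m ↪o Fin n)) :=
    Finset.univ.filter fun p => p.1 ≤ p.2 ∧ pairContent p.1 p.2 = pairContent I J with hPdef
  have himage : {x | ∃ L M : Fin m ↪o Fin n, L ≤ M ∧ pairContent L M = pairContent I J ∧
      x = qMaximalMinor _ (uFrac A u) L * qMaximalMinor _ (uFrac A u) M} =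
      (fun p : (Fin m ↪o Fin n) × (Fin m ↪o Fin n) =>
        qMaximalMinor _ (uFrac A u) p.1 * qMaximalMinor _ (uFrac A u) p.2) '' P := by
    ext x
    constructor
    · rintro ⟨L, M, h1, h2, rfl⟩
      exact ⟨(L, M), by simp [hPdef, h1, h2], rfl⟩
    · rintro ⟨⟨L, M⟩, hp, rfl⟩
      simp only [hPdef, Finset.coe_filter, Finset.mem_univ, true_and, Set.mem_ofPred_eq] at hp
      exact ⟨L, M, hp.1, hp.2, rfl⟩
  rw [himage, Submodule.mem_span_image_finset_iff_exists_fun'] at hspan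
  obtain ⟨k, hk⟩ := hspan
  have hle := le_of_coeff_ne_zero (A := A) (I := I) (J := J) (P := P) (k := k)
    (fun p hp => (Finset.mem_filter.1 hp).2) (by simpa only [qMaximalMinor_eq_maxMinor] using hk)
  rw [← hk]
  refine Submodule.sum_mem _ fun p hp => ?_
  by_cases hkp : k p = 0
  · rw [hkp, zero_smul]
    exact Submodule.zero_mem _
  · obtain ⟨h1, h2⟩ := hle p hp hkp
    refine Submodule.smul_mem _ _ (Submodule.subset_span
      ⟨p.1, p.2, (Finset.mem_filter.1 hp).2.1, lt_of_le_of_ne h1 ?_, lt_of_le_of_ne h2 ?_, rfl⟩)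
    · exact fun h => hIJ (h ▸ h2)
    · exact fun h => hJI (h ▸ h1)
end
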